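/- Let M be an even lattice of signature (2,n) with n ≥ 3 and L an even positive-definite lattice. If M ⊕ L(−1) is reflective, then M is reflective; if M ⊕ L(−1) is 2-reflective, then M is 2-reflective. -/

import Mathlib

open Matrix

namespace Refl

noncomputable section

variable {n : ℕ}

/-- ℂ-bilinear extension of the Gram pairing. -/
def cpair (B : Matrix (Fin n) (Fin n) ℤ) (Z W : Fin n → ℂ) : ℂ :=
  ∑ i, ∑ j, (B i j : ℂ) * Z i * W j

/-- ℚ-bilinear extension of the Gram pairing. -/
def qpair (B : Matrix (Fin n) (Fin n) ℤ) (x y : Fin n → ℚ) : ℚ :=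
  ∑ i, ∑ j, (B i j : ℚ) * x i * y j

/-- ℝ-bilinear extension of the Gram pairing. -/
def rpair (B : Matrix (Fin n) (Fin n) ℤ) (x y : Fin n → ℝ) : ℝ :=
  ∑ i, ∑ j, (B i j : ℝ) * x i * y j

def intQ (v : Fin n → ℤ) : Fin n → ℚ := fun i => (v i : ℚ)

def intR (v : Fin n → ℤ) : Fin n → ℝ := fun i => (v i : ℝ)

def intC (v : Fin n → ℤ) : Fin n → ℂ := fun i => (v i : ℂ)

def ratR (v : Fin n → ℚ) : Fin n → ℝ := fun i => (v i : ℝ)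

def ratC (v : Fin n → ℚ) : Fin n → ℂ := fun i => (v i : ℂ)

/-- (v, v) for an integral vector. -/
def qnorm (B : Matrix (Fin n) (Fin n) ℤ) (v : Fin n → ℤ) : ℤ := v ⬝ᵥ B.mulVec v

/-- Membership in the dual lattice (a vector of ℚ^n pairing integrally with the lattice). -/
def InDual (B : Matrix (Fin n) (Fin n) ℤ) (x : Fin n → ℚ) : Prop :=
  ∀ y : Fin n → ℤ, ∃ m : ℤ, qpair B x (intQ y) = (m : ℚ)

/-- A rational vector lies in the lattice ℤ^n itself. -/
def InLat (x : Fin n → ℚ) : Prop := ∃ w : Fin n → ℤ, x = intQ w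

/-- `B` is the Gram matrix of an even nondegenerate lattice of signature (p,q). -/
def IsEvenLatticeOfSignature (B : Matrix (Fin n) (Fin n) ℤ) (p q : ℕ) : Prop :=
  n = p + q ∧ B.IsSymm ∧ (∀ x : Fin n → ℤ, 2 ∣ qnorm B x) ∧ B.det ≠ 0 ∧
    ∃ P : Matrix (Fin n) (Fin n) ℝ, IsUnit P.det ∧
      Pᵀ * B.map (Int.cast : ℤ → ℝ) * P =
        Matrix.diagonal (fun i : Fin n => if (i : ℕ) < p then (1 : ℝ) else -1)

/-- `B` is the Gram matrix of an even positive-definite lattice. -/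
def IsEvenPosDef (B : Matrix (Fin n) (Fin n) ℤ) : Prop :=
  B.IsSymm ∧ (∀ x : Fin n → ℤ, 2 ∣ qnorm B x) ∧ (B.map (Int.cast : ℤ → ℝ)).PosDef

/-- The cone {Z | (Z,Z) = 0, (Z,conj Z) > 0}. -/
def Cone (B : Matrix (Fin n) (Fin n) ℤ) : Set (Fin n → ℂ) :=
  {Z | cpair B Z Z = 0 ∧ 0 < (cpair B Z (fun i => (starRingEnd ℂ) (Z i))).re}

/-- `D` is one of the connected components of the cone (the affine cone `D•(M)`). -/
def IsComponent (B : Matrix (Fin n) (Fin n) ℤ) (D : Set (Fin n → ℂ)) : Prop :=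
  ∃ Z ∈ Cone B, D = connectedComponentIn (Cone B) Z

/-- The action of an integral matrix on ℂ^n. -/
def actC (g : Matrix (Fin n) (Fin n) ℤ) (Z : Fin n → ℂ) : Fin n → ℂ :=
  (g.map (Int.cast : ℤ → ℂ)).mulVec Z

/-- The group O⁺(M): integral isometries preserving the chosen component. -/
def OPlus (B : Matrix (Fin n) (Fin n) ℤ) (D : Set (Fin n → ℂ)) :
    Set (Matrix (Fin n) (Fin n) ℤ) :=
  {g | gᵀ * B * g = B ∧ actC g '' D = D}

/-- The stable orthogonal group Õ⁺(M): elements of O⁺(M) acting trivially on M^∨/M. -/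
def StableOPlus (B : Matrix (Fin n) (Fin n) ℤ) (D : Set (Fin n → ℂ)) :
    Set (Matrix (Fin n) (Fin n) ℤ) :=
  {g | g ∈ OPlus B D ∧ ∀ x : Fin n → ℚ, InDual B x →
        ∃ w : Fin n → ℤ, (g.map (Int.cast : ℤ → ℚ)).mulVec x - x = intQ w}

/-- `Γ` is a finite-index subgroup of O⁺(M). -/
structure IsFiniteIndexSubgroup (B : Matrix (Fin n) (Fin n) ℤ) (D : Set (Fin n → ℂ))
    (Γ : Set (Matrix (Fin n) (Fin n) ℤ)) : Prop where
  subset : Γ ⊆ OPlus B D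
  one_mem : (1 : Matrix (Fin n) (Fin n) ℤ) ∈ Γ
  mul_mem : ∀ g ∈ Γ, ∀ h ∈ Γ, g * h ∈ Γ
  inv_mem : ∀ g ∈ Γ, ∃ h ∈ Γ, g * h = 1 ∧ h * g = 1
  finite_index : ∃ S : Finset (Matrix (Fin n) (Fin n) ℤ),
    ∀ g ∈ OPlus B D, ∃ s ∈ S, ∃ γ ∈ Γ, g = s * γ

/-- `χ` is a character Γ → ℂ× with finite image (equivalently, of finite order). -/
structure IsCharacter (Γ : Set (Matrix (Fin n) (Fin n) ℤ))
    (χ : Matrix (Fin n) (Fin n) ℤ → ℂ) : Prop where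
  ne_zero : ∀ g ∈ Γ, χ g ≠ 0
  map_mul : ∀ g ∈ Γ, ∀ h ∈ Γ, χ (g * h) = χ g * χ h
  finite_image : (χ '' Γ).Finite

/-- `F` is a modular form of weight `k` and character `χ` for `Γ` on the component `D`. -/
structure IsModularForm (B : Matrix (Fin n) (Fin n) ℤ) (D : Set (Fin n → ℂ))
    (Γ : Set (Matrix (Fin n) (Fin n) ℤ)) (χ : Matrix (Fin n) (Fin n) ℤ → ℂ)
    (k : ℤ) (F : (Fin n → ℂ) → ℂ) : Prop where
  holo : DifferentiableOn ℂ F D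
  homogeneous : ∀ t : ℂ, t ≠ 0 → ∀ Z ∈ D, F (t • Z) = t ^ (-k) * F Z
  equivariant : ∀ g ∈ Γ, ∀ Z ∈ D, F (actC g Z) = χ g * F Z

def NonConstantOn (D : Set (Fin n → ℂ)) (F : (Fin n → ℂ) → ℂ) : Prop :=
  ¬ ∃ c : ℂ, ∀ Z ∈ D, F Z = c

/-- `Z` lies on the rational quadratic divisor of the integral vector `v`. -/
def OrthZ (B : Matrix (Fin n) (Fin n) ℤ) (Z : Fin n → ℂ) (v : Fin n → ℤ) : Prop :=
  cpair B Z (intC v) = 0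

/-- `F` is nonconstant and its zero set is contained in hyperplanes of (-2)-vectors. -/
def Is2ReflectiveForm (B : Matrix (Fin n) (Fin n) ℤ) (D : Set (Fin n → ℂ))
    (F : (Fin n → ℂ) → ℂ) : Prop :=
  NonConstantOn D F ∧
    ∀ Z ∈ D, F Z = 0 → ∃ v : Fin n → ℤ, qnorm B v = -2 ∧ OrthZ B Z v

/-- The lattice is 2-reflective. -/
def Is2Reflective (B : Matrix (Fin n) (Fin n) ℤ) : Prop :=
  ∃ D : Set (Fin n → ℂ), IsComponent B D ∧
    ∃ (Γ : Set (Matrix (Fin n) (Fin n) ℤ)) (χ : Matrix (Fin n) (Fin n) ℤ → ℂ)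
      (k : ℤ) (F : (Fin n → ℂ) → ℂ),
      IsFiniteIndexSubgroup B D Γ ∧ IsCharacter Γ χ ∧
      IsModularForm B D Γ χ k F ∧ Is2ReflectiveForm B D F

/-- Primitivity of an integral vector : ℚv ∩ ℤ^n = ℤv. -/
def IsPrimitive (v : Fin n → ℤ) : Prop :=
  v ≠ 0 ∧ ∀ (a : ℚ) (w : Fin n → ℤ), (∀ i, a * (v i : ℚ) = (w i : ℚ)) →
    ∃ m : ℤ, w = m • v

/-- The reflection σ_v maps the lattice into itself. -/
def ReflPreservesLat (B : Matrix (Fin n) (Fin n) ℤ) (v : Fin n → ℤ) : Prop :=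
  ∀ x : Fin n → ℤ, ∃ y : Fin n → ℤ, ∀ i,
    (x i : ℚ) - (2 * ((x ⬝ᵥ B.mulVec v : ℤ) : ℚ) / (qnorm B v : ℚ)) * (v i : ℚ) = (y i : ℚ)

/-- The ℂ-linear extension of the reflection σ_v. -/
def reflC (B : Matrix (Fin n) (Fin n) ℤ) (v : Fin n → ℤ) (Z : Fin n → ℂ) : Fin n → ℂ :=
  fun i => Z i - (2 * cpair B Z (intC v) / (qnorm B v : ℂ)) * (v i : ℂ)

/-- `v` is a reflective vector of the lattice `M` (w.r.t. the component `D`). -/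
def IsReflectiveVector (B : Matrix (Fin n) (Fin n) ℤ) (D : Set (Fin n → ℂ))
    (v : Fin n → ℤ) : Prop :=
  IsPrimitive v ∧ qnorm B v < 0 ∧ ReflPreservesLat B v ∧ reflC B v '' D = D

/-- `F` is nonconstant and its zero set is contained in hyperplanes of reflective vectors. -/
def IsReflectiveForm (B : Matrix (Fin n) (Fin n) ℤ) (D : Set (Fin n → ℂ))
    (F : (Fin n → ℂ) → ℂ) : Prop :=
  NonConstantOn D F ∧
    ∀ Z ∈ D, F Z = 0 → ∃ v : Fin n → ℤ, IsReflectiveVector B D v ∧ OrthZ B Z v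

/-- The lattice is reflective. -/
def IsReflective (B : Matrix (Fin n) (Fin n) ℤ) : Prop :=
  ∃ D : Set (Fin n → ℂ), IsComponent B D ∧
    ∃ (Γ : Set (Matrix (Fin n) (Fin n) ℤ)) (χ : Matrix (Fin n) (Fin n) ℤ → ℂ)
      (k : ℤ) (F : (Fin n → ℂ) → ℂ),
      IsFiniteIndexSubgroup B D Γ ∧ IsCharacter Γ χ ∧
      IsModularForm B D Γ χ k F ∧ IsReflectiveForm B D F

/-- Isomorphism of lattices given by Gram matrices. -/
def LatIso {m n : ℕ} (A : Matrix (Fin m) (Fin m) ℤ) (B : Matrix (Fin n) (Fin n) ℤ) : Prop :=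
  ∃ e : (Fin m → ℤ) ≃ₗ[ℤ] (Fin n → ℤ), ∀ x y : Fin m → ℤ,
    e x ⬝ᵥ B.mulVec (e y) = x ⬝ᵥ A.mulVec y

/-- Orthogonal direct sum of lattices. -/
def dsum {m n : ℕ} (A : Matrix (Fin m) (Fin m) ℤ) (B : Matrix (Fin n) (Fin n) ℤ) :
    Matrix (Fin (m + n)) (Fin (m + n)) ℤ :=
  Matrix.reindex finSumFinEquiv finSumFinEquiv (Matrix.fromBlocks A 0 0 B)

/-- The hyperbolic plane U. -/
def U : Matrix (Fin 2) (Fin 2) ℤ := !![0, 1; 1, 0]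

/-- Gram matrix of the root lattice A_m. -/
def gramA (m : ℕ) : Matrix (Fin m) (Fin m) ℤ :=
  Matrix.of fun i j =>
    if i = j then 2 else if i.val + 1 = j.val ∨ j.val + 1 = i.val then -1 else 0

/-- Gram matrix of the root lattice D_m. -/
def gramD (m : ℕ) : Matrix (Fin m) (Fin m) ℤ :=
  Matrix.of fun i j =>
    if i = j then 2
    else if (i.val + 1 = j.val ∧ j.val + 1 ≠ m) ∨ (j.val + 1 = i.val ∧ i.val + 1 ≠ m) then -1
    else if (i.val + 3 = m ∧ j.val + 1 = m) ∨ (j.val + 3 = m ∧ i.val + 1 = m) then -1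
    else 0

/-- Gram matrix of the root lattice E_6. -/
def gramE6 : Matrix (Fin 6) (Fin 6) ℤ :=
  !![2, -1, 0, 0, 0, 0;
     -1, 2, -1, 0, 0, 0;
     0, -1, 2, -1, 0, -1;
     0, 0, -1, 2, -1, 0;
     0, 0, 0, -1, 2, 0;
     0, 0, -1, 0, 0, 2]

/-- Gram matrix of the root lattice E_7. -/
def gramE7 : Matrix (Fin 7) (Fin 7) ℤ :=
  !![2, -1, 0, 0, 0, 0, 0;
     -1, 2, -1, 0, 0, 0, 0;
     0, -1, 2, -1, 0, 0, -1;
     0, 0, -1, 2, -1, 0, 0;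
     0, 0, 0, -1, 2, -1, 0;
     0, 0, 0, 0, -1, 2, 0;
     0, 0, -1, 0, 0, 0, 2]

/-- Gram matrix of the root lattice E_8. -/
def gramE8 : Matrix (Fin 8) (Fin 8) ℤ :=
  !![2, -1, 0, 0, 0, 0, 0, 0;
     -1, 2, -1, 0, 0, 0, 0, 0;
     0, -1, 2, -1, 0, 0, 0, -1;
     0, 0, -1, 2, -1, 0, 0, 0;
     0, 0, 0, -1, 2, -1, 0, 0;
     0, 0, 0, 0, -1, 2, -1, 0;
     0, 0, 0, 0, 0, -1, 2, 0;
     0, 0, -1, 0, 0, 0, 0, 2]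

/-- Gram matrix of the Nikulin lattice N_8 (basis a_1,…,a_7,h with h=(a_1+⋯+a_8)/2). -/
def gramN8 : Matrix (Fin 8) (Fin 8) ℤ :=
  Matrix.of fun i j =>
    if i = j then (if i.val = 7 then 4 else 2)
    else if i.val = 7 ∨ j.val = 7 then 1 else 0

/-- The lattice M = 2U ⊕ L(−1). -/
def M2U {r : ℕ} (L : Matrix (Fin r) (Fin r) ℤ) :
    Matrix (Fin (2 + (2 + r))) (Fin (2 + (2 + r))) ℤ :=
  dsum U (dsum U (-L))

/-- div(v) = d : the ideal (v, M) of ℤ is generated by d. -/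
def DivEq (B : Matrix (Fin n) (Fin n) ℤ) (v : Fin n → ℤ) (d : ℤ) : Prop :=
  Ideal.span {a : ℤ | ∃ x : Fin n → ℤ, a = v ⬝ᵥ B.mulVec x} = Ideal.span {d}

/-- Sum-of-divisors function σ₁ (on nonnegative integers). -/
def sigma1 (m : ℤ) : ℤ := ∑ d ∈ m.toNat.divisors, (d : ℤ)

end

end Refl

namespace Refl

section Pairing

variable {n : ℕ} (B : Matrix (Fin n) (Fin n) ℤ)

lemma cpair_add_left (X Y W : Fin n → ℂ) :
    cpair B (X + Y) W = cpair B X W + cpair B Y W := by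
  simp [cpair, mul_add, add_mul, Finset.sum_add_distrib]

lemma cpair_add_right (X Y W : Fin n → ℂ) :
    cpair B W (X + Y) = cpair B W X + cpair B W Y := by
  simp [cpair, mul_add, Finset.sum_add_distrib]

lemma cpair_smul_left (c : ℂ) (X W : Fin n → ℂ) :
    cpair B (c • X) W = c * cpair B X W := by
  simp only [cpair, Finset.mul_sum, Pi.smul_apply, smul_eq_mul]
  exact Finset.sum_congr rfl fun i _ => Finset.sum_congr rfl fun j _ => by ring

lemma cpair_smul_right (c : ℂ) (X W : Fin n → ℂ) :
    cpair B W (c • X) = c * cpair B W X := by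
  simp only [cpair, Finset.mul_sum, Pi.smul_apply, smul_eq_mul]
  exact Finset.sum_congr rfl fun i _ => Finset.sum_congr rfl fun j _ => by ring

lemma cpair_neg_left (X W : Fin n → ℂ) : cpair B (-X) W = - cpair B X W := by
  simp [cpair]

lemma cpair_neg_right (X W : Fin n → ℂ) : cpair B W (-X) = - cpair B W X := by
  simp [cpair]

lemma cpair_sub_left (X Y W : Fin n → ℂ) :
    cpair B (X - Y) W = cpair B X W - cpair B Y W := by
  rw [sub_eq_add_neg, cpair_add_left, cpair_neg_left, sub_eq_add_neg]

lemma cpair_sub_right (X Y W : Fin n → ℂ) :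
    cpair B W (X - Y) = cpair B W X - cpair B W Y := by
  rw [sub_eq_add_neg, cpair_add_right, cpair_neg_right, sub_eq_add_neg]

lemma cpair_comm {B : Matrix (Fin n) (Fin n) ℤ} (hB : B.IsSymm) (X Y : Fin n → ℂ) :
    cpair B X Y = cpair B Y X := by
  unfold cpair
  rw [Finset.sum_comm]
  refine Finset.sum_congr rfl fun i _ => Finset.sum_congr rfl fun j _ => ?_
  rw [hB.apply i j]
  ring

lemma cpair_eq_dotProduct (X Y : Fin n → ℂ) :
    cpair B X Y = X ⬝ᵥ (B.map (Int.cast : ℤ → ℂ)) *ᵥ Y := by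
  simp only [cpair, dotProduct, mulVec, map_apply, Finset.mul_sum]
  exact Finset.sum_congr rfl fun i _ => Finset.sum_congr rfl fun j _ => by ring

lemma rpair_eq_dotProduct (X Y : Fin n → ℝ) :
    rpair B X Y = X ⬝ᵥ (B.map (Int.cast : ℤ → ℝ)) *ᵥ Y := by
  simp only [rpair, dotProduct, mulVec, map_apply, Finset.mul_sum]
  exact Finset.sum_congr rfl fun i _ => Finset.sum_congr rfl fun j _ => by ring

/-- Coordinatewise complex conjugation. -/
def cj (Z : Fin n → ℂ) : Fin n → ℂ := fun i => (starRingEnd ℂ) (Z i)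

@[simp] lemma cj_cj (Z : Fin n → ℂ) : cj (cj Z) = Z := by
  ext i; simp [cj]

lemma cj_add (Z W : Fin n → ℂ) : cj (Z + W) = cj Z + cj W := by
  ext i; simp [cj]

lemma cj_sub (Z W : Fin n → ℂ) : cj (Z - W) = cj Z - cj W := by
  ext i; simp [cj]

lemma cj_smul (c : ℂ) (Z : Fin n → ℂ) : cj (c • Z) = (starRingEnd ℂ c) • cj Z := by
  ext i; simp [cj]

lemma continuous_cj : Continuous (cj : (Fin n → ℂ) → Fin n → ℂ) :=
  continuous_pi fun i => Complex.continuous_conj.comp (continuous_apply i)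

lemma cpair_cj (Z W : Fin n → ℂ) : cpair B (cj Z) (cj W) = starRingEnd ℂ (cpair B Z W) := by
  simp [cpair, cj]

lemma cpair_cj_left (Z W : Fin n → ℂ) :
    cpair B (cj Z) W = starRingEnd ℂ (cpair B Z (cj W)) := by
  rw [← cpair_cj, cj_cj]

@[fun_prop]
lemma continuous_cpair_comp {α : Type*} [TopologicalSpace α] {f g : α → Fin n → ℂ}
    (hf : Continuous f) (hg : Continuous g) : Continuous fun a => cpair B (f a) (g a) := by
  unfold cpair
  fun_prop

lemma differentiableAt_cpair {E : Type*} [NormedAddCommGroup E] [NormedSpace ℂ E]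
    {f g : E → Fin n → ℂ} {x : E} (hf : DifferentiableAt ℂ f x) (hg : DifferentiableAt ℂ g x) :
    DifferentiableAt ℂ (fun a => cpair B (f a) (g a)) x := by
  have hf' := fun i => (differentiableAt_pi.1 hf i)
  have hg' := fun i => (differentiableAt_pi.1 hg i)
  unfold cpair
  refine DifferentiableAt.fun_sum fun i _ => DifferentiableAt.fun_sum fun j _ => ?_
  exact ((hf' i).const_mul _).mul (hg' j)

/-- The complexification of a real vector. -/
def realC (x : Fin n → ℝ) : Fin n → ℂ := fun i => (x i : ℂ)

/-- The real part of a complex vector. -/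
def reV (Z : Fin n → ℂ) : Fin n → ℝ := fun i => (Z i).re

/-- The imaginary part of a complex vector. -/
def imV (Z : Fin n → ℂ) : Fin n → ℝ := fun i => (Z i).im

lemma realC_add_im (Z : Fin n → ℂ) : realC (reV Z) + Complex.I • realC (imV Z) = Z := by
  ext i
  simp only [realC, reV, imV, Pi.add_apply, Pi.smul_apply, smul_eq_mul]
  rw [mul_comm, Complex.re_add_im]

@[simp] lemma cj_realC (x : Fin n → ℝ) : cj (realC x) = realC x := by
  ext i; simp [cj, realC]

lemma realC_add (x y : Fin n → ℝ) : realC (x + y) = realC x + realC y := by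
  ext i; simp [realC]

lemma realC_smul (c : ℝ) (x : Fin n → ℝ) : realC (c • x) = (c : ℂ) • realC x := by
  ext i; simp [realC]

lemma cpair_realC (x y : Fin n → ℝ) : cpair B (realC x) (realC y) = (rpair B x y : ℂ) := by
  simp [cpair, rpair, realC]

lemma intC_eq_realC (v : Fin n → ℤ) : intC v = realC (intR v) := by
  ext i; simp [intC, intR, realC]

lemma rpair_intR (v w : Fin n → ℤ) : rpair B (intR v) (intR w) = ((v ⬝ᵥ B *ᵥ w : ℤ) : ℝ) := by
  simp only [rpair, intR, dotProduct, mulVec, Finset.mul_sum]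
  push_cast
  exact Finset.sum_congr rfl fun i _ => Finset.sum_congr rfl fun j _ => by ring

lemma rpair_intR_self (v : Fin n → ℤ) : rpair B (intR v) (intR v) = (qnorm B v : ℝ) :=
  rpair_intR B v v

lemma rpair_add_left (X Y W : Fin n → ℝ) :
    rpair B (X + Y) W = rpair B X W + rpair B Y W := by
  simp [rpair, mul_add, add_mul, Finset.sum_add_distrib]

lemma rpair_add_right (X Y W : Fin n → ℝ) :
    rpair B W (X + Y) = rpair B W X + rpair B W Y := by
  simp [rpair, mul_add, Finset.sum_add_distrib]

lemma rpair_smul_left (c : ℝ) (X W : Fin n → ℝ) :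
    rpair B (c • X) W = c * rpair B X W := by
  simp only [rpair, Finset.mul_sum, Pi.smul_apply, smul_eq_mul]
  exact Finset.sum_congr rfl fun i _ => Finset.sum_congr rfl fun j _ => by ring

lemma rpair_smul_right (c : ℝ) (X W : Fin n → ℝ) :
    rpair B W (c • X) = c * rpair B W X := by
  simp only [rpair, Finset.mul_sum, Pi.smul_apply, smul_eq_mul]
  exact Finset.sum_congr rfl fun i _ => Finset.sum_congr rfl fun j _ => by ring

lemma rpair_sub_left (X Y W : Fin n → ℝ) :
    rpair B (X - Y) W = rpair B X W - rpair B Y W := by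
  simp [rpair, mul_sub, sub_mul, Finset.sum_sub_distrib]

lemma rpair_sub_right (X Y W : Fin n → ℝ) :
    rpair B W (X - Y) = rpair B W X - rpair B W Y := by
  simp [rpair, mul_sub, Finset.sum_sub_distrib]

lemma rpair_comm {B : Matrix (Fin n) (Fin n) ℤ} (hB : B.IsSymm) (X Y : Fin n → ℝ) :
    rpair B X Y = rpair B Y X := by
  have := cpair_comm hB (realC X) (realC Y)
  rw [cpair_realC, cpair_realC] at this
  exact_mod_cast this

@[fun_prop]
lemma continuous_rpair_comp {α : Type*} [TopologicalSpace α] {f g : α → Fin n → ℝ}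
    (hf : Continuous f) (hg : Continuous g) : Continuous fun a => rpair B (f a) (g a) := by
  unfold rpair
  fun_prop

lemma mem_cone {B : Matrix (Fin n) (Fin n) ℤ} {Z : Fin n → ℂ} :
    Z ∈ Cone B ↔ cpair B Z Z = 0 ∧ 0 < (cpair B Z (cj Z)).re := Iff.rfl

lemma cj_mem_cone {B : Matrix (Fin n) (Fin n) ℤ} (hB : B.IsSymm) {Z : Fin n → ℂ}
    (hZ : Z ∈ Cone B) : cj Z ∈ Cone B := by
  rw [mem_cone] at *
  rw [cj_cj, cpair_cj, hZ.1, cpair_comm hB]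
  exact ⟨map_zero _, hZ.2⟩

lemma cpair_cj_self_eq_re {B : Matrix (Fin n) (Fin n) ℤ} (hB : B.IsSymm) (Z : Fin n → ℂ) :
    cpair B Z (cj Z) = ((cpair B Z (cj Z)).re : ℂ) := by
  have h : starRingEnd ℂ (cpair B Z (cj Z)) = cpair B Z (cj Z) := by
    rw [← cpair_cj_left, cpair_comm hB]
  exact (Complex.conj_eq_iff_re.1 h).symm

lemma smul_mem_cone {B : Matrix (Fin n) (Fin n) ℤ} {Z : Fin n → ℂ}
    (hZ : Z ∈ Cone B) {t : ℂ} (ht : t ≠ 0) : t • Z ∈ Cone B := by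
  rw [mem_cone] at *
  rw [cj_smul]
  simp only [cpair_smul_left, cpair_smul_right, hZ.1, mul_zero, true_and]
  rw [← mul_assoc, mul_comm _ t, Complex.mul_conj, Complex.re_ofReal_mul]
  exact mul_pos (Complex.normSq_pos.2 ht) hZ.2

/-- `rpair` in terms of the real and imaginary parts of a point of the cone. -/
lemma cone_re_im {B : Matrix (Fin n) (Fin n) ℤ} (hB : B.IsSymm) {Z : Fin n → ℂ}
    (hZ : Z ∈ Cone B) :
    rpair B (reV Z) (imV Z) = 0 ∧ rpair B (reV Z) (reV Z) = rpair B (imV Z) (imV Z) ∧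
      (cpair B Z (cj Z)).re = 2 * rpair B (reV Z) (reV Z) := by
  obtain ⟨h1, -⟩ := mem_cone.1 hZ
  have e : Z = realC (reV Z) + Complex.I • realC (imV Z) := (realC_add_im Z).symm
  have h0 : cpair B Z Z = (rpair B (reV Z) (reV Z) - rpair B (imV Z) (imV Z) : ℝ) +
      (2 * rpair B (reV Z) (imV Z) : ℝ) * Complex.I := by
    conv_lhs => rw [e]
    simp only [cpair_add_left, cpair_add_right, cpair_smul_left, cpair_smul_right, cpair_realC]
    rw [rpair_comm hB (imV Z) (reV Z)]
    push_cast
    ring_nf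
    rw [Complex.I_sq]; ring
  have h2 : cpair B Z (cj Z) = (rpair B (reV Z) (reV Z) + rpair B (imV Z) (imV Z) : ℝ) := by
    conv_lhs => rw [e]
    simp only [cj_add, cj_smul, cj_realC, Complex.conj_I, cpair_add_left, cpair_add_right,
      cpair_smul_left, cpair_smul_right, cpair_realC]
    rw [rpair_comm hB (imV Z) (reV Z)]
    push_cast
    ring_nf
    rw [Complex.I_sq]; ring
  rw [h0] at h1
  have hr := congrArg Complex.re h1
  have hi := congrArg Complex.im h1
  simp at hr hi
  refine ⟨hi, by linarith, ?_⟩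
  rw [h2, Complex.ofReal_re]
  linarith

/-- Symmetric forms whose positive part has dimension at most two. -/
structure Hyp (B : Matrix (Fin n) (Fin n) ℤ) : Prop where
  symm : B.IsSymm
  neg : ∃ T : (Fin n → ℝ) →ₗ[ℝ] (Fin 2 → ℝ), ∀ w, w ≠ 0 → T w = 0 → rpair B w w < 0

/-- A real vector orthogonal to a point of the cone has negative norm. -/
lemma Hyp.neg_of_orth {B : Matrix (Fin n) (Fin n) ℤ} (hB : Hyp B) {Z : Fin n → ℂ}
    (hZ : Z ∈ Cone B) {w : Fin n → ℝ} (hw : w ≠ 0) (h : cpair B Z (realC w) = 0) :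
    rpair B w w < 0 := by
  obtain ⟨T, hT⟩ := hB.neg
  obtain ⟨h1, h2, h3⟩ := cone_re_im hB.symm hZ
  have hpos := (mem_cone.1 hZ).2
  set x := reV Z
  set y := imV Z
  rw [← realC_add_im Z] at h
  simp only [cpair_add_left, cpair_smul_left, cpair_realC] at h
  have hx : rpair B x w = 0 := by simpa using congrArg Complex.re h
  have hy : rpair B y w = 0 := by simpa using congrArg Complex.im h
  let S : (Fin 3 → ℝ) →ₗ[ℝ] (Fin n → ℝ) := Fintype.linearCombination ℝ ![x, y, w]
  have hS : ∀ c, S c = c 0 • x + c 1 • y + c 2 • w := by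
    intro c
    simp [S, Fintype.linearCombination_apply, Fin.sum_univ_three]
  have hker : (T ∘ₗ S).ker ≠ ⊥ := LinearMap.ker_ne_bot_of_finrank_lt (by simp)
  obtain ⟨c, hc, hc0⟩ := (Submodule.ne_bot_iff _).1 hker
  have hc' : T (S c) = 0 := hc
  by_contra hneg
  push Not at hneg
  have hnorm : rpair B (S c) (S c) =
      (c 0 ^ 2 + c 1 ^ 2) * rpair B x x + c 2 ^ 2 * rpair B w w := by
    rw [hS]
    simp only [rpair_add_left, rpair_add_right, rpair_smul_left, rpair_smul_right]
    rw [rpair_comm hB.symm y x, rpair_comm hB.symm w x, rpair_comm hB.symm w y, h1, hx, hy, ← h2]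
    ring
  have hnn : 0 ≤ rpair B (S c) (S c) := by
    rw [hnorm]
    have : 0 < rpair B x x := by linarith
    positivity
  have hSc : S c = 0 := by
    by_contra hne
    exact absurd (hT _ hne hc') (not_lt.2 hnn)
  have hxx : rpair B x x ≠ 0 := by linarith
  have e0 : c 0 = 0 := by
    have : rpair B x (S c) = c 0 * rpair B x x := by
      rw [hS]
      simp only [rpair_add_right, rpair_smul_right, h1, hx]
      ring
    rw [hSc] at this
    have z : rpair B x 0 = 0 := by simp [rpair]
    rw [z] at this
    simpa [hxx] using this.symm
  have e1 : c 1 = 0 := by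
    have : rpair B y (S c) = c 1 * rpair B x x := by
      rw [hS]
      simp only [rpair_add_right, rpair_smul_right, rpair_comm hB.symm y x, h1, hy, ← h2]
      ring
    rw [hSc] at this
    have z : rpair B y 0 = 0 := by simp [rpair]
    rw [z] at this
    simpa [hxx] using this.symm
  have e2 : c 2 = 0 := by
    rw [hS, e0, e1] at hSc
    simpa [hw] using hSc
  apply hc0
  ext i
  fin_cases i <;> simp [e0, e1, e2]

/-- On the complex orthogonal complement of a point of the cone and its conjugate, the hermitian
form is negative and dominates the quadratic form. -/
lemma Hyp.norm_le_of_orth {B : Matrix (Fin n) (Fin n) ℤ} (hB : Hyp B) {Z : Fin n → ℂ}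
    (hZ : Z ∈ Cone B) {W : Fin n → ℂ} (h : cpair B Z W = 0) (h' : cpair B (cj Z) W = 0) :
    ‖cpair B W W‖ ≤ -(cpair B W (cj W)).re := by
  have key : ∀ W : Fin n → ℂ, cpair B Z W = 0 → cpair B (cj Z) W = 0 →
      (cpair B W W).re ≤ -(cpair B W (cj W)).re := by
    intro W h h'
    have h'' : cpair B Z (cj W) = 0 := by
      rw [← cj_cj Z, cpair_cj, h', map_zero]
    have e1 : realC (reV W) = (1 / 2 : ℂ) • (W + cj W) := by
      ext i
      simp [realC, reV, cj, Complex.add_conj]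
    have hr : cpair B Z (realC (reV W)) = 0 := by
      rw [e1, cpair_smul_right, cpair_add_right, h, h'']
      simp
    have hr' : rpair B (reV W) (reV W) ≤ 0 := by
      by_cases h0 : reV W = 0
      · rw [h0]; simp [rpair]
      · exact (hB.neg_of_orth hZ h0 hr).le
    have e2 : cpair B (realC (reV W)) (realC (reV W)) =
        (1 / 2) * (1 / 2) * (cpair B W W + starRingEnd ℂ (cpair B W W) +
          2 * cpair B W (cj W)) := by
      rw [e1, cpair_smul_left, cpair_smul_right, cpair_add_left, cpair_add_right, cpair_add_right,
        cpair_cj, cpair_comm hB.symm (cj W) W]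
      ring
    rw [cpair_realC] at e2
    have e3 := congrArg Complex.re e2
    rw [cpair_cj_self_eq_re hB.symm W, Complex.add_conj] at e3
    norm_num at e3
    have : rpair B (reV W) (reV W) =
      1 / 4 * (2 * (cpair B W W).re + 2 * (cpair B W (cj W)).re) := by
      rw [e3]
    linarith
  obtain ⟨u, hu, hu2⟩ : ∃ u : ℂ, ‖u‖ = 1 ∧ u ^ 2 * cpair B W W = ‖cpair B W W‖ := by
    by_cases h0 : cpair B W W = 0
    · exact ⟨1, by simp, by simp [h0]⟩
    · obtain ⟨u, hu⟩ := IsAlgClosed.exists_pow_nat_eq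
        ((‖cpair B W W‖ : ℂ) / cpair B W W) two_pos
      refine ⟨u, ?_, by rw [hu, div_mul_cancel₀ _ h0]⟩
      have := congrArg norm hu
      rw [norm_pow, norm_div, Complex.norm_real, norm_norm, div_self (norm_ne_zero_iff.2 h0)] at this
      exact (pow_eq_one_iff_of_nonneg (norm_nonneg _) two_ne_zero).1 this
  have := key (u • W) (by rw [cpair_smul_right, h, mul_zero])
    (by rw [cpair_smul_right, h', mul_zero])
  rw [cj_smul, cpair_smul_left, cpair_smul_right, cpair_smul_left, cpair_smul_right, ← mul_assoc,
    ← mul_assoc, mul_comm _ u, Complex.mul_conj, Complex.normSq_eq_norm_sq, hu, ← sq, hu2] at this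
  simpa using this

end Pairing

section Component

variable {n : ℕ} {B : Matrix (Fin n) (Fin n) ℤ}

/-- `Z` and `W` lie in the same component of the cone. -/
def Same (B : Matrix (Fin n) (Fin n) ℤ) (Z W : Fin n → ℂ) : Prop :=
  ‖cpair B W Z‖ < ‖cpair B W (cj Z)‖

/-- The coefficient of `W` along `Z`. -/
noncomputable def coefZ (B : Matrix (Fin n) (Fin n) ℤ) (Z W : Fin n → ℂ) : ℂ :=
  cpair B W (cj Z) / cpair B Z (cj Z)

/-- The coefficient of `W` along the conjugate of `Z`. -/
noncomputable def coefJ (B : Matrix (Fin n) (Fin n) ℤ) (Z W : Fin n → ℂ) : ℂ :=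
  cpair B W Z / cpair B Z (cj Z)

/-- The component of `W` orthogonal to `Z` and its conjugate. -/
noncomputable def perp (B : Matrix (Fin n) (Fin n) ℤ) (Z W : Fin n → ℂ) : Fin n → ℂ :=
  W - coefZ B Z W • Z - coefJ B Z W • cj Z

lemma decomp (Z W : Fin n → ℂ) :
    W = coefZ B Z W • Z + coefJ B Z W • cj Z + perp B Z W := by
  unfold perp; abel

lemma cone_cpair_ne {Z : Fin n → ℂ} (hZ : Z ∈ Cone B) : cpair B Z (cj Z) ≠ 0 := by
  intro h
  have := hZ.2
  change 0 < (cpair B Z (cj Z)).re at this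
  rw [h] at this
  simp at this

lemma cpair_cj_cj_self (hB : B.IsSymm) {Z : Fin n → ℂ} (hZ : Z ∈ Cone B) :
    cpair B (cj Z) (cj Z) = 0 := (cj_mem_cone hB hZ).1

lemma cpair_perp (hB : B.IsSymm) {Z : Fin n → ℂ} (hZ : Z ∈ Cone B) (W : Fin n → ℂ) :
    cpair B Z (perp B Z W) = 0 := by
  have h0 := cone_cpair_ne hZ
  simp only [perp, coefZ, coefJ, cpair_sub_right, cpair_smul_right, (mem_cone.1 hZ).1]
  rw [cpair_comm hB W Z]
  field_simp
  ring

lemma cpair_cj_perp (hB : B.IsSymm) {Z : Fin n → ℂ} (hZ : Z ∈ Cone B) (W : Fin n → ℂ) :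
    cpair B (cj Z) (perp B Z W) = 0 := by
  have h0 := cone_cpair_ne hZ
  simp only [perp, coefZ, coefJ, cpair_sub_right, cpair_smul_right, cpair_cj_cj_self hB hZ]
  rw [cpair_comm hB (cj Z) Z, cpair_comm hB W (cj Z)]
  field_simp
  ring

lemma cpair_comb (hB : B.IsSymm) {Z : Fin n → ℂ} (hZ : Z ∈ Cone B) {V : Fin n → ℂ}
    (h : cpair B Z V = 0) (h' : cpair B (cj Z) V = 0) (a b t : ℂ) :
    cpair B (a • Z + b • cj Z + t • V) (a • Z + b • cj Z + t • V) =
      2 * a * b * cpair B Z (cj Z) + t ^ 2 * cpair B V V := by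
  simp only [cpair_add_left, cpair_add_right, cpair_smul_left, cpair_smul_right,
    (mem_cone.1 hZ).1, cpair_cj_cj_self hB hZ, h, h', cpair_comm hB V Z, cpair_comm hB V (cj Z),
    cpair_comm hB (cj Z) Z]
  ring

lemma cpair_comb_cj (hB : B.IsSymm) {Z : Fin n → ℂ} (hZ : Z ∈ Cone B) {V : Fin n → ℂ}
    (h : cpair B Z V = 0) (h' : cpair B (cj Z) V = 0) (a b t : ℂ) :
    (cpair B (a • Z + b • cj Z + t • V) (cj (a • Z + b • cj Z + t • V))).re =
      (‖a‖ ^ 2 + ‖b‖ ^ 2) * (cpair B Z (cj Z)).re + ‖t‖ ^ 2 * (cpair B V (cj V)).re := by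
  have e1 : cpair B Z (cj V) = 0 := by rw [← cj_cj Z, cpair_cj, h', map_zero]
  have e2 : cpair B (cj Z) (cj V) = 0 := by rw [cpair_cj, h, map_zero]
  simp only [cj_add, cj_smul, cj_cj, cpair_add_left, cpair_add_right, cpair_smul_left,
    cpair_smul_right, (mem_cone.1 hZ).1, cpair_cj_cj_self hB hZ, h, h', cpair_comm hB V Z,
    cpair_comm hB V (cj Z), cpair_comm hB (cj Z) Z, e1, e2]
  have : ∀ z : ℂ, starRingEnd ℂ z * z = ((‖z‖ ^ 2 : ℝ) : ℂ) := fun z => by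
    rw [mul_comm, Complex.mul_conj, Complex.normSq_eq_norm_sq]
  rw [cpair_cj_self_eq_re hB Z, cpair_cj_self_eq_re hB V]
  simp only [mul_zero, add_zero, zero_add, ← mul_assoc, this]
  norm_cast
  ring

lemma cpair_self_perp (hB : B.IsSymm) {Z : Fin n → ℂ} (hZ : Z ∈ Cone B) (W : Fin n → ℂ) :
    cpair B W W = 2 * coefZ B Z W * coefJ B Z W * cpair B Z (cj Z) +
      cpair B (perp B Z W) (perp B Z W) := by
  have := cpair_comb hB hZ (cpair_perp hB hZ W) (cpair_cj_perp hB hZ W) (coefZ B Z W)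
    (coefJ B Z W) 1
  rwa [one_smul, ← decomp, one_pow, one_mul] at this

lemma cpair_self_cj_perp (hB : B.IsSymm) {Z : Fin n → ℂ} (hZ : Z ∈ Cone B) (W : Fin n → ℂ) :
    (cpair B W (cj W)).re = (‖coefZ B Z W‖ ^ 2 + ‖coefJ B Z W‖ ^ 2) * (cpair B Z (cj Z)).re +
      (cpair B (perp B Z W) (cj (perp B Z W))).re := by
  have := cpair_comb_cj hB hZ (cpair_perp hB hZ W) (cpair_cj_perp hB hZ W) (coefZ B Z W)
    (coefJ B Z W) 1
  rwa [one_smul, ← decomp, norm_one, one_pow, one_mul] at this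

lemma norm_cpair_cone (hB : B.IsSymm) {Z : Fin n → ℂ} (hZ : Z ∈ Cone B) :
    ‖cpair B Z (cj Z)‖ = (cpair B Z (cj Z)).re := by
  rw [cpair_cj_self_eq_re hB Z, Complex.norm_real, Complex.ofReal_re, Real.norm_eq_abs,
    abs_of_pos (mem_cone.1 hZ).2]

lemma coef_norm_ne (hB : Hyp B) {Z W : Fin n → ℂ} (hZ : Z ∈ Cone B) (hW : W ∈ Cone B) :
    ‖coefJ B Z W‖ ≠ ‖coefZ B Z W‖ := by
  intro h
  have h1 := cpair_self_perp hB.symm hZ W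
  have h2 := cpair_self_cj_perp hB.symm hZ W
  have h3 := hB.norm_le_of_orth hZ (cpair_perp hB.symm hZ W) (cpair_cj_perp hB.symm hZ W)
  have h4 := (mem_cone.1 hW).2
  rw [(mem_cone.1 hW).1] at h1
  have h5 : cpair B (perp B Z W) (perp B Z W) =
    -(2 * coefZ B Z W * coefJ B Z W * cpair B Z (cj Z)) := by linear_combination -h1
  rw [h5, norm_neg, norm_mul, norm_mul, norm_mul, norm_cpair_cone hB.symm hZ, h] at h3
  rw [h] at h2
  norm_num at h3
  nlinarith

lemma same_iff {Z W : Fin n → ℂ} (hZ : Z ∈ Cone B) :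
    Same B Z W ↔ ‖coefJ B Z W‖ < ‖coefZ B Z W‖ := by
  have : 0 < ‖cpair B Z (cj Z)‖ := norm_pos_iff.2 (cone_cpair_ne hZ)
  simp only [Same, coefJ, coefZ, norm_div]
  rw [div_lt_div_iff_of_pos_right this]

lemma same_norm_ne (hB : Hyp B) {Z W : Fin n → ℂ} (hZ : Z ∈ Cone B) (hW : W ∈ Cone B) :
    ‖cpair B W Z‖ ≠ ‖cpair B W (cj Z)‖ := by
  intro h
  apply coef_norm_ne hB hZ hW
  simp only [coefJ, coefZ, norm_div, h]

lemma same_self {Z : Fin n → ℂ} (hZ : Z ∈ Cone B) : Same B Z Z := by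
  unfold Same
  rw [(mem_cone.1 hZ).1, norm_zero]
  exact norm_pos_iff.2 (cone_cpair_ne hZ)

/-- A quadratically parametrised disc joining a multiple of `Z` to `W`. -/
noncomputable def disc (B : Matrix (Fin n) (Fin n) ℤ) (Z W : Fin n → ℂ) (t : ℂ) : Fin n → ℂ :=
  coefZ B Z W • Z + (t ^ 2 * coefJ B Z W) • cj Z + t • perp B Z W

lemma disc_one (Z W : Fin n → ℂ) : disc B Z W 1 = W := by
  simp [disc, ← decomp]

lemma disc_zero (Z W : Fin n → ℂ) : disc B Z W 0 = coefZ B Z W • Z := by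
  simp [disc]

lemma differentiable_disc (Z W : Fin n → ℂ) : Differentiable ℂ (disc B Z W) := by
  unfold disc
  fun_prop

lemma coefZ_comb (hB : B.IsSymm) {Z : Fin n → ℂ} (hZ : Z ∈ Cone B) {V : Fin n → ℂ}
    (h' : cpair B (cj Z) V = 0) (a b t : ℂ) :
    coefZ B Z (a • Z + b • cj Z + t • V) = a := by
  have h0 := cone_cpair_ne hZ
  simp only [coefZ, cpair_add_left, cpair_smul_left, cpair_cj_cj_self hB hZ,
    cpair_comm hB V (cj Z), h']
  field_simp
  ring

lemma coefJ_comb (hB : B.IsSymm) {Z : Fin n → ℂ} (hZ : Z ∈ Cone B) {V : Fin n → ℂ}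
    (h : cpair B Z V = 0) (a b t : ℂ) :
    coefJ B Z (a • Z + b • cj Z + t • V) = b := by
  have h0 := cone_cpair_ne hZ
  simp only [coefJ, cpair_add_left, cpair_smul_left, (mem_cone.1 hZ).1,
    cpair_comm hB V Z, h, cpair_comm hB (cj Z) Z]
  field_simp
  ring

lemma disc_mem (hB : Hyp B) {Z W : Fin n → ℂ} (hZ : Z ∈ Cone B) (hW : W ∈ Cone B)
    (h : Same B Z W) {t : ℂ} (ht : ‖t‖ ≤ 1) : disc B Z W t ∈ Cone B ∧ Same B Z (disc B Z W t) := by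
  have hlt := (same_iff hZ).1 h
  have p1 := cpair_perp hB.symm hZ W
  have p2 := cpair_cj_perp hB.symm hZ W
  refine ⟨mem_cone.2 ⟨?_, ?_⟩, (same_iff hZ).2 ?_⟩
  · have h1 := cpair_self_perp hB.symm hZ W
    rw [(mem_cone.1 hW).1] at h1
    rw [disc, cpair_comb hB.symm hZ p1 p2]
    linear_combination -t ^ 2 * h1
  · have h2 := cpair_self_cj_perp hB.symm hZ W
    have h4 := (mem_cone.1 hW).2
    have hA := (mem_cone.1 hZ).2
    rw [disc, cpair_comb_cj hB.symm hZ p1 p2, norm_mul, norm_pow]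
    have hs : ‖t‖ ^ 2 ≤ 1 := pow_le_one₀ (norm_nonneg _) ht
    have hs0 : 0 ≤ ‖t‖ ^ 2 := by positivity
    generalize ‖t‖ ^ 2 = s at hs hs0 ⊢
    have hab : ‖coefJ B Z W‖ ^ 2 < ‖coefZ B Z W‖ ^ 2 := by gcongr
    have hb0 : 0 ≤ ‖coefJ B Z W‖ ^ 2 := by positivity
    rw [mul_pow]
    generalize ‖coefJ B Z W‖ ^ 2 = b at *
    generalize ‖coefZ B Z W‖ ^ 2 = a at *
    generalize (cpair B Z (cj Z)).re = A at *
    generalize (cpair B (perp B Z W) (cj (perp B Z W))).re = c at *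
    rw [h2] at h4
    have key : (a + s ^ 2 * b) * A + s * c =
      A * ((1 - s) * (a - s * b)) + s * ((a + b) * A + c) := by ring
    rw [key]
    have hsb : 0 < a - s * b := by nlinarith
    rcases hs.lt_or_eq with h | h
    · have : 0 < A * ((1 - s) * (a - s * b)) := mul_pos hA (mul_pos (by linarith) hsb)
      have : 0 ≤ s * ((a + b) * A + c) := by positivity
      linarith
    · subst h; simpa using h4
  · rw [disc, coefJ_comb hB.symm hZ p1, coefZ_comb hB.symm hZ p2, norm_mul, norm_pow]
    refine lt_of_le_of_lt ?_ hlt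
    have : ‖t‖ ^ 2 ≤ 1 := pow_le_one₀ (norm_nonneg _) ht
    exact mul_le_of_le_one_left (norm_nonneg _) this

lemma component_eq (hB : Hyp B) {Z : Fin n → ℂ} (hZ : Z ∈ Cone B) :
    connectedComponentIn (Cone B) Z = {W | W ∈ Cone B ∧ Same B Z W} := by
  apply Set.Subset.antisymm
  · intro W hW
    have hsub := connectedComponentIn_subset (Cone B) Z
    refine ⟨hsub hW, ?_⟩
    have hc : ContinuousOn (fun W => ‖cpair B W (cj Z)‖ - ‖cpair B W Z‖)
        (connectedComponentIn (Cone B) Z) :=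
      Continuous.continuousOn (by fun_prop)
    by_contra hne
    unfold Same at hne
    push Not at hne
    have hmem : (0 : ℝ) ∈ (fun W => ‖cpair B W (cj Z)‖ - ‖cpair B W Z‖) ''
        (connectedComponentIn (Cone B) Z) := by
      apply isPreconnected_connectedComponentIn.intermediate_value hW
        (mem_connectedComponentIn hZ) hc
      exact ⟨by linarith, by have := same_self hZ; unfold Same at this; linarith⟩
    obtain ⟨V, hV, h0⟩ := hmem
    exact same_norm_ne hB hZ (hsub hV) (by simp only at h0; linarith)
  · rintro W ⟨hW, hS⟩
    have hlt := (same_iff hZ).1 hS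
    have ha : coefZ B Z W ≠ 0 := by
      intro h0
      rw [h0, norm_zero] at hlt
      exact absurd hlt (not_lt.2 (norm_nonneg _))
    have hc1 : IsPreconnected ((fun t : ℂ => t • Z) '' {0}ᶜ) :=
      (isConnected_compl_singleton_of_one_lt_rank
        (by simp [Complex.rank_real_complex]) 0).isPreconnected.image _
        (Continuous.continuousOn (by fun_prop))
    have hc2 : IsPreconnected (disc B Z W '' Metric.closedBall 0 1) :=
      (convex_closedBall (0 : ℂ) 1).isPreconnected.image _
        (differentiable_disc Z W).continuous.continuousOn
    have m1 : coefZ B Z W • Z ∈ (fun t : ℂ => t • Z) '' {0}ᶜ := ⟨_, ha, rfl⟩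
    have m2 : coefZ B Z W • Z ∈ disc B Z W '' Metric.closedBall 0 1 :=
      ⟨0, by simp, disc_zero Z W⟩
    have hc := IsPreconnected.union (coefZ B Z W • Z) m1 m2 hc1 hc2
    refine hc.subset_connectedComponentIn (F := Cone B) (x := Z)
      (Or.inl ⟨1, by simp, one_smul _ _⟩) ?_ (Or.inr ⟨1, by simp, disc_one Z W⟩)
    rintro V (⟨t, ht, rfl⟩ | ⟨t, ht, rfl⟩)
    · exact smul_mem_cone hZ ht
    · exact (disc_mem hB hZ hW hS (by simpa using ht)).1

variable {D : Set (Fin n → ℂ)}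

lemma IsComponent.subset (hD : IsComponent B D) : D ⊆ Cone B := by
  obtain ⟨Z, hZ, rfl⟩ := hD
  exact connectedComponentIn_subset _ _

lemma IsComponent.mem_iff (hD : IsComponent B D) (hB : Hyp B) {Z : Fin n → ℂ} (hZ : Z ∈ D)
    {W : Fin n → ℂ} : W ∈ D ↔ W ∈ Cone B ∧ Same B Z W := by
  obtain ⟨Z', hZ', rfl⟩ := hD
  rw [connectedComponentIn_eq hZ, component_eq hB (connectedComponentIn_subset _ _ hZ)]
  rfl

lemma IsComponent.smul_mem (hD : IsComponent B D) (hB : Hyp B) {Z : Fin n → ℂ} (hZ : Z ∈ D)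
    {t : ℂ} (ht : t ≠ 0) : t • Z ∈ D := by
  rw [hD.mem_iff hB hZ]
  refine ⟨smul_mem_cone (hD.subset hZ) ht, ?_⟩
  unfold Same
  rw [cpair_smul_left, cpair_smul_left, norm_mul, norm_mul]
  exact mul_lt_mul_of_pos_left (same_self (hD.subset hZ)) (norm_pos_iff.2 ht)

lemma IsComponent.disc_mem (hD : IsComponent B D) (hB : Hyp B) {Z W : Fin n → ℂ} (hZ : Z ∈ D)
    (hW : W ∈ D) {t : ℂ} (ht : ‖t‖ ≤ 1) : disc B Z W t ∈ D := by
  rw [hD.mem_iff hB hZ] at *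
  exact Refl.disc_mem hB hZ.1 hW.1 hW.2 ht

lemma IsComponent.coefZ_ne_zero (hD : IsComponent B D) (hB : Hyp B) {Z W : Fin n → ℂ}
    (hZ : Z ∈ D) (hW : W ∈ D) : coefZ B Z W ≠ 0 := by
  intro h0
  have := (same_iff (hD.subset hZ)).1 ((hD.mem_iff hB hZ).1 hW).2
  rw [h0, norm_zero] at this
  exact absurd this (not_lt.2 (norm_nonneg _))

lemma IsComponent.cpair_cj_ne_zero (hD : IsComponent B D) (hB : Hyp B) {Z W : Fin n → ℂ}
    (hZ : Z ∈ D) (hW : W ∈ D) : cpair B W (cj Z) ≠ 0 := by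
  intro h0
  apply hD.coefZ_ne_zero hB hZ hW
  rw [coefZ, h0, zero_div]

/-- Each point of the cone or its conjugate lies in a given component. -/
lemma IsComponent.mem_or_cj_mem (hD : IsComponent B D) (hB : Hyp B) {W : Fin n → ℂ}
    (hW : W ∈ Cone B) : W ∈ D ∨ cj W ∈ D := by
  obtain ⟨Z, hZ⟩ : D.Nonempty := by
    obtain ⟨Z, hZ, rfl⟩ := hD
    exact ⟨Z, mem_connectedComponentIn hZ⟩
  rw [hD.mem_iff hB hZ, hD.mem_iff hB hZ]
  rcases lt_or_gt_of_ne (same_norm_ne hB (hD.subset hZ) hW) with h | h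
  · exact Or.inl ⟨hW, h⟩
  · refine Or.inr ⟨cj_mem_cone hB.symm hW, ?_⟩
    unfold Same
    rwa [cpair_cj, cpair_cj_left, RCLike.norm_conj, RCLike.norm_conj]

lemma isComponent_same (hB : Hyp B) {Z : Fin n → ℂ} (hZ : Z ∈ Cone B) :
    IsComponent B {W | W ∈ Cone B ∧ Same B Z W} :=
  ⟨Z, hZ, (component_eq hB hZ).symm⟩

lemma IsComponent.nonempty (hD : IsComponent B D) : D.Nonempty := by
  obtain ⟨Z, hZ, rfl⟩ := hD
  exact ⟨Z, mem_connectedComponentIn hZ⟩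

/-- Near a point of a component, isotropic vectors lie in the component. -/
lemma IsComponent.eventually_mem (hD : IsComponent B D) (hB : Hyp B) {α : Type*} {l : Filter α}
    {f : α → Fin n → ℂ} {Z : Fin n → ℂ} (hZ : Z ∈ D) (hf : Filter.Tendsto f l (nhds Z))
    (h0 : ∀ᶠ a in l, cpair B (f a) (f a) = 0) : ∀ᶠ a in l, f a ∈ D := by
  have c1 : Continuous fun W : Fin n → ℂ => (cpair B W (cj W)).re :=
    Complex.continuous_re.comp (continuous_cpair_comp B continuous_id continuous_cj)
  have c2 : Continuous fun W : Fin n → ℂ => ‖cpair B W (cj Z)‖ - ‖cpair B W Z‖ := by fun_prop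
  have h1 := ((c1.tendsto Z).comp hf).eventually_const_lt (hD.subset hZ).2
  have h2 := ((c2.tendsto Z).comp hf).eventually_const_lt
    (sub_pos.2 (same_self (hD.subset hZ)))
  filter_upwards [h0, h1, h2] with a h0 h1 h2
  rw [hD.mem_iff hB hZ]
  exact ⟨mem_cone.2 ⟨h0, h1⟩, sub_pos.1 h2⟩

lemma IsComponent.mem_of_tendsto (hD : IsComponent B D) (hB : Hyp B) {α : Type*} {l : Filter α}
    [l.NeBot] {f : α → Fin n → ℂ} {Z : Fin n → ℂ} (hZ : Z ∈ Cone B)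
    (hf : Filter.Tendsto f l (nhds Z)) (h0 : ∃ᶠ a in l, f a ∈ D) : Z ∈ D := by
  rcases hD.mem_or_cj_mem hB hZ with h | h
  · exact h
  · exfalso
    have c2 : Continuous fun W : Fin n → ℂ => ‖cpair B W Z‖ - ‖cpair B W (cj Z)‖ := by fun_prop
    have h2 := ((c2.tendsto Z).comp hf).eventually_lt_const
      (sub_neg.2 (same_self hZ))
    obtain ⟨a, ha, ha2⟩ := (h0.and_eventually h2).exists
    have := ((hD.mem_iff hB h).1 ha).2
    unfold Same at this
    rw [cj_cj] at this
    exact absurd this (not_lt.2 (sub_neg.1 ha2).le)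

end Component

section Action

variable {n : ℕ} {B : Matrix (Fin n) (Fin n) ℤ} {D : Set (Fin n → ℂ)}

lemma cpair_actC {g : Matrix (Fin n) (Fin n) ℤ} (hg : gᵀ * B * g = B) (Z W : Fin n → ℂ) :
    cpair B (actC g Z) (actC g W) = cpair B Z W := by
  have h := congrArg (fun M : Matrix (Fin n) (Fin n) ℤ => M.map (Int.cast : ℤ → ℂ)) hg
  have h' : (g.map (Int.cast : ℤ → ℂ))ᵀ * B.map (Int.cast : ℤ → ℂ) * g.map (Int.cast : ℤ → ℂ) =
      B.map (Int.cast : ℤ → ℂ) := by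
    simpa only [map_mul_intCast, transpose_map] using h
  have hs : (B.map (Int.cast : ℤ → ℂ)) = (g.map (Int.cast : ℤ → ℂ))ᵀ *
      (B.map (Int.cast : ℤ → ℂ) * g.map (Int.cast : ℤ → ℂ)) := by
    rw [← Matrix.mul_assoc, h']
  rw [cpair_eq_dotProduct, cpair_eq_dotProduct]
  conv_rhs => rw [hs, ← Matrix.mulVec_mulVec, Matrix.dotProduct_mulVec, Matrix.vecMul_transpose,
    ← Matrix.mulVec_mulVec]
  rfl

lemma actC_mul (g h : Matrix (Fin n) (Fin n) ℤ) (Z : Fin n → ℂ) :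
    actC (g * h) Z = actC g (actC h Z) := by
  simp only [actC, map_mul_intCast, Matrix.mulVec_mulVec]

lemma actC_one (Z : Fin n → ℂ) : actC 1 Z = Z := by
  simp [actC]

lemma actC_smul (g : Matrix (Fin n) (Fin n) ℤ) (c : ℂ) (Z : Fin n → ℂ) :
    actC g (c • Z) = c • actC g Z := by
  simp [actC, Matrix.mulVec_smul]

lemma actC_add (g : Matrix (Fin n) (Fin n) ℤ) (Z W : Fin n → ℂ) :
    actC g (Z + W) = actC g Z + actC g W := by
  simp [actC, Matrix.mulVec_add]

lemma cj_actC (g : Matrix (Fin n) (Fin n) ℤ) (Z : Fin n → ℂ) :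
    cj (actC g Z) = actC g (cj Z) := by
  ext i
  simp [cj, actC, Matrix.mulVec, dotProduct]

lemma continuous_actC (g : Matrix (Fin n) (Fin n) ℤ) : Continuous (actC g) := by
  unfold actC
  fun_prop

lemma actC_mem_cone {g : Matrix (Fin n) (Fin n) ℤ} (hg : gᵀ * B * g = B) {Z : Fin n → ℂ}
    (hZ : Z ∈ Cone B) : actC g Z ∈ Cone B := by
  rw [mem_cone] at *
  rwa [cj_actC, cpair_actC hg, cpair_actC hg]

lemma same_actC {g : Matrix (Fin n) (Fin n) ℤ} (hg : gᵀ * B * g = B) {Z W : Fin n → ℂ}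
    (h : Same B Z W) : Same B (actC g Z) (actC g W) := by
  unfold Same at *
  rwa [cj_actC, cpair_actC hg, cpair_actC hg]

/-- Over a nondegenerate lattice, an integral isometry has an inverse isometry. -/
lemma exists_inv_isometry (hdet : B.det ≠ 0) {g : Matrix (Fin n) (Fin n) ℤ}
    (hg : gᵀ * B * g = B) : ∃ h : Matrix (Fin n) (Fin n) ℤ, g * h = 1 ∧ h * g = 1 ∧
      hᵀ * B * h = B := by
  have h1 := congrArg Matrix.det hg
  rw [det_mul, det_mul, det_transpose] at h1
  have h2 : g.det * g.det = 1 := by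
    apply mul_right_cancel₀ hdet
    linear_combination h1
  have hu : IsUnit g.det := IsUnit.of_mul_eq_one _ h2
  have hgi := Matrix.mul_nonsing_inv g hu
  have hig := Matrix.nonsing_inv_mul g hu
  refine ⟨g⁻¹, hgi, hig, ?_⟩
  have : (g⁻¹)ᵀ * gᵀ = 1 := by rw [← transpose_mul, hgi, transpose_one]
  calc (g⁻¹)ᵀ * B * g⁻¹ = (g⁻¹)ᵀ * (gᵀ * B * g) * g⁻¹ := by rw [hg]
    _ = ((g⁻¹)ᵀ * gᵀ) * B * (g * g⁻¹) := by simp only [Matrix.mul_assoc]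
    _ = B := by rw [this, hgi, Matrix.one_mul, Matrix.mul_one]

lemma mem_OPlus_of_mem (hB : Hyp B) (hdet : B.det ≠ 0) (hD : IsComponent B D)
    {g : Matrix (Fin n) (Fin n) ℤ} (hg : gᵀ * B * g = B) {Z : Fin n → ℂ} (hZ : Z ∈ D)
    (hgZ : actC g Z ∈ D) : g ∈ OPlus B D := by
  have fwd : ∀ {g : Matrix (Fin n) (Fin n) ℤ} (_ : gᵀ * B * g = B) {Z : Fin n → ℂ} (_ : Z ∈ D)
      (_ : actC g Z ∈ D) {W : Fin n → ℂ}, W ∈ D → actC g W ∈ D := by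
    intro g hg Z hZ hgZ W hW
    rw [hD.mem_iff hB hgZ]
    rw [hD.mem_iff hB hZ] at hW
    exact ⟨actC_mem_cone hg hW.1, same_actC hg hW.2⟩
  refine ⟨hg, Set.Subset.antisymm ?_ ?_⟩
  · rintro _ ⟨W, hW, rfl⟩
    exact fwd hg hZ hgZ hW
  · intro W hW
    obtain ⟨h, h1, h2, h3⟩ := exists_inv_isometry hdet hg
    refine ⟨actC h W, ?_, by rw [← actC_mul, h1, actC_one]⟩
    refine fwd h3 hgZ ?_ hW
    rwa [← actC_mul, h2, actC_one]

lemma OPlus_act {g : Matrix (Fin n) (Fin n) ℤ} (hg : g ∈ OPlus B D) {Z : Fin n → ℂ}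
    (hZ : Z ∈ D) : actC g Z ∈ D := by
  rw [← hg.2]
  exact ⟨Z, hZ, rfl⟩

lemma norm_char_eq_one {Γ : Set (Matrix (Fin n) (Fin n) ℤ)} {χ : Matrix (Fin n) (Fin n) ℤ → ℂ}
    (hΓ : IsFiniteIndexSubgroup B D Γ) (hχ : IsCharacter Γ χ) {g : Matrix (Fin n) (Fin n) ℤ}
    (hg : g ∈ Γ) : ‖χ g‖ = 1 := by
  have hpow : ∀ j : ℕ, g ^ (j + 1) ∈ Γ ∧ χ (g ^ (j + 1)) = χ g ^ (j + 1) := by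
    intro j
    induction j with
    | zero => simpa using hg
    | succ j ih =>
      rw [pow_succ]
      exact ⟨hΓ.mul_mem _ ih.1 _ hg, by rw [hχ.map_mul _ ih.1 _ hg, ih.2, ← pow_succ]⟩
  have hmem : ∀ j : ℕ, χ g ^ (j + 1) ∈ χ '' Γ := fun j => ⟨_, (hpow j).1, (hpow j).2⟩
  have hni : ¬ Function.Injective fun j : ℕ => χ g ^ (j + 1) := by
    intro hinj
    exact (Set.infinite_range_of_injective hinj)
      (hχ.finite_image.subset (Set.range_subset_iff.2 hmem))
  have hne := hχ.ne_zero g hg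
  simp only [Function.Injective, not_forall] at hni
  obtain ⟨i, j, hij, hne'⟩ := hni
  have hn := congrArg norm hij
  simp only [norm_pow] at hn
  by_contra h1
  have := pow_right_injective₀ (norm_pos_iff.2 hne) h1 hn
  omega

end Action

section Arithmetic

lemma exists_clear_denominators {n : ℕ} (x : Fin n → ℚ) :
    ∃ d : ℤ, d ≠ 0 ∧ ∃ y : Fin n → ℤ, (d : ℚ) • x = intQ y := by
  obtain ⟨d, hd⟩ := IsLocalization.exist_integer_multiples_of_finite (nonZeroDivisors ℤ) x
  choose y hy using hd
  refine ⟨d, nonZeroDivisors.coe_ne_zero d, y, ?_⟩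
  ext i
  have := hy i
  simp only [Pi.smul_apply, smul_eq_mul, intQ]
  rw [Algebra.smul_def] at this
  exact this.symm

lemma exists_orthogonal_vectors {n : ℕ} {B : Matrix (Fin n) (Fin n) ℤ} (hB : B.IsSymm)
    (hdet : B.det ≠ 0) : ∃ e : Fin n → Fin n → ℤ,
      (∀ i j, i ≠ j → e i ⬝ᵥ B *ᵥ e j = 0) ∧ ∀ i, e i ⬝ᵥ B *ᵥ e i ≠ 0 := by
  set A : Matrix (Fin n) (Fin n) ℚ := B.map (Int.cast : ℤ → ℚ)
  have hA : A.det ≠ 0 := by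
    have : A.det = ((B.det : ℤ) : ℚ) := by
      have := (Int.castRingHom ℚ).map_det B
      simpa using this.symm
    rw [this]
    exact_mod_cast hdet
  have hsymm : LinearMap.IsSymm (Matrix.toBilin' A) := by
    refine ⟨fun x y => ?_⟩
    have hAs : Aᵀ = A := by
      ext i j
      simp [A, hB.apply i j]
    simp only [Matrix.toBilin'_apply', RingHom.id_apply]
    rw [dotProduct_mulVec, ← mulVec_transpose, hAs, dotProduct_comm]
  obtain ⟨v, hv⟩ := LinearMap.BilinForm.exists_orthogonal_basis hsymm
  have hnd := LinearMap.BilinForm.nondegenerate_toBilin'_of_det_ne_zero' A hA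
  have hself := fun i => LinearMap.IsOrthoᵢ.not_isOrtho_basis_self_of_separatingLeft hv hnd.1 i
  have hfr : Module.finrank ℚ (Fin n → ℚ) = n := by simp
  choose d hd y hy using fun i : Fin n => exists_clear_denominators (v (Fin.cast hfr.symm i))
  have key : ∀ i j, ((y i ⬝ᵥ B *ᵥ y j : ℤ) : ℚ) =
      d i * d j * Matrix.toBilin' A (v (Fin.cast hfr.symm i)) (v (Fin.cast hfr.symm j)) := by
    intro i j
    have h1 : ((y i ⬝ᵥ B *ᵥ y j : ℤ) : ℚ) = Matrix.toBilin' A (intQ (y i)) (intQ (y j)) := by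
      rw [Matrix.toBilin'_apply']
      simp [dotProduct, mulVec, intQ, A]
    rw [h1, ← hy, ← hy]
    simp [mul_assoc, mul_left_comm]
  refine ⟨y, fun i j hij => ?_, fun i h => ?_⟩
  · have h0 : Matrix.toBilin' A (v (Fin.cast hfr.symm i)) (v (Fin.cast hfr.symm j)) = 0 :=
      hv (by simpa using hij)
    have := key i j
    rw [h0, mul_zero] at this
    exact_mod_cast this
  · have := key i i
    rw [h] at this
    have hdi : (d i : ℚ) ≠ 0 := by exact_mod_cast hd i
    simp [hdi, hself] at this

lemma eq_zero_of_dvd_step {ι : Type*} {p : ℤ} (hp : 1 < p) {S : Set (ι → ℤ)}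
    (hS : ∀ m ∈ S, ∃ m' ∈ S, m = p • m') {m : ι → ℤ} (hm : m ∈ S) : m = 0 := by
  have h : ∀ k : ℕ, ∀ m ∈ S, ∃ m' : ι → ℤ, m = p ^ k • m' := by
    intro k
    induction k with
    | zero => exact fun m _ => ⟨m, by simp⟩
    | succ k ih =>
      intro m hm
      obtain ⟨m', hm', rfl⟩ := hS m hm
      obtain ⟨m'', rfl⟩ := ih m' hm'
      exact ⟨m'', by rw [smul_smul, pow_succ']⟩
  ext i
  obtain ⟨m', hm'⟩ := h (m i).natAbs m hm
  have h1 : m i = p ^ (m i).natAbs * m' i := by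
    conv_lhs => rw [hm']
    simp
  refine Int.eq_zero_of_abs_lt_dvd (Dvd.intro _ h1.symm) ?_
  have h2 : (2 : ℤ) ^ (m i).natAbs ≤ p ^ (m i).natAbs :=
    pow_le_pow_left₀ (by norm_num) (by omega) _
  have h3 : ((m i).natAbs : ℤ) < 2 ^ (m i).natAbs := by
    exact_mod_cast Nat.lt_two_pow_self
  rw [Int.abs_eq_natAbs]
  omega

lemma ternary_anisotropic {p : ℕ} (hp : p.Prime) {a b c : ℤ}
    (hab : ∀ x y : ZMod p, (a : ZMod p) * x ^ 2 + b * y ^ 2 = 0 → x = 0 ∧ y = 0)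
    (hc : (p : ℤ) ∣ c) (hc2 : ¬ (p : ℤ) ^ 2 ∣ c) {G : Matrix (Fin 3) (Fin 3) ℤ}
    (hG : ∀ m : Fin 3 → ℤ, (p : ℤ) ^ 2 ∣
      m ⬝ᵥ G *ᵥ m - (a * m 0 ^ 2 + b * m 1 ^ 2 + c * m 2 ^ 2))
    {m : Fin 3 → ℤ} (hm : m ⬝ᵥ G *ᵥ m = 0) : m = 0 := by
  have hp1 : (1 : ℤ) < p := by exact_mod_cast hp.one_lt
  have := Fact.mk hp
  have hpp : Prime (p : ℤ) := Nat.prime_iff_prime_int.1 hp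
  refine eq_zero_of_dvd_step hp1 (S := {m | m ⬝ᵥ G *ᵥ m = 0}) ?_ hm
  intro m hm
  have h := hG m
  change m ⬝ᵥ G *ᵥ m = 0 at hm
  rw [hm, zero_sub, dvd_neg] at h
  have h1 : ((a * m 0 ^ 2 + b * m 1 ^ 2 + c * m 2 ^ 2 : ℤ) : ZMod p) = 0 :=
    (ZMod.intCast_zmod_eq_zero_iff_dvd _ _).2 (dvd_trans (dvd_pow_self _ two_ne_zero) h)
  have hc' : ((c : ℤ) : ZMod p) = 0 := (ZMod.intCast_zmod_eq_zero_iff_dvd _ _).2 hc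
  push_cast at h1
  rw [hc', zero_mul, add_zero] at h1
  obtain ⟨h0, h1⟩ := hab _ _ h1
  obtain ⟨x, hx⟩ := (ZMod.intCast_zmod_eq_zero_iff_dvd _ _).1 h0
  obtain ⟨y, hy⟩ := (ZMod.intCast_zmod_eq_zero_iff_dvd _ _).1 h1
  obtain ⟨c', rfl⟩ := hc
  have h2 : (p : ℤ) ∣ m 2 := by
    have : (p : ℤ) ^ 2 ∣ p * (c' * m 2 ^ 2) := by
      have e : (p : ℤ) * (c' * m 2 ^ 2) = (a * m 0 ^ 2 + b * m 1 ^ 2 + p * c' * m 2 ^ 2) -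
        p ^ 2 * (a * x ^ 2 + b * y ^ 2) := by rw [hx, hy]; ring
      rw [e]
      exact dvd_sub h (Dvd.intro _ rfl)
    rw [sq, mul_dvd_mul_iff_left (by positivity)] at this
    rcases hpp.dvd_or_dvd this with h | h
    · exact absurd (by rw [sq]; exact mul_dvd_mul_left _ h) hc2
    · exact hpp.dvd_of_dvd_pow h
  obtain ⟨z, hz⟩ := h2
  have hm' : m = (p : ℤ) • ![x, y, z] := by
    ext i
    fin_cases i <;> simp [hx, hy, hz]
  refine ⟨_, ?_, hm'⟩
  rw [hm'] at hm
  simp only [mulVec_smul, dotProduct_smul, smul_dotProduct, smul_eq_mul] at hm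
  have hp0 : (p : ℤ) ≠ 0 := hpp.ne_zero
  exact (mul_eq_zero.1 ((mul_eq_zero.1 hm).resolve_left hp0)).resolve_left hp0

lemma exists_binary_anisotropic {p : ℕ} (hp : p.Prime) (hp2 : p ≠ 2) {d₁ d₂ d₃ : ℤ}
    (h1 : ¬ (p : ℤ) ∣ d₁) (h2 : ¬ (p : ℤ) ∣ d₂) (h3 : ¬ (p : ℤ) ∣ d₃) :
    ∃ s t : ℤ, ∀ x y : ZMod p, (d₁ : ZMod p) * x ^ 2 + ((d₂ * s ^ 2 + d₃ * t ^ 2 : ℤ) : ZMod p) *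
      y ^ 2 = 0 → x = 0 ∧ y = 0 := by
  have := Fact.mk hp
  have n1 : (d₁ : ZMod p) ≠ 0 := mt (ZMod.intCast_zmod_eq_zero_iff_dvd _ _).1 h1
  have n2 : (d₂ : ZMod p) ≠ 0 := mt (ZMod.intCast_zmod_eq_zero_iff_dvd _ _).1 h2
  have n3 : (d₃ : ZMod p) ≠ 0 := mt (ZMod.intCast_zmod_eq_zero_iff_dvd _ _).1 h3
  obtain ⟨ν, hν⟩ := FiniteField.exists_nonsquare (F := ZMod p) (by rwa [ZMod.ringChar_zmod_n])
  have hodd : Fintype.card (ZMod p) % 2 = 1 := by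
    rw [ZMod.card]
    exact (hp.eq_two_or_odd).resolve_left hp2
  obtain ⟨s, t, hst⟩ := FiniteField.exists_root_sum_quadratic
    (f := Polynomial.C (d₂ : ZMod p) * Polynomial.X ^ 2 + Polynomial.C 0 * Polynomial.X +
      Polynomial.C (ν / d₁))
    (g := Polynomial.C (d₃ : ZMod p) * Polynomial.X ^ 2 + Polynomial.C 0 * Polynomial.X +
      Polynomial.C 0)
    (Polynomial.degree_quadratic n2) (Polynomial.degree_quadratic n3) hodd
  obtain ⟨s, rfl⟩ := ZMod.intCast_surjective s
  obtain ⟨t, rfl⟩ := ZMod.intCast_surjective t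
  simp only [map_zero, zero_mul, add_zero, Polynomial.eval_add, Polynomial.eval_mul,
    Polynomial.eval_C, Polynomial.eval_pow, Polynomial.eval_X] at hst
  refine ⟨s, t, fun x y hxy => ?_⟩
  push_cast at hxy
  have e : (d₁ : ZMod p) ^ 2 * x ^ 2 = ν * y ^ 2 := by
    have hst' : (d₁ : ZMod p) * (d₂ * s ^ 2 + d₃ * t ^ 2) = - ν := by
      have : (d₁ : ZMod p) * (ν / d₁) = ν := by field_simp
      linear_combination (d₁ : ZMod p) * hst - this
    linear_combination (d₁ : ZMod p) * hxy - y ^ 2 * hst'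
  have hy : y = 0 := by
    by_contra hy
    apply hν
    refine ⟨d₁ * x / y, ?_⟩
    field_simp
    linear_combination -e
  subst hy
  refine ⟨?_, rfl⟩
  have : (d₁ : ZMod p) ^ 2 * x ^ 2 = 0 := by rw [e]; ring
  simpa [n1] using this

lemma exists_ternary_uniformizer {p : ℕ} (hp : p.Prime) (hp2 : p ≠ 2) {d₁ d₂ d₃ : ℤ}
    (h1 : ¬ (p : ℤ) ∣ d₁) (h2 : ¬ (p : ℤ) ∣ d₂) (h3 : ¬ (p : ℤ) ∣ d₃) :
    ∃ u v w : ℤ, (p : ℤ) ∣ d₁ * u ^ 2 + d₂ * v ^ 2 + d₃ * w ^ 2 ∧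
      ¬ (p : ℤ) ^ 2 ∣ d₁ * u ^ 2 + d₂ * v ^ 2 + d₃ * w ^ 2 := by
  have := Fact.mk hp
  have n1 : (d₁ : ZMod p) ≠ 0 := mt (ZMod.intCast_zmod_eq_zero_iff_dvd _ _).1 h1
  have n2 : (d₂ : ZMod p) ≠ 0 := mt (ZMod.intCast_zmod_eq_zero_iff_dvd _ _).1 h2
  have hpp : Prime (p : ℤ) := Nat.prime_iff_prime_int.1 hp
  have hodd : Fintype.card (ZMod p) % 2 = 1 := by
    rw [ZMod.card]
    exact (hp.eq_two_or_odd).resolve_left hp2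
  obtain ⟨s, t, hst⟩ := FiniteField.exists_root_sum_quadratic
    (f := Polynomial.C (d₁ : ZMod p) * Polynomial.X ^ 2 + Polynomial.C 0 * Polynomial.X +
      Polynomial.C (d₃ : ZMod p))
    (g := Polynomial.C (d₂ : ZMod p) * Polynomial.X ^ 2 + Polynomial.C 0 * Polynomial.X +
      Polynomial.C 0)
    (Polynomial.degree_quadratic n1) (Polynomial.degree_quadratic n2) hodd
  obtain ⟨s, rfl⟩ := ZMod.intCast_surjective s
  obtain ⟨t, rfl⟩ := ZMod.intCast_surjective t
  simp only [map_zero, zero_mul, add_zero, Polynomial.eval_add, Polynomial.eval_mul,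
    Polynomial.eval_C, Polynomial.eval_pow, Polynomial.eval_X] at hst
  have hdvd : (p : ℤ) ∣ d₁ * s ^ 2 + d₂ * t ^ 2 + d₃ * 1 ^ 2 := by
    rw [← ZMod.intCast_zmod_eq_zero_iff_dvd]
    push_cast
    linear_combination hst
  by_cases hsq : (p : ℤ) ^ 2 ∣ d₁ * s ^ 2 + d₂ * t ^ 2 + d₃ * 1 ^ 2
  · refine ⟨s, t, 1 + p, ?_, fun h => ?_⟩
    · have e : d₁ * s ^ 2 + d₂ * t ^ 2 + d₃ * (1 + p) ^ 2 =
        (d₁ * s ^ 2 + d₂ * t ^ 2 + d₃ * 1 ^ 2) + p * (d₃ * (2 + p)) := by ring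
      rw [e]
      exact dvd_add hdvd (Dvd.intro _ rfl)
    · have h' := dvd_sub h hsq
      have e : d₁ * s ^ 2 + d₂ * t ^ 2 + d₃ * (1 + p) ^ 2 -
        (d₁ * s ^ 2 + d₂ * t ^ 2 + d₃ * 1 ^ 2) = p * (d₃ * 2 + p * d₃) := by ring
      have hp0 : (p : ℤ) ≠ 0 := hpp.ne_zero
      rw [e, sq, mul_dvd_mul_iff_left hp0] at h'
      have h'' := (dvd_add_left (Dvd.intro _ rfl)).1 h'
      rcases hpp.dvd_or_dvd h'' with h | h
      · exact h3 h
      · exact hp2 ((Nat.prime_dvd_prime_iff_eq hp Nat.prime_two).1 (by exact_mod_cast h))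
  · exact ⟨s, t, 1, hdvd, hsq⟩

/-- In rank at least six there is a congruence class of integral triples spanning anisotropic
ternary lattices. -/
lemma exists_anisotropic_class {n : ℕ} (hn : 6 ≤ n) {B : Matrix (Fin n) (Fin n) ℤ}
    (hB : B.IsSymm) (hdet : B.det ≠ 0) : ∃ (q : ℤ) (_ : 0 < q) (C : Matrix (Fin n) (Fin 3) ℤ),
      ∀ T : Matrix (Fin n) (Fin 3) ℤ, ∀ m : Fin 3 → ℤ,
        m ⬝ᵥ ((C + q • T)ᵀ * B * (C + q • T)) *ᵥ m = 0 → m = 0 := by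
  obtain ⟨e', horth', hself'⟩ := exists_orthogonal_vectors hB hdet
  let e : Fin 6 → Fin n → ℤ := fun i => e' (Fin.castLE hn i)
  have horth : ∀ i j, i ≠ j → e i ⬝ᵥ B *ᵥ e j = 0 := fun i j hij =>
    horth' _ _ (by simpa using hij)
  obtain ⟨p, hple, hp⟩ := Nat.exists_infinite_primes
    (3 + ∑ i, (e i ⬝ᵥ B *ᵥ e i).natAbs)
  have hnd : ∀ i, ¬ (p : ℤ) ∣ e i ⬝ᵥ B *ᵥ e i := by
    intro i hdvd
    have h1 := Int.eq_zero_of_abs_lt_dvd hdvd (by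
      have : (e i ⬝ᵥ B *ᵥ e i).natAbs ≤ ∑ i, (e i ⬝ᵥ B *ᵥ e i).natAbs :=
        Finset.single_le_sum (f := fun i => (e i ⬝ᵥ B *ᵥ e i).natAbs) (fun _ _ => Nat.zero_le _)
          (Finset.mem_univ i)
      rw [Int.abs_eq_natAbs]
      omega)
    exact hself' _ h1
  have hp2 : p ≠ 2 := by omega
  obtain ⟨s, t, hst⟩ := exists_binary_anisotropic hp hp2 (hnd 0) (hnd 1) (hnd 2)
  obtain ⟨u, v, w, huvw, huvw2⟩ := exists_ternary_uniformizer hp hp2 (hnd 3) (hnd 4) (hnd 5)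
  let c : Fin 3 → Fin n → ℤ := ![e 0, s • e 1 + t • e 2, u • e 3 + v • e 4 + w • e 5]
  let C : Matrix (Fin n) (Fin 3) ℤ := (Matrix.of c)ᵀ
  have hp0 : (0 : ℤ) < p := by exact_mod_cast hp.pos
  refine ⟨(p : ℤ) ^ 2, by positivity, C, fun T m hm => ?_⟩
  refine ternary_anisotropic hp hst huvw huvw2 (fun m => ?_) hm
  have hC : C *ᵥ m = m 0 • c 0 + m 1 • c 1 + m 2 • c 2 := by
    ext i
    simp [C, mulVec, dotProduct, Fin.sum_univ_three]
    ring
  have hCC : (C *ᵥ m) ⬝ᵥ B *ᵥ (C *ᵥ m) = (e 0 ⬝ᵥ B *ᵥ e 0) * m 0 ^ 2 +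
      ((e 1 ⬝ᵥ B *ᵥ e 1) * s ^ 2 + (e 2 ⬝ᵥ B *ᵥ e 2) * t ^ 2) * m 1 ^ 2 +
      ((e 3 ⬝ᵥ B *ᵥ e 3) * u ^ 2 + (e 4 ⬝ᵥ B *ᵥ e 4) * v ^ 2 + (e 5 ⬝ᵥ B *ᵥ e 5) * w ^ 2) *
        m 2 ^ 2 := by
    rw [hC]
    simp only [c, Matrix.cons_val, mulVec_add, mulVec_smul, dotProduct_add, add_dotProduct,
      dotProduct_smul, smul_dotProduct, smul_eq_mul]
    simp only [horth 0 1 (by decide), horth 0 2 (by decide), horth 0 3 (by decide),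
      horth 0 4 (by decide), horth 0 5 (by decide), horth 1 0 (by decide), horth 1 2 (by decide),
      horth 1 3 (by decide), horth 1 4 (by decide), horth 1 5 (by decide), horth 2 0 (by decide),
      horth 2 1 (by decide), horth 2 3 (by decide), horth 2 4 (by decide), horth 2 5 (by decide),
      horth 3 0 (by decide), horth 3 1 (by decide), horth 3 2 (by decide), horth 3 4 (by decide),
      horth 3 5 (by decide), horth 4 0 (by decide), horth 4 1 (by decide), horth 4 2 (by decide),
      horth 4 3 (by decide), horth 4 5 (by decide), horth 5 0 (by decide), horth 5 1 (by decide),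
      horth 5 2 (by decide), horth 5 3 (by decide), horth 5 4 (by decide)]
    ring
  have hGm : m ⬝ᵥ ((C + (p : ℤ) ^ 2 • T)ᵀ * B * (C + (p : ℤ) ^ 2 • T)) *ᵥ m =
      (C *ᵥ m + (p : ℤ) ^ 2 • T *ᵥ m) ⬝ᵥ B *ᵥ (C *ᵥ m + (p : ℤ) ^ 2 • T *ᵥ m) := by
    rw [← smul_mulVec, ← add_mulVec, Matrix.mul_assoc, ← mulVec_mulVec, ← mulVec_mulVec,
      dotProduct_mulVec, vecMul_transpose]
  rw [hGm, ← hCC]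
  simp only [mulVec_add, mulVec_smul, dotProduct_add, add_dotProduct,
      dotProduct_smul, smul_dotProduct, smul_eq_mul]
  exact ⟨T *ᵥ m ⬝ᵥ B *ᵥ C *ᵥ m + C *ᵥ m ⬝ᵥ B *ᵥ T *ᵥ m + p ^ 2 * (T *ᵥ m ⬝ᵥ B *ᵥ T *ᵥ m), by ring⟩

end Arithmetic

section Minkowski

open MeasureTheory in
lemma minkowski_box {ι : Type*} [Fintype ι] [DecidableEq ι] {A : Matrix ι ι ℝ} (hA : A.det ≠ 0)
    {b : ι → ℝ} (hb : ∀ i, 0 < b i) (h : |A.det| < ∏ i, b i) :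
    ∃ m : ι → ℤ, m ≠ 0 ∧ ∀ i, |(A *ᵥ fun j => (m j : ℝ)) i| < b i := by
  set s : Set (ι → ℝ) := (Matrix.toLin' A) ⁻¹' Set.pi Set.univ fun i => Set.Ioo (-b i) (b i)
  have hmem : ∀ x, x ∈ s ↔ ∀ i, |(A *ᵥ x) i| < b i := by
    intro x
    simp [s, abs_lt]
  have hvol : volume s = ENNReal.ofReal (|A.det|⁻¹ * ∏ i, (2 * b i)) := by
    rw [Measure.addHaar_preimage_linearMap _ (by simpa using hA), Real.volume_pi_Ioo,
      LinearMap.det_toLin', ENNReal.ofReal_mul (by positivity),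
      ENNReal.ofReal_prod_of_nonneg (fun i _ => by have := hb i; positivity), abs_inv]
    congr 1
    exact Finset.prod_congr rfl fun i _ => by congr 1; ring
  have hfund : volume (ZSpan.fundamentalDomain (Pi.basisFun ℝ ι)) = 1 := by
    rw [ZSpan.fundamentalDomain_pi_basisFun, volume_pi_pi]
    simp
  have hconv : Convex ℝ s :=
    (convex_pi fun i _ => convex_Ioo (-b i) (b i)).linear_preimage _
  have hcount : Countable (Submodule.span ℤ (Set.range (Pi.basisFun ℝ ι))).toAddSubgroup :=
    inferInstanceAs (Countable (Submodule.span ℤ (Set.range (Pi.basisFun ℝ ι))))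
  obtain ⟨x, hx0, hxs⟩ := exists_ne_zero_mem_lattice_of_measure_mul_two_pow_lt_measure
    (ZSpan.isAddFundamentalDomain' (Pi.basisFun ℝ ι) volume) (s := s)
    (fun x hx => by
      rw [hmem] at *
      intro i
      rw [mulVec_neg, Pi.neg_apply, abs_neg]
      exact hx i) hconv (by
      rw [hfund, hvol, one_mul, Module.finrank_fintype_fun_eq_card, Finset.prod_mul_distrib]
      have e : (2 : ENNReal) ^ Fintype.card ι = ENNReal.ofReal (2 ^ Fintype.card ι) := by
        rw [ENNReal.ofReal_pow (by norm_num)]; simp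
      have h0 : 0 < |A.det| := abs_pos.2 hA
      have h1 : 0 < ∏ i, b i := Finset.prod_pos fun i _ => hb i
      rw [e, ENNReal.ofReal_lt_ofReal_iff (by positivity)]
      simp only [Finset.prod_const, Finset.card_univ]
      rw [mul_left_comm]
      have h2 : 1 < |A.det|⁻¹ * ∏ i, b i := by
        rw [inv_mul_eq_div, one_lt_div h0]; exact h
      have h3 : (0 : ℝ) < 2 ^ Fintype.card ι := by positivity
      nlinarith)
  have hx := x.2
  choose m hm using ((Pi.basisFun ℝ ι).mem_span_iff_repr_mem ℤ (x : ι → ℝ)).1 hx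
  have hxm : (x : ι → ℝ) = fun j => (m j : ℝ) := by
    ext j
    have := hm j
    simpa using this.symm
  refine ⟨m, ?_, ?_⟩
  · rintro rfl
    apply hx0
    ext j
    simp [hxm]
  · rw [← hxm]
    exact (hmem _).1 hxs

lemma exists_bounded_pairing_ne {A : Matrix (Fin 3) (Fin 3) ℝ} (hA : A.det ≠ 0)
    (hmin : ∀ m : Fin 3 → ℤ, m ≠ 0 → ∃ i, 1 / 2 ≤ |(A *ᵥ fun j => (m j : ℝ)) i|)
    {ν : Fin 3 → ℝ} (hν : ν ≠ 0) : ∃ m : Fin 3 → ℤ,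
      (∀ i, |(A *ᵥ fun j => (m j : ℝ)) i| ≤ 64 * (|A.det| + 1)) ∧
      ν ⬝ᵥ (A *ᵥ fun j => (m j : ℝ)) ≠ 0 := by
  obtain ⟨i, -, hi⟩ := Finset.exists_max_image Finset.univ (fun i => |ν i|) ⟨0, by simp⟩
  have hdet : 0 ≤ |A.det| := abs_nonneg _
  obtain ⟨m, hm0, hm⟩ := minkowski_box hA
    (b := Function.update (fun _ => 1 / 8) i (64 * (|A.det| + 1)))
    (fun j => by
      by_cases hj : j = i
      · subst hj; simp; positivity
      · simp [hj])
    (by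
      rw [Finset.prod_update_of_mem (Finset.mem_univ i)]
      simp [Finset.card_sdiff]
      norm_num
      linarith)
  set w := A *ᵥ fun j => (m j : ℝ)
  have hwi : |w i| < 64 * (|A.det| + 1) := by simpa using hm i
  have hwj : ∀ j, j ≠ i → |w j| < 1 / 8 := fun j hj => by
    have := hm j
    rwa [Function.update_of_ne hj] at this
  have hwi' : 1 / 2 ≤ |w i| := by
    obtain ⟨j, hj⟩ := hmin m hm0
    by_cases hji : j = i
    · rwa [← hji]
    · have := hwj j hji
      linarith
  have hνi : 0 < |ν i| := by
    by_contra hcon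
    apply hν
    ext j
    have := hi j (Finset.mem_univ j)
    exact abs_eq_zero.1 (le_antisymm (by linarith) (abs_nonneg _))
  refine ⟨m, fun j => ?_, fun h0 => ?_⟩
  · by_cases hji : j = i
    · rw [hji]; exact hwi.le
    · have := hwj j hji
      linarith
  · have hsum : ν ⬝ᵥ w = ν i * w i + ∑ j ∈ Finset.univ.erase i, ν j * w j := by
      exact (Finset.add_sum_erase _ (fun j => ν j * w j) (Finset.mem_univ i)).symm
    have hle : |∑ j ∈ Finset.univ.erase i, ν j * w j| ≤ 2 * (|ν i| * (1 / 8)) := by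
      calc |∑ j ∈ Finset.univ.erase i, ν j * w j|
          ≤ ∑ j ∈ Finset.univ.erase i, |ν j * w j| := Finset.abs_sum_le_sum_abs _ _
        _ ≤ ∑ j ∈ Finset.univ.erase i, |ν i| * (1 / 8) := by
            refine Finset.sum_le_sum fun j hj => ?_
            rw [abs_mul]
            exact mul_le_mul (hi j (Finset.mem_univ j)) (hwj j (Finset.ne_of_mem_erase hj)).le
              (abs_nonneg _) (abs_nonneg _)
        _ = _ := by simp [Finset.card_erase_of_mem]
    rw [hsum] at h0
    have h1 : |ν i * w i| = |∑ j ∈ Finset.univ.erase i, ν j * w j| := by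
      rw [eq_neg_of_add_eq_zero_left h0, abs_neg]
    rw [abs_mul] at h1
    nlinarith

/-- A lattice of bounded covolume without short vectors contains a bounded frame. -/
lemma exists_bounded_matrix {A : Matrix (Fin 3) (Fin 3) ℝ} (hA : A.det ≠ 0)
    (hmin : ∀ m : Fin 3 → ℤ, m ≠ 0 → ∃ i, 1 / 2 ≤ |(A *ᵥ fun j => (m j : ℝ)) i|) :
    ∃ M : Matrix (Fin 3) (Fin 3) ℤ, M.det ≠ 0 ∧
      ∀ i j, |(A * M.map (Int.cast : ℤ → ℝ)) i j| ≤ 64 * (|A.det| + 1) := by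
  set S : Set (Fin 3 → ℝ) := {w | ∃ m : Fin 3 → ℤ, w = A *ᵥ (fun j => (m j : ℝ)) ∧
    ∀ i, |w i| ≤ 64 * (|A.det| + 1)}
  have hspan : Submodule.span ℝ S = ⊤ := by
    by_contra hne
    obtain ⟨f, hf0, hf⟩ := Submodule.exists_le_ker_of_lt_top _ (lt_top_iff_ne_top.2 hne)
    have hfν : ∀ w, f w = (fun i => f (Pi.single i 1)) ⬝ᵥ w := by
      intro w
      conv_lhs => rw [pi_eq_sum_univ' w]
      simp [dotProduct, mul_comm, map_sum]
    obtain ⟨m, hm1, hm2⟩ := exists_bounded_pairing_ne hA hmin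
      (ν := fun i => f (Pi.single i 1)) (by
        intro h0
        apply hf0
        ext w
        simpa using congrFun h0 w)
    apply hm2
    rw [← hfν]
    exact hf (Submodule.subset_span ⟨m, rfl, hm1⟩)
  have hfr : Module.finrank ℝ (Submodule.span ℝ S) = 3 := by
    rw [hspan, finrank_top]; simp
  obtain ⟨f, hfS, -, hfli⟩ := Submodule.exists_fun_fin_finrank_span_eq ℝ S
  choose m hm1 hm2 using fun i : Fin 3 => hfS (Fin.cast hfr.symm i)
  have hli : LinearIndependent ℝ fun i : Fin 3 => f (Fin.cast hfr.symm i) :=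
    hfli.comp _ (Fin.cast_injective _)
  let M : Matrix (Fin 3) (Fin 3) ℤ := (Matrix.of m)ᵀ
  have hcol : ∀ i j, (A * M.map (Int.cast : ℤ → ℝ)) i j = f (Fin.cast hfr.symm j) i := by
    intro i j
    rw [hm1]
    simp [Matrix.mul_apply, mulVec, dotProduct, M]
  refine ⟨M, ?_, fun i j => ?_⟩
  · intro h0
    have h1 : IsUnit (A * M.map (Int.cast : ℤ → ℝ)) := by
      rw [← Matrix.linearIndependent_cols_iff_isUnit]
      have h2 : (fun i : Fin 3 => f (Fin.cast hfr.symm i)) =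
          (A * M.map (Int.cast : ℤ → ℝ)).col := by
        ext j i
        exact (hcol i j).symm
      exact h2 ▸ hli
    have h2 := (Matrix.isUnit_iff_isUnit_det _).1 h1
    have h3 : (M.map (Int.cast : ℤ → ℝ)).det = ((M.det : ℤ) : ℝ) := by
      simpa using ((Int.castRingHom ℝ).map_det M).symm
    rw [det_mul, h3, h0] at h2
    simp at h2
  · rw [hcol]
    exact hm2 j i

end Minkowski

section Extension

variable {N : ℕ}

/-- An isometry between bases of a common nondegenerate subspace extends by the identity on the
orthogonal complement. -/
lemma isometry_extension {S : Matrix (Fin N) (Fin N) ℝ} (hS : S.IsSymm)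
    {b : Matrix (Fin N) (Fin 3) ℝ} {Q H : Matrix (Fin 3) (Fin 3) ℝ} (hH : bᵀ * S * b = H)
    (hdet : H.det ≠ 0) (hQ : (b + b * Q)ᵀ * S * (b + b * Q) = H) :
    (1 + b * Q * H⁻¹ * bᵀ * S)ᵀ * S * (1 + b * Q * H⁻¹ * bᵀ * S) = S ∧
      (1 + b * Q * H⁻¹ * bᵀ * S) * b = b + b * Q := by
  have hHs : Hᵀ = H := by
    rw [← hH]
    simp [transpose_mul, hS.eq, Matrix.mul_assoc]
  have hHi : H⁻¹ᵀ = H⁻¹ := by rw [transpose_nonsing_inv, hHs]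
  have h1 : H⁻¹ * H = 1 := nonsing_inv_mul _ (Ne.isUnit hdet)
  have h2 : H * H⁻¹ = 1 := mul_nonsing_inv _ (Ne.isUnit hdet)
  obtain ⟨c, hc⟩ : ∃ c, c = bᵀ * S := ⟨_, rfl⟩
  have hct : S * b = cᵀ := by rw [hc, transpose_mul, transpose_transpose, hS.eq]
  have hcb : c * b = H := by rw [hc, hH]
  have hQ' : Qᵀ * H + H * Q + Qᵀ * H * Q = 0 := by
    have h3 : (b + b * Q)ᵀ * S * (b + b * Q) = H + (Qᵀ * H + H * Q + Qᵀ * H * Q) := by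
      have h4 : (b + b * Q)ᵀ * S = c + Qᵀ * c := by
        rw [transpose_add, transpose_mul, Matrix.add_mul, Matrix.mul_assoc, ← hc]
      rw [h4]
      simp only [Matrix.add_mul, Matrix.mul_add, Matrix.mul_assoc, hcb]
      rw [← Matrix.mul_assoc c b Q, hcb]
      abel
    rw [h3] at hQ
    simpa using hQ
  have hg : 1 + b * Q * H⁻¹ * bᵀ * S = 1 + b * (Q * H⁻¹) * c := by
    rw [hc]; simp only [Matrix.mul_assoc]
  rw [hg]
  constructor
  · have h5 : (1 + b * (Q * H⁻¹) * c)ᵀ * S = S + cᵀ * (H⁻¹ * Qᵀ) * c := by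
      rw [transpose_add, transpose_one, transpose_mul, transpose_mul, transpose_mul, hHi,
        Matrix.add_mul, Matrix.one_mul]
      simp only [Matrix.mul_assoc, ← hc]
    rw [h5]
    have h6 : (S + cᵀ * (H⁻¹ * Qᵀ) * c) * (1 + b * (Q * H⁻¹) * c) =
        S + cᵀ * (H⁻¹ * Qᵀ + Q * H⁻¹ + H⁻¹ * Qᵀ * H * Q * H⁻¹) * c := by
      simp only [Matrix.add_mul, Matrix.mul_add, Matrix.mul_one, Matrix.mul_assoc]
      rw [← Matrix.mul_assoc S b, hct, ← Matrix.mul_assoc c b, hcb]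
      abel
    have h7 : H⁻¹ * Qᵀ + Q * H⁻¹ + H⁻¹ * Qᵀ * H * Q * H⁻¹ =
        H⁻¹ * (Qᵀ * H + H * Q + Qᵀ * H * Q) * H⁻¹ := by
      simp only [Matrix.mul_add, Matrix.add_mul, Matrix.mul_assoc]
      rw [h2, Matrix.mul_one, ← Matrix.mul_assoc H⁻¹ H, h1, Matrix.one_mul]
    rw [h6, h7, hQ']
    simp
  · rw [Matrix.add_mul, Matrix.one_mul]
    simp only [Matrix.mul_assoc]
    rw [hcb, h1, Matrix.mul_one]

/-- Integral version: bases of a common sublattice with the same Gram matrix `H`, congruent modulo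
`det H`, are related by an integral isometry. -/
lemma exists_integral_isometry {B : Matrix (Fin N) (Fin N) ℤ} (hB : B.IsSymm)
    {K : Matrix (Fin N) (Fin 3) ℤ} {M M' H : Matrix (Fin 3) (Fin 3) ℤ} (hM : M.det ≠ 0)
    (hH : (K * M)ᵀ * B * (K * M) = H) (hH' : (K * M')ᵀ * B * (K * M') = H) (hdet : H.det ≠ 0)
    (hmod : ∀ i j, H.det ∣ (K * M' - K * M) i j) :
    ∃ g : Matrix (Fin N) (Fin N) ℤ, gᵀ * B * g = B ∧ g * (K * M) = K * M' := by
  choose T hT using hmod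
  have hT' : K * M' - K * M = H.det • Matrix.of T := by
    ext i j; simp [hT i j]
  refine ⟨1 + Matrix.of T * H.adjugate * (K * M)ᵀ * B, ?_, ?_⟩
  swap
  · rw [Matrix.add_mul, Matrix.one_mul, Matrix.mul_assoc _ B, Matrix.mul_assoc _ (K * M)ᵀ,
      ← Matrix.mul_assoc (K * M)ᵀ, hH, Matrix.mul_assoc, adjugate_mul, Matrix.mul_smul,
      Matrix.mul_one, ← hT']
    abel
  · let f : ℤ →+* ℝ := Int.castRingHom ℝ
    have hf : Function.Injective f := Int.cast_injective
    have hmap : ∀ {m : ℕ} (A : Matrix (Fin m) (Fin m) ℤ), (A.map f).det = f A.det := fun A => by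
      rw [RingHom.map_det]; rfl
    have hMd : IsUnit (M.map f).det := by
      rw [hmap]; exact Ne.isUnit fun h => hM (hf (by simpa using h))
    have hHd : (H.map f).det ≠ 0 := by
      rw [hmap]; exact fun h => hdet (hf (by simpa using h))
    set b := (K * M).map f with hb
    set Q := (M.map f)⁻¹ * (M'.map f) - 1 with hQ
    have hbQ : b * Q = (K * M').map f - b := by
      rw [hQ, Matrix.mul_sub, hb, Matrix.map_mul, Matrix.mul_assoc, ← Matrix.mul_assoc (M.map f),
        mul_nonsing_inv _ hMd, Matrix.one_mul, ← Matrix.map_mul, Matrix.mul_one, Matrix.map_mul]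
    have hbb : b + b * Q = (K * M').map f := by rw [hbQ]; abel
    have hgr : ∀ X : Matrix (Fin N) (Fin 3) ℤ,
        (X.map f)ᵀ * B.map f * X.map f = (Xᵀ * B * X).map f := fun X => by
      rw [← transpose_map, ← Matrix.map_mul, ← Matrix.map_mul]
    have key := isometry_extension (S := B.map f) (b := b) (Q := Q) (H := H.map f)
      (by rw [IsSymm, ← transpose_map, hB.eq])
      (by rw [hb, hgr, hH]) hHd
      (by rw [hbb, hgr, hH'])
    have hg : (1 + Matrix.of T * H.adjugate * (K * M)ᵀ * B).map f =
        1 + b * Q * (H.map f)⁻¹ * bᵀ * B.map f := by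
      have h1 : b * Q * (H.map f)⁻¹ = (Matrix.of T * H.adjugate).map f := by
        have h2 : b * Q = f H.det • (Matrix.of T).map f := by
          rw [hbQ, hb]
          have := congrArg (fun A => A.map f) hT'
          ext i j
          have := congrFun (congrFun this i) j
          simpa only [Matrix.map_apply, Matrix.sub_apply, Matrix.smul_apply, map_sub, map_mul,
            smul_eq_mul] using this
        have h3 : f H.det ≠ 0 := by rw [← hmap]; exact hHd
        rw [h2, Matrix.inv_def, hmap, Ring.inverse_eq_inv', Matrix.smul_mul, Matrix.mul_smul,
          smul_smul, mul_inv_cancel₀ h3, one_smul, Matrix.map_mul]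
        congr 1
        exact (RingHom.map_adjugate f H).symm
      rw [h1, hb, ← transpose_map, ← Matrix.map_mul, ← Matrix.map_mul,
        Matrix.map_add _ (map_add f), Matrix.map_one _ (map_zero f) (map_one f)]
    apply Matrix.map_injective hf
    beta_reduce
    rw [Matrix.map_mul, Matrix.map_mul, transpose_map, hg]
    exact key.1

end Extension

section FiniteReps

variable {N : ℕ} {B : Matrix (Fin N) (Fin N) ℤ} {D : Set (Fin N → ℂ)}

lemma Same.cj {Z W : Fin N → ℂ} (h : Same B Z W) : Same B (cj Z) (cj W) := by
  unfold Same at *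
  rwa [cpair_cj, cpair_cj, RCLike.norm_conj, RCLike.norm_conj]

lemma exists_coset_reps (hB : Hyp B) (hdet : B.det ≠ 0) (hD : IsComponent B D)
    {Γ : Set (Matrix (Fin N) (Fin N) ℤ)} (hΓ : IsFiniteIndexSubgroup B D Γ) :
    ∃ S : Set (Matrix (Fin N) (Fin N) ℤ), S.Finite ∧
      ∀ g, gᵀ * B * g = B → ∃ s ∈ S, ∃ γ ∈ Γ, g = s * γ := by
  obtain ⟨S, hS⟩ := hΓ.finite_index
  obtain ⟨Z, hZ⟩ := hD.nonempty
  have hcase : ∀ g, gᵀ * B * g = B → actC g Z ∈ D ∨ cj (actC g Z) ∈ D := fun g hg =>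
    hD.mem_or_cj_mem hB (actC_mem_cone hg (hD.subset hZ))
  by_cases hex : ∃ g₁ : Matrix (Fin N) (Fin N) ℤ, g₁ᵀ * B * g₁ = B ∧ cj (actC g₁ Z) ∈ D
  · obtain ⟨g₁, hg₁, hgD⟩ := hex
    obtain ⟨h₁, -, h2, -⟩ := exists_inv_isometry hdet hg₁
    refine ⟨↑S ∪ (fun s => h₁ * s) '' ↑S, S.finite_toSet.union (S.finite_toSet.image _), ?_⟩
    intro g hg
    rcases hcase g hg with h | h
    · obtain ⟨s, hs, γ, hγ, e⟩ := hS g (mem_OPlus_of_mem hB hdet hD hg hZ h)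
      exact ⟨s, Or.inl hs, γ, hγ, e⟩
    · have hiso : (g₁ * g)ᵀ * B * (g₁ * g) = B := by
        have : (g₁ * g)ᵀ * B * (g₁ * g) = gᵀ * (g₁ᵀ * B * g₁) * g := by
          simp only [transpose_mul, Matrix.mul_assoc]
        rw [this, hg₁, hg]
      have hmem : actC (g₁ * g) Z ∈ D := by
        refine (hD.mem_iff hB hgD).2 ⟨actC_mem_cone hiso (hD.subset hZ), ?_⟩
        have h3 := (same_actC hg₁ ((hD.mem_iff hB hZ).1 h).2).cj
        rwa [cj_actC g₁ (cj _), cj_cj, ← actC_mul] at h3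
      obtain ⟨s, hs, γ, hγ, e⟩ := hS _ (mem_OPlus_of_mem hB hdet hD hiso hZ hmem)
      refine ⟨h₁ * s, Or.inr ⟨s, hs, rfl⟩, γ, hγ, ?_⟩
      rw [Matrix.mul_assoc, ← e, ← Matrix.mul_assoc, h2, Matrix.one_mul]
  · refine ⟨↑S, S.finite_toSet, fun g hg => ?_⟩
    rcases hcase g hg with h | h
    · exact hS g (mem_OPlus_of_mem hB hdet hD hg hZ h)
    · exact (hex ⟨g, hg, h⟩).elim

lemma exists_finite_transversal {α β : Type*} {A : Set α} (c : α → β) (hc : (c '' A).Finite) :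
    ∃ F ⊆ A, F.Finite ∧ ∀ a ∈ A, ∃ a' ∈ F, c a' = c a := by
  obtain ⟨F, hFA, hF⟩ := Set.exists_subset_bijOn A c
  refine ⟨F, hFA, Set.Finite.of_finite_image (by rwa [hF.image_eq]) hF.injOn, fun a ha => ?_⟩
  have : c a ∈ c '' F := by rw [hF.image_eq]; exact ⟨a, ha, rfl⟩
  exact this

lemma exists_finite_reps_of_gram (hB : Hyp B) (hdet : B.det ≠ 0) (hD : IsComponent B D)
    {Γ : Set (Matrix (Fin N) (Fin N) ℤ)} (hΓ : IsFiniteIndexSubgroup B D Γ)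
    (K : Matrix (Fin N) (Fin 3) ℤ) {H : Matrix (Fin 3) (Fin 3) ℤ} (hH : H.det ≠ 0) :
    ∃ S : Set (Matrix (Fin 3) (Fin 3) ℤ), S.Finite ∧ ∀ M : Matrix (Fin 3) (Fin 3) ℤ,
      M.det ≠ 0 → (K * M)ᵀ * B * (K * M) = H → ∃ γ ∈ Γ, ∃ M₁ ∈ S, K * M = γ * (K * M₁) := by
  set A : Set (Matrix (Fin 3) (Fin 3) ℤ) := {M | M.det ≠ 0 ∧ (K * M)ᵀ * B * (K * M) = H}
  obtain ⟨S, hSf, hS⟩ := exists_coset_reps hB hdet hD hΓ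
  have hne : NeZero H.det.natAbs := ⟨Int.natAbs_ne_zero.2 hH⟩
  obtain ⟨F₀, hF₀A, hF₀, hF⟩ := exists_finite_transversal (A := A)
    (fun M => fun i j => (((K * M) i j : ℤ) : ZMod H.det.natAbs)) (Set.toFinite _)
  have h1 : ∀ M ∈ A, ∃ p ∈ F₀ ×ˢ S, ∃ γ ∈ Γ, K * p.1 = p.2 * γ * (K * M) ∧
      ∃ h : Matrix (Fin N) (Fin N) ℤ, h * p.2 = 1 := by
    intro M hM
    obtain ⟨M₀, hM₀, hc⟩ := hF M hM
    obtain ⟨g, hg, hgM⟩ := exists_integral_isometry hB.symm hM.1 hM.2 (hF₀A hM₀).2 hH (by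
      intro i j
      have h2 := congrFun (congrFun hc i) j
      rw [ZMod.intCast_eq_intCast_iff_dvd_sub, Int.natCast_natAbs, abs_dvd] at h2
      rw [Matrix.sub_apply, ← dvd_neg, neg_sub]
      exact h2)
    obtain ⟨s, hs, γ, hγ, e⟩ := hS g hg
    obtain ⟨h, -, hhg, -⟩ := exists_inv_isometry hdet hg
    obtain ⟨γi, -, hγi, -⟩ := hΓ.inv_mem γ hγ
    refine ⟨(M₀, s), ⟨hM₀, hs⟩, γ, hγ, ?_, γ * h, ?_⟩
    · rw [← hgM, e]
    · have h3 : s = g * γi := by rw [e, Matrix.mul_assoc, hγi, Matrix.mul_one]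
      change γ * h * s = 1
      rw [h3, Matrix.mul_assoc, ← Matrix.mul_assoc h, hhg, Matrix.one_mul, hγi]
  choose! p hp γ hγ hpγ hinv using h1
  obtain ⟨F, hFA, hFf, hF'⟩ := exists_finite_transversal (A := A) p
    ((hF₀.prod hSf).subset (Set.image_subset_iff.2 fun M hM => hp M hM))
  refine ⟨F, hFf, fun M hM1 hM2 => ?_⟩
  obtain ⟨M₁, hM₁, hpe⟩ := hF' M ⟨hM1, hM2⟩
  have hM : M ∈ A := ⟨hM1, hM2⟩
  have e1 := hpγ M hM
  have e2 := hpγ M₁ (hFA hM₁)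
  rw [hpe, e1] at e2
  obtain ⟨h, hh⟩ := hinv M hM
  obtain ⟨γi, hγi, -, hγi2⟩ := hΓ.inv_mem _ (hγ M hM)
  refine ⟨γi * γ M₁, hΓ.mul_mem _ hγi _ (hγ _ (hFA hM₁)), M₁, hM₁, ?_⟩
  have e3 := congrArg (fun X => γi * (h * X)) e2
  simp only [← Matrix.mul_assoc] at e3
  rw [Matrix.mul_assoc γi h, hh, Matrix.mul_one, hγi2, Matrix.one_mul] at e3
  simpa only [Matrix.mul_assoc] using e3

/-- Bases of bounded Gram matrix in the sublattice spanned by `K` form finitely many orbits. -/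
lemma exists_finite_reps (hB : Hyp B) (hdet : B.det ≠ 0) (hD : IsComponent B D)
    {Γ : Set (Matrix (Fin N) (Fin N) ℤ)} (hΓ : IsFiniteIndexSubgroup B D Γ)
    (K : Matrix (Fin N) (Fin 3) ℤ) (R : ℤ) :
    ∃ S : Set (Matrix (Fin 3) (Fin 3) ℤ), S.Finite ∧ ∀ M : Matrix (Fin 3) (Fin 3) ℤ,
      M.det ≠ 0 → ((K * M)ᵀ * B * (K * M)).det ≠ 0 →
      (∀ i j, |((K * M)ᵀ * B * (K * M)) i j| ≤ R) → ∃ γ ∈ Γ, ∃ M₁ ∈ S, K * M = γ * (K * M₁) := by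
  have h1 : ∀ H : Matrix (Fin 3) (Fin 3) ℤ, ∃ S : Set (Matrix (Fin 3) (Fin 3) ℤ), S.Finite ∧
      ∀ M : Matrix (Fin 3) (Fin 3) ℤ, M.det ≠ 0 → H.det ≠ 0 → (K * M)ᵀ * B * (K * M) = H →
        ∃ γ ∈ Γ, ∃ M₁ ∈ S, K * M = γ * (K * M₁) := by
    intro H
    by_cases hH : H.det = 0
    · exact ⟨∅, Set.finite_empty, fun M _ h => (h hH).elim⟩
    · obtain ⟨S, hS, h⟩ := exists_finite_reps_of_gram hB hdet hD hΓ K hH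
      exact ⟨S, hS, fun M hM _ => h M hM⟩
  choose S hSf hS using h1
  have hfin : {H : Matrix (Fin 3) (Fin 3) ℤ | ∀ i j, |H i j| ≤ R}.Finite := by
    have h2 : (Set.pi Set.univ fun _ : Fin 3 => Set.pi Set.univ fun _ : Fin 3 =>
        Set.Icc (-R) R).Finite :=
      Set.Finite.pi fun _ => Set.Finite.pi fun _ => Set.finite_Icc _ _
    exact h2.subset fun H hH i _ j _ => abs_le.1 (hH i j)
  refine ⟨⋃ H ∈ {H : Matrix (Fin 3) (Fin 3) ℤ | ∀ i j, |H i j| ≤ R}, S H,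
    hfin.biUnion fun H _ => hSf H, fun M h1 h2 h3 => ?_⟩
  obtain ⟨γ, hγ, M₁, hM₁, e⟩ := hS _ M h1 h2 rfl
  exact ⟨γ, hγ, M₁, Set.mem_biUnion h3 hM₁, e⟩

end FiniteReps

section Frames

variable {N : ℕ} {B : Matrix (Fin N) (Fin N) ℤ} {D : Set (Fin N → ℂ)}

/-- The standard Lorentzian form of signature `(2,1)`. -/
def lorentz : Matrix (Fin 3) (Fin 3) ℝ := diagonal ![1, 1, -1]

/-- The integral Gram matrix over the reals. -/
noncomputable def toR {a b : ℕ} (A : Matrix (Fin a) (Fin b) ℤ) : Matrix (Fin a) (Fin b) ℝ :=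
  A.map (Int.cast : ℤ → ℝ)

/-- A triple of real vectors, as columns, with Gram matrix `diag(1,1,-1)`. -/
def IsFrame (B : Matrix (Fin N) (Fin N) ℤ) (X : Matrix (Fin N) (Fin 3) ℝ) : Prop :=
  Xᵀ * toR B * X = lorentz

/-- The isotropic vector spanned by the first two columns. -/
noncomputable def pt (X : Matrix (Fin N) (Fin 3) ℝ) : Fin N → ℂ :=
  realC (fun i => X i 0) + Complex.I • realC (fun i => X i 1)

lemma toR_mul {a b c : ℕ} (A : Matrix (Fin a) (Fin b) ℤ) (A' : Matrix (Fin b) (Fin c) ℤ) :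
    toR (A * A') = toR A * toR A' :=
  Matrix.map_mul (f := Int.castRingHom ℝ)

lemma toR_transpose {a b : ℕ} (A : Matrix (Fin a) (Fin b) ℤ) : toR Aᵀ = (toR A)ᵀ := rfl

lemma det_toR {a : ℕ} (A : Matrix (Fin a) (Fin a) ℤ) : (toR A).det = (A.det : ℝ) :=
  ((Int.castRingHom ℝ).map_det A).symm

lemma gram_apply (X : Matrix (Fin N) (Fin 3) ℝ) (i j : Fin 3) :
    (Xᵀ * toR B * X) i j = rpair B (fun a => X a i) (fun a => X a j) := by
  rw [rpair_eq_dotProduct, Matrix.mul_assoc, Matrix.mul_apply]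
  simp only [dotProduct, mulVec, transpose_apply, Matrix.mul_apply, toR]

lemma IsFrame.rpair {X : Matrix (Fin N) (Fin 3) ℝ} (hX : IsFrame B X) (i j : Fin 3) :
    rpair B (fun a => X a i) (fun a => X a j) = lorentz i j := by
  rw [← gram_apply, hX]

lemma IsFrame.cpair_pt {X : Matrix (Fin N) (Fin 3) ℝ} (hX : IsFrame B X) :
    cpair B (pt X) (pt X) = 0 ∧ cpair B (pt X) (cj (pt X)) = 2 := by
  have h00 := hX.rpair 0 0
  have h01 := hX.rpair 0 1
  have h10 := hX.rpair 1 0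
  have h11 := hX.rpair 1 1
  simp only [pt, cj_add, cj_smul, cj_realC, cpair_add_left, cpair_add_right, cpair_smul_left,
    cpair_smul_right, cpair_realC, h00, h01, h10, h11, lorentz, Complex.conj_I]
  have hI := Complex.I_mul_I
  constructor
  · simp
  · simp; norm_num

lemma IsFrame.mem_cone {X : Matrix (Fin N) (Fin 3) ℝ} (hX : IsFrame B X) : pt X ∈ Cone B := by
  rw [Refl.mem_cone, hX.cpair_pt.1, hX.cpair_pt.2]
  simp

lemma actC_realC (g : Matrix (Fin N) (Fin N) ℤ) (x : Fin N → ℝ) :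
    actC g (realC x) = realC (toR g *ᵥ x) := by
  ext i
  simp [actC, realC, mulVec, dotProduct, toR]

lemma actC_pt (g : Matrix (Fin N) (Fin N) ℤ) (X : Matrix (Fin N) (Fin 3) ℝ) :
    actC g (pt X) = pt (toR g * X) := by
  rw [pt, actC_add, actC_smul, actC_realC, actC_realC]
  rfl

lemma IsFrame.act {g : Matrix (Fin N) (Fin N) ℤ} (hg : gᵀ * B * g = B)
    {X : Matrix (Fin N) (Fin 3) ℝ} (hX : IsFrame B (toR g * X)) : IsFrame B X := by
  have h1 : (toR g)ᵀ * toR B * toR g = toR B := by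
    rw [← toR_transpose, ← toR_mul, ← toR_mul, hg]
  unfold IsFrame at *
  calc Xᵀ * toR B * X = Xᵀ * ((toR g)ᵀ * toR B * toR g) * X := by rw [h1]
    _ = (toR g * X)ᵀ * toR B * (toR g * X) := by simp only [transpose_mul, Matrix.mul_assoc]
    _ = lorentz := hX

lemma det_lorentz : lorentz.det = -1 := by
  simp [lorentz, det_diagonal, Fin.prod_univ_three]

@[fun_prop]
lemma continuous_pt : Continuous (pt : Matrix (Fin N) (Fin 3) ℝ → Fin N → ℂ) := by
  unfold pt realC
  fun_prop

lemma lorentz_form (v : Fin 3 → ℝ) : v ⬝ᵥ lorentz *ᵥ v = v 0 ^ 2 + v 1 ^ 2 - v 2 ^ 2 := by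
  simp [lorentz, dotProduct, Fin.sum_univ_three, mulVec_diagonal]
  ring

lemma lorentz_gram {a : ℕ} (Y : Matrix (Fin 3) (Fin a) ℝ) (i j : Fin a) :
    (Yᵀ * lorentz * Y) i j = Y 0 i * Y 0 j + Y 1 i * Y 1 j - Y 2 i * Y 2 j := by
  rw [Matrix.mul_apply]
  simp [lorentz, Fin.sum_univ_three, mul_diagonal]
  ring

/-- Reduction: a frame in the span of `K` is bounded up to an integral change of basis. -/
lemma exists_reduced_frame {K : Matrix (Fin N) (Fin 3) ℤ}
    (hK : ∀ m, m ⬝ᵥ (Kᵀ * B * K) *ᵥ m = 0 → m = 0) :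
    ∃ R : ℤ, ∀ P, IsFrame B (toR K * P) → ∃ (M : Matrix (Fin 3) (Fin 3) ℤ)
      (Y : Matrix (Fin 3) (Fin 3) ℝ), M.det ≠ 0 ∧ (toR M = P * Y) ∧ 1 ≤ |Y.det| ∧
      (∀ i j, |Y i j| ≤ R) ∧ ((K * M)ᵀ * B * (K * M)).det ≠ 0 ∧
      ∀ i j, |((K * M)ᵀ * B * (K * M)) i j| ≤ R := by
  set G := Kᵀ * B * K with hG
  set R₀ : ℤ := 64 * (|G.det| + 2) with hR₀
  have hR₀0 : (128 : ℝ) ≤ R₀ := by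
    have : (128 : ℤ) ≤ R₀ := by
      have := abs_nonneg G.det
      omega
    exact_mod_cast this
  refine ⟨3 * R₀ ^ 2, fun P hP => ?_⟩
  have hPG : Pᵀ * toR G * P = lorentz := by
    rw [← hP, hG, toR_mul, toR_mul, toR_transpose, transpose_mul]
    simp only [Matrix.mul_assoc]
  have hPd : P.det ^ 2 * (G.det : ℝ) = -1 := by
    have := congrArg det hPG
    rw [det_mul, det_mul, det_transpose, det_toR, det_lorentz] at this
    linarith
  have hPu : P.det ≠ 0 := by
    intro h
    rw [h] at hPd
    norm_num at hPd
  have hPP : P⁻¹ * P = 1 := nonsing_inv_mul _ (Ne.isUnit hPu)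
  have hPP' : P * P⁻¹ = 1 := mul_nonsing_inv _ (Ne.isUnit hPu)
  obtain ⟨A, hA⟩ : ∃ A, A = P⁻¹ := ⟨_, rfl⟩
  rw [← hA] at hPP hPP'
  have hAd : A.det * P.det = 1 := by rw [← det_mul, hPP, det_one]
  have hA0 : A.det ≠ 0 := left_ne_zero_of_mul_eq_one hAd
  have hAG : (G.det : ℝ) = -A.det ^ 2 := by
    have : A.det ^ 2 * P.det ^ 2 = 1 := by rw [← mul_pow, hAd, one_pow]
    linear_combination (A.det) ^ 2 * hPd - (G.det : ℝ) * this
  have hGA : toR G = Aᵀ * lorentz * A := by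
    rw [← hPG]
    have h1 : Aᵀ * Pᵀ = 1 := by rw [← transpose_mul, hPP', transpose_one]
    calc toR G = (Aᵀ * Pᵀ) * toR G * (P * A) := by rw [h1, hPP']; simp
      _ = _ := by simp only [Matrix.mul_assoc]
  have hAle : |A.det| ≤ |(G.det : ℝ)| + 1 := by
    rw [hAG, abs_neg, abs_pow]
    nlinarith [sq_nonneg (|A.det| - 1), abs_nonneg A.det]
  obtain ⟨M, hM, hMb⟩ := exists_bounded_matrix hA0 (by
    intro m hm
    by_contra hcon
    push Not at hcon
    have h1 : m ⬝ᵥ G *ᵥ m ≠ 0 := fun h => hm (hK m h)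
    have h2 : ((m ⬝ᵥ G *ᵥ m : ℤ) : ℝ) = (A *ᵥ fun j => (m j : ℝ)) ⬝ᵥ lorentz *ᵥ
        (A *ᵥ fun j => (m j : ℝ)) := by
      have h3 : ((m ⬝ᵥ G *ᵥ m : ℤ) : ℝ) = (fun j => (m j : ℝ)) ⬝ᵥ toR G *ᵥ fun j => (m j : ℝ) := by
        simp [dotProduct, mulVec, toR]
      rw [h3, hGA, ← mulVec_mulVec, ← mulVec_mulVec, dotProduct_mulVec _ Aᵀ, vecMul_transpose]
    rw [lorentz_form] at h2
    have h4 : (1 : ℝ) ≤ |((m ⬝ᵥ G *ᵥ m : ℤ) : ℝ)| := by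
      exact_mod_cast Int.one_le_abs h1
    have h5 : ∀ i, (A *ᵥ fun j => (m j : ℝ)) i ^ 2 < 1 / 4 := fun i => by
      rw [← sq_abs]
      nlinarith [hcon i, abs_nonneg ((A *ᵥ fun j => (m j : ℝ)) i)]
    have h6 := h5 0
    have h7 := h5 1
    have h8 := h5 2
    rw [h2] at h4
    have : |(A *ᵥ fun j => (m j : ℝ)) 0 ^ 2 + (A *ᵥ fun j => (m j : ℝ)) 1 ^ 2 -
        (A *ᵥ fun j => (m j : ℝ)) 2 ^ 2| < 1 := by
      rw [abs_lt]
      constructor <;> nlinarith [sq_nonneg ((A *ᵥ fun j => (m j : ℝ)) 0),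
        sq_nonneg ((A *ᵥ fun j => (m j : ℝ)) 1), sq_nonneg ((A *ᵥ fun j => (m j : ℝ)) 2)]
    linarith)
  have hYb : ∀ i j, |(A * toR M) i j| ≤ R₀ := fun i j => by
    refine (hMb i j).trans ?_
    rw [hR₀]
    simp only [Int.cast_mul, Int.cast_add, Int.cast_abs, Int.cast_ofNat]
    linarith
  have hH : toR ((K * M)ᵀ * B * (K * M)) = (A * toR M)ᵀ * lorentz * (A * toR M) := by
    have : (K * M)ᵀ * B * (K * M) = Mᵀ * G * M := by
      rw [hG, transpose_mul]; simp only [Matrix.mul_assoc]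
    rw [this, toR_mul, toR_mul, hGA, transpose_mul, toR_transpose]
    simp only [Matrix.mul_assoc]
  have hHd : (((K * M)ᵀ * B * (K * M)).det : ℝ) = - (A * toR M).det ^ 2 := by
    rw [← det_toR, hH, det_mul, det_mul, det_transpose, det_lorentz]
    ring
  have hYd : (A * toR M).det ≠ 0 := by
    rw [det_mul, det_toR]
    exact mul_ne_zero hA0 (by exact_mod_cast hM)
  have hHd0 : ((K * M)ᵀ * B * (K * M)).det ≠ 0 := by
    intro h
    rw [h, Int.cast_zero] at hHd
    exact hYd (by simpa using hHd.symm)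
  refine ⟨M, A * toR M, hM, ?_, ?_, ?_, hHd0, ?_⟩
  · rw [← Matrix.mul_assoc, hPP', Matrix.one_mul]
  · have h1 : (1 : ℝ) ≤ |(((K * M)ᵀ * B * (K * M)).det : ℝ)| := by
      exact_mod_cast Int.one_le_abs hHd0
    rw [hHd, abs_neg, abs_pow] at h1
    nlinarith [abs_nonneg (A * toR M).det]
  · intro i j
    refine (hYb i j).trans ?_
    push_cast
    nlinarith
  · intro i j
    have h1 : ((((K * M)ᵀ * B * (K * M)) i j : ℤ) : ℝ) =
        (A * toR M) 0 i * (A * toR M) 0 j + (A * toR M) 1 i * (A * toR M) 1 j -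
          (A * toR M) 2 i * (A * toR M) 2 j := by
      rw [← lorentz_gram, ← hH]
      rfl
    have h3 : ∀ a, |(A * toR M) a i * (A * toR M) a j| ≤ R₀ ^ 2 := fun a => by
      rw [abs_mul, sq]
      exact mul_le_mul (hYb a i) (hYb a j) (abs_nonneg _) (by linarith)
    have h4 : |((((K * M)ᵀ * B * (K * M)) i j : ℤ) : ℝ)| ≤ 3 * R₀ ^ 2 := by
      rw [h1, abs_le]
      have a0 := abs_le.1 (h3 0)
      have a1 := abs_le.1 (h3 1)
      have a2 := abs_le.1 (h3 2)
      constructor <;> linarith [a0.1, a0.2, a1.1, a1.2, a2.1, a2.2]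
    exact_mod_cast h4

end Frames

section Maximum

variable {N : ℕ} {B : Matrix (Fin N) (Fin N) ℤ} {D : Set (Fin N → ℂ)}

lemma continuousOn_frame (E : Matrix (Fin N) (Fin 3) ℝ) :
    ContinuousOn (fun Y : Matrix (Fin 3) (Fin 3) ℝ => E * Y⁻¹) {Y | 1 ≤ |Y.det|} := by
  have h1 : ContinuousOn (fun Y : Matrix (Fin 3) (Fin 3) ℝ => Y.det⁻¹ • Y.adjugate)
      {Y | 1 ≤ |Y.det|} := by
    refine ContinuousOn.smul (f := fun Y : Matrix (Fin 3) (Fin 3) ℝ => Y.det⁻¹)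
      (g := fun Y : Matrix (Fin 3) (Fin 3) ℝ => Y.adjugate) (ContinuousOn.inv₀ ?_ ?_) ?_
    · exact Continuous.continuousOn (by fun_prop)
    swap
    · exact Continuous.continuousOn (by fun_prop)
    intro Y hY h0
    have : (1 : ℝ) ≤ |Y.det| := hY
    rw [h0, abs_zero] at this
    linarith
  have h2 : ContinuousOn (fun Y : Matrix (Fin 3) (Fin 3) ℝ => E * (Y.det⁻¹ • Y.adjugate))
      {Y | 1 ≤ |Y.det|} := by
    exact (continuous_const.matrix_mul continuous_id).comp_continuousOn h1
  refine h2.congr fun Y _ => ?_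
  simp only
  rw [Matrix.inv_def, Ring.inverse_eq_inv']

lemma isCompact_frames (hB : Hyp B) (hD : IsComponent B D) (E : Matrix (Fin N) (Fin 3) ℝ) (R : ℝ) :
    IsCompact {Y : Matrix (Fin 3) (Fin 3) ℝ | (∀ i j, |Y i j| ≤ R) ∧ 1 ≤ |Y.det| ∧
      IsFrame B (E * Y⁻¹) ∧ pt (E * Y⁻¹) ∈ D} := by
  have hcpt : IsCompact {Y : Matrix (Fin 3) (Fin 3) ℝ | ∀ i j, |Y i j| ≤ R} := by
    have h2 : IsCompact (Set.pi Set.univ fun _ : Fin 3 => Set.pi Set.univ fun _ : Fin 3 =>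
        Set.Icc (-R) R) :=
      isCompact_univ_pi fun _ => isCompact_univ_pi fun _ => isCompact_Icc
    have h3 : {Y : Matrix (Fin 3) (Fin 3) ℝ | ∀ i j, |Y i j| ≤ R} =
        Set.pi Set.univ fun _ : Fin 3 => Set.pi Set.univ fun _ : Fin 3 => Set.Icc (-R) R := by
      refine Set.ext fun Y => ?_
      exact ⟨fun h i _ j _ => abs_le.1 (h i j), fun h i j => abs_le.2 (h i trivial j trivial)⟩
    rw [h3]
    exact h2
  refine hcpt.of_isClosed_subset ?_ fun Y hY => hY.1
  have : FirstCountableTopology (Matrix (Fin 3) (Fin 3) ℝ) :=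
    inferInstanceAs (FirstCountableTopology (Fin 3 → Fin 3 → ℝ))
  refine IsSeqClosed.isClosed fun Y Y₀ hY hlim => ?_
  have hcl : IsClosed {Y : Matrix (Fin 3) (Fin 3) ℝ | 1 ≤ |Y.det|} :=
    isClosed_le continuous_const (by fun_prop)
  have h0 : 1 ≤ |Y₀.det| := hcl.mem_of_tendsto hlim (Filter.Eventually.of_forall fun n => (hY n).2.1)
  have hlim' : Filter.Tendsto (fun n => E * (Y n)⁻¹) Filter.atTop (nhds (E * Y₀⁻¹)) := by
    refine ((continuousOn_frame E) Y₀ h0).tendsto.comp ?_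
    exact tendsto_nhdsWithin_iff.2 ⟨hlim, Filter.Eventually.of_forall fun n => (hY n).2.1⟩
  have hfr : IsFrame B (E * Y₀⁻¹) := by
    have hc : Continuous fun X : Matrix (Fin N) (Fin 3) ℝ => Xᵀ * toR B * X := by fun_prop
    refine tendsto_nhds_unique ((hc.tendsto _).comp hlim') ?_
    refine tendsto_const_nhds.congr fun n => ?_
    exact ((hY n).2.2.1).symm
  refine ⟨hcpt.isClosed.mem_of_tendsto hlim (Filter.Eventually.of_forall fun n => (hY n).1), h0,
    hfr, ?_⟩
  exact hD.mem_of_tendsto hB hfr.mem_cone ((continuous_pt.tendsto _).comp hlim')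
    (Filter.Frequently.of_forall fun n => (hY n).2.2.2)

/-- On frames in the span of an anisotropic sublattice, a modular form attains its maximum. -/
lemma exists_max_frame (hB : Hyp B) (hdet : B.det ≠ 0) (hD : IsComponent B D)
    {Γ : Set (Matrix (Fin N) (Fin N) ℤ)} {χ : Matrix (Fin N) (Fin N) ℤ → ℂ}
    (hΓ : IsFiniteIndexSubgroup B D Γ) (hχ : IsCharacter Γ χ) {k : ℤ} {F : (Fin N → ℂ) → ℂ}
    (hF : IsModularForm B D Γ χ k F) {K : Matrix (Fin N) (Fin 3) ℤ}
    (hK : ∀ m, m ⬝ᵥ (Kᵀ * B * K) *ᵥ m = 0 → m = 0)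
    (hne : ∃ P : Matrix (Fin 3) (Fin 3) ℝ, IsFrame B (toR K * P) ∧ pt (toR K * P) ∈ D) :
    ∃ P : Matrix (Fin 3) (Fin 3) ℝ, IsFrame B (toR K * P) ∧ pt (toR K * P) ∈ D ∧
      ∀ P' : Matrix (Fin 3) (Fin 3) ℝ, IsFrame B (toR K * P') → pt (toR K * P') ∈ D →
        ‖F (pt (toR K * P'))‖ ≤ ‖F (pt (toR K * P))‖ := by
  obtain ⟨R, hR⟩ := exists_reduced_frame hK
  obtain ⟨S, hSf, hS⟩ := exists_finite_reps hB hdet hD hΓ K R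
  let C : Matrix (Fin 3) (Fin 3) ℤ → Set (Matrix (Fin 3) (Fin 3) ℝ) := fun M₁ =>
    {Y | (∀ i j, |Y i j| ≤ R) ∧ 1 ≤ |Y.det| ∧
      IsFrame B (toR (K * M₁) * Y⁻¹) ∧ pt (toR (K * M₁) * Y⁻¹) ∈ D}
  set 𝓟 : Set (Fin N → ℂ) := ⋃ M₁ ∈ S, (fun Y => pt (toR (K * M₁) * Y⁻¹)) '' C M₁ with h𝓟
  have hcpt : IsCompact 𝓟 := hSf.isCompact_biUnion fun M₁ _ =>
    (isCompact_frames hB hD _ _).image_of_continuousOn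
      (continuous_pt.comp_continuousOn ((continuousOn_frame _).mono fun Y hY => hY.2.1))
  have hsub : 𝓟 ⊆ D := by
    intro Z hZ
    simp only [h𝓟, Set.mem_iUnion] at hZ
    obtain ⟨M₁, -, Y, hY, rfl⟩ := hZ
    exact hY.2.2.2
  have hred : ∀ P : Matrix (Fin 3) (Fin 3) ℝ, IsFrame B (toR K * P) → pt (toR K * P) ∈ D →
      ∃ Z ∈ 𝓟, ‖F (pt (toR K * P))‖ = ‖F Z‖ := by
    intro P hP hPD
    obtain ⟨M, Y, hM, hMY, hYd, hYb, hHd, hHb⟩ := hR P hP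
    obtain ⟨γ, hγ, M₁, hM₁, hγM⟩ := hS M hM hHd hHb
    have hYu : IsUnit Y.det := by
      refine Ne.isUnit fun h => ?_
      rw [h, abs_zero] at hYd
      linarith
    have e1 : toR K * P = toR γ * (toR (K * M₁) * Y⁻¹) := by
      have e2 : P = toR M * Y⁻¹ := by
        rw [hMY, Matrix.mul_assoc, mul_nonsing_inv _ hYu, Matrix.mul_one]
      rw [e2, ← Matrix.mul_assoc, ← toR_mul, hγM, toR_mul, Matrix.mul_assoc]
    have hγO := hΓ.subset hγ
    have hfr : IsFrame B (toR (K * M₁) * Y⁻¹) := IsFrame.act hγO.1 (e1 ▸ hP)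
    have hmem : pt (toR (K * M₁) * Y⁻¹) ∈ D := by
      obtain ⟨δ, hδ, -, hδγ⟩ := hΓ.inv_mem γ hγ
      have := OPlus_act (hΓ.subset hδ) hPD
      rwa [e1, ← actC_pt, ← actC_mul, hδγ, actC_one] at this
    refine ⟨_, Set.mem_biUnion hM₁ ⟨Y, ⟨hYb, hYd, hfr, hmem⟩, rfl⟩, ?_⟩
    rw [e1, ← actC_pt, hF.equivariant γ hγ _ hmem, norm_mul, norm_char_eq_one hΓ hχ hγ, one_mul]
  obtain ⟨P₀, hP₀, hP₀D⟩ := hne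
  obtain ⟨Z₀, hZ₀, -⟩ := hred P₀ hP₀ hP₀D
  obtain ⟨Z, hZ, hmax⟩ := hcpt.exists_isMaxOn ⟨Z₀, hZ₀⟩ (hF.holo.continuousOn.norm.mono hsub)
  have hZ' := hZ
  simp only [h𝓟, Set.mem_iUnion] at hZ'
  obtain ⟨M₁, -, Y, hY, rfl⟩ := hZ'
  have e3 : toR (K * M₁) * Y⁻¹ = toR K * (toR M₁ * Y⁻¹) := by rw [toR_mul, Matrix.mul_assoc]
  refine ⟨toR M₁ * Y⁻¹, e3 ▸ hY.2.2.1, e3 ▸ hY.2.2.2, fun P' hP' hP'D => ?_⟩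
  obtain ⟨Z', hZ', e4⟩ := hred P' hP' hP'D
  rw [e4, ← e3]
  exact hmax hZ'

end Maximum

section FrameDisc

variable {N : ℕ} {B : Matrix (Fin N) (Fin N) ℤ} {D : Set (Fin N → ℂ)}

/-- The holomorphic disc through a point `Z` of the cone in the direction of a real vector. -/
noncomputable def ray (Z : Fin N → ℂ) (v : Fin N → ℝ) (s : ℂ) : Fin N → ℂ :=
  Z + s • realC v + (s ^ 2 / 4) • cj Z

lemma differentiable_ray (Z : Fin N → ℂ) (v : Fin N → ℝ) : Differentiable ℂ (ray Z v) := by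
  unfold ray
  fun_prop

lemma ray_zero (Z : Fin N → ℂ) (v : Fin N → ℝ) : ray Z v 0 = Z := by
  simp [ray]

lemma IsFrame.mul {X : Matrix (Fin N) (Fin 3) ℝ} (hX : IsFrame B X)
    {T : Matrix (Fin 3) (Fin 3) ℝ} (hT : Tᵀ * lorentz * T = lorentz) : IsFrame B (X * T) := by
  unfold IsFrame at *
  rw [← hX] at hT
  rw [transpose_mul, ← hX, ← hT]
  simp only [Matrix.mul_assoc]

lemma pt_mul (X : Matrix (Fin N) (Fin 3) ℝ) (T : Matrix (Fin 3) (Fin 3) ℝ) :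
    pt (X * T) =
      (((T 0 0 + Complex.I * T 0 1) - Complex.I * (T 1 0 + Complex.I * T 1 1)) / 2) • pt X +
      (((T 0 0 + Complex.I * T 0 1) + Complex.I * (T 1 0 + Complex.I * T 1 1)) / 2) • cj (pt X) +
      (T 2 0 + Complex.I * T 2 1 : ℂ) • realC fun i => X i 2 := by
  ext i
  simp only [pt, realC, cj, Matrix.mul_apply, Fin.sum_univ_three, Pi.add_apply, Pi.smul_apply,
    smul_eq_mul, map_add, map_mul, Complex.conj_I, Complex.conj_ofReal]
  push_cast
  linear_combination (X i 1 * T 1 0 + X i 1 * Complex.I * T 1 1 : ℂ) * Complex.I_sq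

lemma exists_lorentz {a b : Fin 3 → ℝ} (haa : a 0 ^ 2 + a 1 ^ 2 - a 2 ^ 2 = 1)
    (hbb : b 0 ^ 2 + b 1 ^ 2 - b 2 ^ 2 = 1) (hab : a 0 * b 0 + a 1 * b 1 - a 2 * b 2 = 0) :
    ∃ T : Matrix (Fin 3) (Fin 3) ℝ, Tᵀ * lorentz * T = lorentz ∧
      (∀ i, T i 0 = a i) ∧ ∀ i, T i 1 = b i := by
  refine ⟨Matrix.of ![![a 0, b 0, a 1 * b 2 - a 2 * b 1], ![a 1, b 1, a 2 * b 0 - a 0 * b 2],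
    ![a 2, b 2, -(a 0 * b 1 - a 1 * b 0)]], ?_, ?_, ?_⟩
  · ext i j
    rw [lorentz_gram]
    fin_cases i <;> fin_cases j <;> simp [lorentz]
    · linarith
    · linarith
    · ring
    · linarith
    · linarith
    · ring
    · ring
    · ring
    · linear_combination (a 0 * b 0 + a 1 * b 1 - a 2 * b 2) * hab -
        (b 0 ^ 2 + b 1 ^ 2 - b 2 ^ 2) * haa - hbb
  · intro i; fin_cases i <;> rfl
  · intro i; fin_cases i <;> rfl

/-- Points of the disc are multiples of points of frames with the same span. -/
lemma IsFrame.exists_ray {X : Matrix (Fin N) (Fin 3) ℝ} {s : ℂ} (hs : ‖s‖ < 2) :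
    ∃ T : Matrix (Fin 3) (Fin 3) ℝ, Tᵀ * lorentz * T = lorentz ∧
      ray (pt X) (fun i => X i 2) s = ((1 - ‖s‖ ^ 2 / 4 : ℝ) : ℂ) • pt (X * T) := by
  obtain ⟨p, q, rfl⟩ : ∃ p q : ℝ, s = p + q * Complex.I := ⟨s.re, s.im, (Complex.re_add_im s).symm⟩
  have hn : ‖(p + q * Complex.I : ℂ)‖ ^ 2 = p ^ 2 + q ^ 2 := by
    rw [← Complex.normSq_eq_norm_sq, Complex.normSq_add_mul_I]
  have hl : 0 < 1 - (p ^ 2 + q ^ 2) / 4 := by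
    rw [← hn]
    nlinarith [norm_nonneg (p + q * Complex.I : ℂ)]
  rw [hn]
  obtain ⟨l, hl'⟩ : ∃ l, l = 1 - (p ^ 2 + q ^ 2) / 4 := ⟨_, rfl⟩
  rw [← hl'] at hl ⊢
  have hl0 : (l : ℂ) ≠ 0 := by exact_mod_cast hl.ne'
  obtain ⟨T, hT, ha, hb⟩ := exists_lorentz (a := ![(1 + (p ^ 2 - q ^ 2) / 4) / l, p * q / 2 / l, p / l])
    (b := ![p * q / 2 / l, (1 - (p ^ 2 - q ^ 2) / 4) / l, q / l])
    (by simp only [cons_val]; field_simp; rw [hl']; ring)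
    (by simp only [cons_val]; field_simp; rw [hl']; ring)
    (by simp only [cons_val]; field_simp; ring)
  refine ⟨T, hT, ?_⟩
  rw [pt_mul, smul_add, smul_add, smul_smul, smul_smul, smul_smul, ray]
  have hI := Complex.I_sq
  have e1 : (l : ℂ) * (((T 0 0 + Complex.I * T 0 1) - Complex.I * (T 1 0 + Complex.I * T 1 1)) / 2)
      = 1 := by
    rw [ha, ha, hb, hb]
    simp only [cons_val]
    push_cast
    field_simp
    linear_combination 2 * (-4 + (p : ℂ) ^ 2 - q ^ 2) * hI
  have e2 : (l : ℂ) * (((T 0 0 + Complex.I * T 0 1) + Complex.I * (T 1 0 + Complex.I * T 1 1)) / 2)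
      = (p + q * Complex.I) ^ 2 / 4 := by
    rw [ha, ha, hb, hb]
    simp only [cons_val]
    push_cast
    field_simp
    linear_combination 2 * (4 - (p : ℂ) ^ 2 - q ^ 2) * hI
  have e3 : (l : ℂ) * (T 2 0 + Complex.I * T 2 1) = p + q * Complex.I := by
    rw [ha, hb]
    simp only [cons_val]
    push_cast
    field_simp
  rw [e1, e2, e3, one_smul]
  abel

lemma IsFrame.same_ray {X : Matrix (Fin N) (Fin 3) ℝ} (hB : B.IsSymm) (hX : IsFrame B X)
    {α β γ : ℂ} :
    cpair B (α • pt X + β • cj (pt X) + γ • realC fun i => X i 2) (pt X) = 2 * β ∧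
    cpair B (α • pt X + β • cj (pt X) + γ • realC fun i => X i 2) (cj (pt X)) = 2 * α ∧
    cpair B (α • pt X + β • cj (pt X) + γ • realC fun i => X i 2)
      (α • pt X + β • cj (pt X) + γ • realC fun i => X i 2) = 4 * α * β - γ ^ 2 := by
  obtain ⟨h1, h2⟩ := hX.cpair_pt
  have h3 : cpair B (cj (pt X)) (pt X) = 2 := by rw [cpair_comm hB, h2]
  have h4 : cpair B (cj (pt X)) (cj (pt X)) = 0 := by rw [cpair_cj, h1, map_zero]
  have h5 : cpair B (realC fun i => X i 2) (pt X) = 0 := by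
    rw [pt, cpair_add_right, cpair_smul_right, cpair_realC, cpair_realC, hX.rpair, hX.rpair]
    simp [lorentz]
  have h6 : cpair B (realC fun i => X i 2) (cj (pt X)) = 0 := by
    rw [← cj_realC, cpair_cj, h5, map_zero]
  have h7 : cpair B (realC fun i => X i 2) (realC fun i => X i 2) = -1 := by
    rw [cpair_realC, hX.rpair]
    simp [lorentz]
  have h5' := (cpair_comm hB _ _).trans h5
  have h6' := (cpair_comm hB _ _).trans h6
  simp only [cpair_add_left, cpair_add_right, cpair_smul_left, cpair_smul_right, h1, h2, h3, h4, h5,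
    h6, h7, h5', h6']
  refine ⟨by ring, by ring, by ring⟩

lemma IsFrame.pt_mul_mem (hB : Hyp B) (hD : IsComponent B D) {X : Matrix (Fin N) (Fin 3) ℝ}
    (hX : IsFrame B X) (hXD : pt X ∈ D) {s : ℂ} (hs : ‖s‖ < 2) {T : Matrix (Fin 3) (Fin 3) ℝ}
    (hT : Tᵀ * lorentz * T = lorentz)
    (h : ray (pt X) (fun i => X i 2) s = ((1 - ‖s‖ ^ 2 / 4 : ℝ) : ℂ) • pt (X * T)) :
    pt (X * T) ∈ D := by
  have hl : (0 : ℝ) < 1 - ‖s‖ ^ 2 / 4 := by nlinarith [norm_nonneg s]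
  have hl0 : ((1 - ‖s‖ ^ 2 / 4 : ℝ) : ℂ) ≠ 0 := by exact_mod_cast hl.ne'
  have e : pt (X * T) = ((1 - ‖s‖ ^ 2 / 4 : ℝ) : ℂ)⁻¹ • ray (pt X) (fun i => X i 2) s := by
    rw [h, smul_smul, inv_mul_cancel₀ hl0, one_smul]
  refine (hD.mem_iff hB hXD).2 ⟨(hX.mul hT).mem_cone, ?_⟩
  have e' : ray (pt X) (fun i => X i 2) s =
      (1 : ℂ) • pt X + (s ^ 2 / 4) • cj (pt X) + s • realC fun i => X i 2 := by
    rw [ray, one_smul]; abel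
  obtain ⟨h1, h2, -⟩ := hX.same_ray hB.symm (α := 1) (β := s ^ 2 / 4) (γ := s)
  rw [Same, e, e', cpair_smul_left, cpair_smul_left, h1, h2, norm_mul (_⁻¹), norm_mul (_⁻¹)]
  refine mul_lt_mul_of_pos_left ?_ (norm_pos_iff.2 (inv_ne_zero hl0))
  simp only [norm_mul, norm_div, norm_pow, Complex.norm_ofNat, norm_one]
  nlinarith [norm_nonneg s]

lemma IsFrame.ray_mem (hB : Hyp B) (hD : IsComponent B D) {X : Matrix (Fin N) (Fin 3) ℝ}
    (hX : IsFrame B X) (hXD : pt X ∈ D) {s : ℂ} (hs : ‖s‖ < 2) :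
    ray (pt X) (fun i => X i 2) s ∈ D := by
  obtain ⟨T, hT, h⟩ := IsFrame.exists_ray (X := X) hs
  have hl : (0 : ℝ) < 1 - ‖s‖ ^ 2 / 4 := by nlinarith [norm_nonneg s]
  rw [h]
  exact hD.smul_mem hB (hX.pt_mul_mem hB hD hXD hs hT h) (by exact_mod_cast hl.ne')

lemma IsFrame.exists_eq_smul_ray (hB : Hyp B) (hD : IsComponent B D)
    {X : Matrix (Fin N) (Fin 3) ℝ} (hX : IsFrame B X) (hXD : pt X ∈ D)
    {T : Matrix (Fin 3) (Fin 3) ℝ} (hTD : pt (X * T) ∈ D) :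
    ∃ α s : ℂ, α ≠ 0 ∧ ‖s‖ < 2 ∧ pt (X * T) = α • ray (pt X) (fun i => X i 2) s := by
  have e := pt_mul X T
  obtain ⟨α, hα⟩ : ∃ α : ℂ, α =
    ((T 0 0 + Complex.I * T 0 1) - Complex.I * (T 1 0 + Complex.I * T 1 1)) / 2 := ⟨_, rfl⟩
  obtain ⟨β, hβ⟩ : ∃ β : ℂ, β =
    ((T 0 0 + Complex.I * T 0 1) + Complex.I * (T 1 0 + Complex.I * T 1 1)) / 2 := ⟨_, rfl⟩
  obtain ⟨γ, hγ⟩ : ∃ γ : ℂ, γ = T 2 0 + Complex.I * T 2 1 := ⟨_, rfl⟩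
  rw [← hα, ← hβ, ← hγ] at e
  obtain ⟨h1, h2, h3⟩ := hX.same_ray hB.symm (α := α) (β := β) (γ := γ)
  have h4 := ((hD.mem_iff hB hXD).1 hTD).2
  have h5 := (Refl.mem_cone.1 (hD.subset hTD)).1
  rw [Same, e, h1, h2, norm_mul, norm_mul] at h4
  rw [e, h3] at h5
  have h6 : ‖β‖ < ‖α‖ := by
    rw [Complex.norm_ofNat] at h4
    linarith
  have hα0 : α ≠ 0 := norm_pos_iff.1 ((norm_nonneg β).trans_lt h6)
  have h7 : γ ^ 2 = 4 * α * β := by linear_combination -h5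
  refine ⟨α, γ / α, hα0, ?_, ?_⟩
  · have h8 : ‖γ‖ ^ 2 = 4 * ‖α‖ * ‖β‖ := by
      rw [← norm_pow, h7, norm_mul, norm_mul, Complex.norm_ofNat]
    rw [norm_div, div_lt_iff₀ (norm_pos_iff.2 hα0)]
    nlinarith [norm_nonneg γ, norm_nonneg α, norm_nonneg β]
  · rw [e, ray, smul_add, smul_add, smul_smul, smul_smul, mul_div_cancel₀ _ hα0]
    have h9 : α * ((γ / α) ^ 2 / 4) = β := by
      field_simp
      linear_combination h7
    rw [h9]
    abel

end FrameDisc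

section FrameConst

variable {N : ℕ} {B : Matrix (Fin N) (Fin N) ℤ} {D : Set (Fin N → ℂ)}

lemma IsFrame.ray_const (hB : Hyp B) (hdet : B.det ≠ 0) (hD : IsComponent B D)
    {Γ : Set (Matrix (Fin N) (Fin N) ℤ)} {χ : Matrix (Fin N) (Fin N) ℤ → ℂ}
    (hΓ : IsFiniteIndexSubgroup B D Γ) (hχ : IsCharacter Γ χ) {k : ℤ} (hk : k ≤ 0)
    {F : (Fin N → ℂ) → ℂ} (hF : IsModularForm B D Γ χ k F) {K : Matrix (Fin N) (Fin 3) ℤ}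
    (hK : ∀ m, m ⬝ᵥ (Kᵀ * B * K) *ᵥ m = 0 → m = 0) {P : Matrix (Fin 3) (Fin 3) ℝ}
    (hP : IsFrame B (toR K * P)) (hPD : pt (toR K * P) ∈ D) :
    (∀ s : ℂ, ‖s‖ < 2 → F (ray (pt (toR K * P)) (fun i => (toR K * P) i 2) s) =
      F (pt (toR K * P))) ∧ (k < 0 → F (pt (toR K * P)) = 0) := by
  obtain ⟨Q, hQ, hQD, hmax⟩ := exists_max_frame hB hdet hD hΓ hχ hF hK ⟨P, hP, hPD⟩
  have hlam : ∀ {s : ℂ}, ‖s‖ < 2 → 0 < 1 - ‖s‖ ^ 2 / 4 ∧ 1 - ‖s‖ ^ 2 / 4 ≤ 1 := by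
    intro s hs
    constructor <;> nlinarith [norm_nonneg s]
  have hray : ∀ {R : Matrix (Fin 3) (Fin 3) ℝ}, IsFrame B (toR K * R) → pt (toR K * R) ∈ D →
      ∀ {s : ℂ}, ‖s‖ < 2 → ∃ R' : Matrix (Fin 3) (Fin 3) ℝ, IsFrame B (toR K * R') ∧
        pt (toR K * R') ∈ D ∧ F (ray (pt (toR K * R)) (fun i => (toR K * R) i 2) s) =
          ((1 - ‖s‖ ^ 2 / 4 : ℝ) : ℂ) ^ (-k) * F (pt (toR K * R')) := by
    intro R hR hRD s hs
    obtain ⟨T, hT, h⟩ := IsFrame.exists_ray (X := toR K * R) hs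
    have h2 := hR.pt_mul_mem hB hD hRD hs hT h
    have h3 := hR.mul hT
    rw [h, hF.homogeneous _ (by exact_mod_cast (hlam hs).1.ne') _ h2]
    rw [Matrix.mul_assoc] at h2 h3 ⊢
    exact ⟨_, h3, h2, rfl⟩
  have hconst : ∀ s : ℂ, ‖s‖ < 2 →
      F (ray (pt (toR K * Q)) (fun i => (toR K * Q) i 2) s) = F (pt (toR K * Q)) := by
    intro s hs
    have hd : DifferentiableOn ℂ
        (F ∘ ray (pt (toR K * Q)) fun i => (toR K * Q) i 2) (Metric.ball 0 2) :=
      hF.holo.comp (differentiable_ray _ _).differentiableOn fun t ht =>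
        hQ.ray_mem hB hD hQD (by simpa using ht)
    have hm : IsMaxOn (norm ∘ (F ∘ ray (pt (toR K * Q)) fun i => (toR K * Q) i 2))
        (Metric.ball 0 2) 0 := by
      intro t ht
      have ht' : ‖t‖ < 2 := by simpa using ht
      obtain ⟨R, hR, hRD, h⟩ := hray hQ hQD ht'
      simp only [Set.mem_ofPred_eq, Function.comp_apply, ray_zero]
      rw [h, norm_mul, norm_zpow, Complex.norm_real, Real.norm_of_nonneg (hlam ht').1.le]
      refine (mul_le_of_le_one_left (norm_nonneg _) ?_).trans (hmax R hR hRD)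
      obtain ⟨j, hj⟩ : ∃ j : ℕ, -k = j := ⟨(-k).toNat, by omega⟩
      rw [hj, zpow_natCast]
      exact pow_le_one₀ (hlam ht').1.le (hlam ht').2
    have h := Complex.eqOn_of_isPreconnected_of_isMaxOn_norm
      (convex_ball (0 : ℂ) 2).isPreconnected Metric.isOpen_ball hd (by simp) hm
      (show s ∈ Metric.ball (0 : ℂ) 2 by simpa using hs)
    simpa [ray_zero] using h
  have hQ0 : k < 0 → F (pt (toR K * Q)) = 0 := by
    intro hk
    have h1 : ‖(1 : ℂ)‖ < 2 := by norm_num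
    obtain ⟨R, hR, hRD, h⟩ := hray hQ hQD h1
    rw [hconst 1 h1] at h
    have h2 := hmax R hR hRD
    obtain ⟨j, hj⟩ : ∃ j : ℕ, -k = j + 1 := ⟨(-k - 1).toNat, by omega⟩
    have h3 := congrArg norm h
    rw [norm_mul, norm_zpow, Complex.norm_real, Real.norm_of_nonneg (hlam h1).1.le, hj] at h3
    have h4 : (1 - ‖(1 : ℂ)‖ ^ 2 / 4) ^ ((j : ℤ) + 1) ≤ 3 / 4 := by
      rw [norm_one, zpow_add₀ (by norm_num), zpow_natCast, zpow_one]
      have : ((1 : ℝ) - 1 ^ 2 / 4) ^ j ≤ 1 := pow_le_one₀ (by norm_num) (by norm_num)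
      nlinarith
    have h5 : ‖F (pt (toR K * Q))‖ ≤ 3 / 4 * ‖F (pt (toR K * Q))‖ := by
      rw [h3]
      rw [h3] at h2
      nlinarith [norm_nonneg (F (pt (toR K * R)))]
    exact norm_le_zero_iff.1 (by linarith)
  have hval : ∀ {R : Matrix (Fin 3) (Fin 3) ℝ}, IsFrame B (toR K * R) → pt (toR K * R) ∈ D →
      F (pt (toR K * R)) = F (pt (toR K * Q)) := by
    intro R hR hRD
    have hu : IsUnit Q.det := by
      have h := congrArg Matrix.det hQ
      rw [transpose_mul, show Qᵀ * (toR K)ᵀ * toR B * (toR K * Q) =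
        Qᵀ * ((toR K)ᵀ * toR B * toR K) * Q by simp only [Matrix.mul_assoc], det_mul, det_lorentz]
        at h
      rw [isUnit_iff_ne_zero]
      intro h0
      rw [h0, mul_zero] at h
      norm_num at h
    have e : toR K * R = toR K * Q * (Q⁻¹ * R) := by
      rw [Matrix.mul_assoc, ← Matrix.mul_assoc Q, mul_nonsing_inv _ hu, Matrix.one_mul]
    rw [e] at hRD ⊢
    obtain ⟨α, s, hα, hs, h⟩ := hQ.exists_eq_smul_ray hB hD hQD hRD
    rw [h, hF.homogeneous α hα _ (hQ.ray_mem hB hD hQD hs), hconst s hs]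
    rcases hk.lt_or_eq with hk | hk
    · rw [hQ0 hk, mul_zero]
    · rw [hk, neg_zero, zpow_zero, one_mul]
  refine ⟨fun s hs => ?_, fun hk => (hval hP hPD).trans (hQ0 hk)⟩
  obtain ⟨R, hR, hRD, h⟩ := hray hP hPD hs
  rw [h, hval hR hRD, hval hP hPD]
  rcases hk.lt_or_eq with hk | hk
  · rw [hQ0 hk, mul_zero]
  · rw [hk, neg_zero, zpow_zero, one_mul]

end FrameConst

section FrameDense

variable {N : ℕ} {B : Matrix (Fin N) (Fin N) ℤ} {D : Set (Fin N → ℂ)}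

lemma tendsto_matrix {α : Type*} {l : Filter α} {a b : ℕ} {f : α → Matrix (Fin a) (Fin b) ℝ}
    {X : Matrix (Fin a) (Fin b) ℝ}
    (h : ∀ i j, Filter.Tendsto (fun t => f t i j) l (nhds (X i j))) :
    Filter.Tendsto f l (nhds X) :=
  tendsto_pi_nhds.2 fun i => tendsto_pi_nhds.2 (h i)

/-- Integral matrices in a fixed residue class approximate every real matrix up to scaling. -/
lemma tendsto_scaled_class (q : ℤ) (hq : 0 < q) (C : Matrix (Fin N) (Fin 3) ℤ)
    (X : Matrix (Fin N) (Fin 3) ℝ) :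
    ∃ (c : ℕ → ℝ) (T : ℕ → Matrix (Fin N) (Fin 3) ℤ),
      Filter.Tendsto (fun j : ℕ => c j • toR (C + q • T j)) Filter.atTop (nhds X) := by
  refine ⟨fun j => (q * (j + 1) : ℝ)⁻¹,
    fun j => Matrix.of fun a c => ⌊((j + 1 : ℕ) : ℝ) * X a c⌋, ?_⟩
  refine tendsto_matrix fun a c => ?_
  have hq' : (0 : ℝ) < q := by exact_mod_cast hq
  have h1 : Filter.Tendsto (fun j : ℕ => ((j + 1 : ℕ) : ℝ)) Filter.atTop Filter.atTop :=
    tendsto_natCast_atTop_atTop.comp (Filter.tendsto_add_atTop_nat 1)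
  have h3 : Filter.Tendsto (fun j : ℕ => (⌊((j + 1 : ℕ) : ℝ) * X a c⌋ : ℝ) / ((j + 1 : ℕ) : ℝ))
      Filter.atTop (nhds (X a c)) := by
    have h4 : Filter.Tendsto (fun j : ℕ => X a c - 1 / ((j + 1 : ℕ) : ℝ)) Filter.atTop
        (nhds (X a c - 0)) := tendsto_const_nhds.sub (by
      simp only [one_div]
      exact tendsto_inv_atTop_zero.comp h1)
    rw [sub_zero] at h4
    refine tendsto_of_tendsto_of_tendsto_of_le_of_le h4 tendsto_const_nhds ?_ ?_
    · intro j
      have hj : (0 : ℝ) < ((j + 1 : ℕ) : ℝ) := by positivity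
      simp only
      rw [le_div_iff₀ hj, sub_mul, div_mul_cancel₀ _ hj.ne']
      have := Int.sub_one_lt_floor (((j + 1 : ℕ) : ℝ) * X a c)
      linarith
    · intro j
      have hj : (0 : ℝ) < ((j + 1 : ℕ) : ℝ) := by positivity
      simp only
      rw [div_le_iff₀ hj]
      have := Int.floor_le (((j + 1 : ℕ) : ℝ) * X a c)
      linarith
  have h5 : Filter.Tendsto (fun j : ℕ => (C a c / q : ℝ) * ((j + 1 : ℕ) : ℝ)⁻¹)
      Filter.atTop (nhds ((C a c / q : ℝ) * 0)) :=
    tendsto_const_nhds.mul (tendsto_inv_atTop_zero.comp h1)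
  have h6 := h5.add h3
  rw [mul_zero, zero_add] at h6
  refine h6.congr fun j => ?_
  have hj : (0 : ℝ) < (j : ℝ) + 1 := by positivity
  simp only [toR, Matrix.smul_apply, Matrix.map_apply, Matrix.add_apply, Matrix.of_apply,
    smul_eq_mul]
  push_cast
  field_simp

lemma tendsto_rpair {α : Type*} {l : Filter α} {f g : α → Fin N → ℝ} {x y : Fin N → ℝ}
    (hf : Filter.Tendsto f l (nhds x)) (hg : Filter.Tendsto g l (nhds y)) :
    Filter.Tendsto (fun a => rpair B (f a) (g a)) l (nhds (rpair B x y)) := by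
  unfold rpair
  exact tendsto_finsetSum _ fun i _ => tendsto_finsetSum _ fun j _ =>
    (tendsto_const_nhds.mul ((tendsto_pi_nhds.1 hf) i)).mul ((tendsto_pi_nhds.1 hg) j)

/-- Gram–Schmidt orthonormalisation near a frame. -/
lemma exists_frame_near (hB : B.IsSymm) {X : Matrix (Fin N) (Fin 3) ℝ} (hX : IsFrame B X)
    {α : Type*} {l : Filter α} {A : α → Matrix (Fin N) (Fin 3) ℝ}
    (hA : Filter.Tendsto A l (nhds X)) :
    ∃ P : α → Matrix (Fin 3) (Fin 3) ℝ, Filter.Tendsto (fun j => A j * P j) l (nhds X) ∧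
      ∀ᶠ j in l, IsFrame B (A j * P j) := by
  have hcol : ∀ c, Filter.Tendsto (fun j a => A j a c) l (nhds fun a => X a c) := by
    intro c
    exact ((continuous_pi fun a => (continuous_apply c).comp (continuous_apply a)).tendsto X).comp hA
  have g00 : rpair B (fun a => X a 0) (fun a => X a 0) = 1 := by rw [hX.rpair]; simp [lorentz]
  have g11 : rpair B (fun a => X a 1) (fun a => X a 1) = 1 := by rw [hX.rpair]; simp [lorentz]
  have g22 : rpair B (fun a => X a 2) (fun a => X a 2) = -1 := by rw [hX.rpair]; simp [lorentz]
  have g10 : rpair B (fun a => X a 1) (fun a => X a 0) = 0 := by rw [hX.rpair]; simp [lorentz]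
  have g20 : rpair B (fun a => X a 2) (fun a => X a 0) = 0 := by rw [hX.rpair]; simp [lorentz]
  have g21 : rpair B (fun a => X a 2) (fun a => X a 1) = 0 := by rw [hX.rpair]; simp [lorentz]
  let c0 : α → ℝ := fun j => (√(rpair B (fun a => A j a 0) fun a => A j a 0))⁻¹
  let e0 : α → Fin N → ℝ := fun j => c0 j • fun a => A j a 0
  have hQ0 := tendsto_rpair (B := B) (hcol 0) (hcol 0)
  rw [g00] at hQ0
  have hc0 : Filter.Tendsto c0 l (nhds 1) := by
    simpa using hQ0.sqrt.inv₀ (by simp)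
  have he0 : Filter.Tendsto e0 l (nhds fun a => X a 0) := by
    simpa using hc0.smul (hcol 0)
  have n0 : ∀ᶠ j in l, rpair B (e0 j) (e0 j) = 1 := by
    filter_upwards [hQ0.eventually (lt_mem_nhds zero_lt_one)] with j hj
    have := Real.sq_sqrt hj.le
    have h0 := (Real.sqrt_pos.2 hj).ne'
    simp only [e0, c0, rpair_smul_left, rpair_smul_right]
    field_simp
    linarith
  let d : α → ℝ := fun j => rpair B (fun a => A j a 1) (e0 j)
  have hd : Filter.Tendsto d l (nhds 0) := g10 ▸ tendsto_rpair (hcol 1) he0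
  let w1 : α → Fin N → ℝ := fun j => (fun a => A j a 1) - d j • e0 j
  have hw1 : Filter.Tendsto w1 l (nhds fun a => X a 1) := by
    simpa using (hcol 1).sub (hd.smul he0)
  let c1 : α → ℝ := fun j => (√(rpair B (w1 j) (w1 j)))⁻¹
  let e1 : α → Fin N → ℝ := fun j => c1 j • w1 j
  have hQ1 := tendsto_rpair (B := B) hw1 hw1
  rw [g11] at hQ1
  have hc1 : Filter.Tendsto c1 l (nhds 1) := by
    simpa using hQ1.sqrt.inv₀ (by simp)
  have he1 : Filter.Tendsto e1 l (nhds fun a => X a 1) := by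
    simpa using hc1.smul hw1
  have n1 : ∀ᶠ j in l, rpair B (e1 j) (e1 j) = 1 := by
    filter_upwards [hQ1.eventually (lt_mem_nhds zero_lt_one)] with j hj
    have := Real.sq_sqrt hj.le
    have h0 := (Real.sqrt_pos.2 hj).ne'
    simp only [e1, c1, rpair_smul_left, rpair_smul_right]
    field_simp
    linarith
  have o10 : ∀ᶠ j in l, rpair B (e1 j) (e0 j) = 0 := by
    filter_upwards [n0] with j hj
    simp only [e1, w1, rpair_smul_left, rpair_sub_left, hj]
    simp [d]
  let u : α → ℝ := fun j => rpair B (fun a => A j a 2) (e0 j)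
  let v : α → ℝ := fun j => rpair B (fun a => A j a 2) (e1 j)
  have hu : Filter.Tendsto u l (nhds 0) := g20 ▸ tendsto_rpair (hcol 2) he0
  have hv : Filter.Tendsto v l (nhds 0) := g21 ▸ tendsto_rpair (hcol 2) he1
  let w2 : α → Fin N → ℝ := fun j => (fun a => A j a 2) - u j • e0 j - v j • e1 j
  have hw2 : Filter.Tendsto w2 l (nhds fun a => X a 2) := by
    simpa using ((hcol 2).sub (hu.smul he0)).sub (hv.smul he1)
  let c2 : α → ℝ := fun j => (√(-rpair B (w2 j) (w2 j)))⁻¹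
  let e2 : α → Fin N → ℝ := fun j => c2 j • w2 j
  have hQ2 := (tendsto_rpair (B := B) hw2 hw2).neg
  rw [g22, neg_neg] at hQ2
  have hc2 : Filter.Tendsto c2 l (nhds 1) := by
    simpa using hQ2.sqrt.inv₀ (by simp)
  have he2 : Filter.Tendsto e2 l (nhds fun a => X a 2) := by
    simpa using hc2.smul hw2
  have n2 : ∀ᶠ j in l, rpair B (e2 j) (e2 j) = -1 := by
    filter_upwards [hQ2.eventually (lt_mem_nhds zero_lt_one)] with j hj
    have := Real.sq_sqrt hj.le
    have h0 := (Real.sqrt_pos.2 hj).ne'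
    simp only [e2, c2, rpair_smul_left, rpair_smul_right]
    field_simp
    linarith
  have o20 : ∀ᶠ j in l, rpair B (e2 j) (e0 j) = 0 := by
    filter_upwards [n0, o10] with j hj hj'
    simp only [e2, w2, rpair_smul_left, rpair_sub_left, hj, hj']
    simp [u]
  have o21 : ∀ᶠ j in l, rpair B (e2 j) (e1 j) = 0 := by
    filter_upwards [n1, o10] with j hj hj'
    simp only [e2, w2, rpair_smul_left, rpair_sub_left, hj, rpair_comm hB (e0 j), hj']
    simp [v]
  have key : ∃ P : α → Matrix (Fin 3) (Fin 3) ℝ, ∀ j a, (A j * P j) a 0 = e0 j a ∧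
      (A j * P j) a 1 = e1 j a ∧ (A j * P j) a 2 = e2 j a := by
    refine ⟨fun j => Matrix.of ![![c0 j, -(c1 j * d j * c0 j),
      c2 j * v j * c1 j * d j * c0 j - c2 j * u j * c0 j], ![0, c1 j, -(c2 j * v j * c1 j)],
      ![0, 0, c2 j]], fun j a => ?_⟩
    simp only [Matrix.mul_apply, Fin.sum_univ_three, Matrix.of_apply, cons_val, e0, e1, e2, w1, w2,
      Pi.smul_apply, Pi.sub_apply, smul_eq_mul]
    refine ⟨by ring, by ring, by ring⟩
  obtain ⟨P, hP⟩ := key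
  have q0 : ∀ j, (fun a => (A j * P j) a 0) = e0 j := fun j => funext fun a => (hP j a).1
  have q1 : ∀ j, (fun a => (A j * P j) a 1) = e1 j := fun j => funext fun a => (hP j a).2.1
  have q2 : ∀ j, (fun a => (A j * P j) a 2) = e2 j := fun j => funext fun a => (hP j a).2.2
  refine ⟨P, ?_, ?_⟩
  · refine tendsto_matrix fun a c => ?_
    fin_cases c
    · exact ((tendsto_pi_nhds.1 he0) a).congr fun j => (hP j a).1.symm
    · exact ((tendsto_pi_nhds.1 he1) a).congr fun j => (hP j a).2.1.symm
    · exact ((tendsto_pi_nhds.1 he2) a).congr fun j => (hP j a).2.2.symm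
  · filter_upwards [n0, n1, n2, o10, o20, o21] with j m0 m1 m2 m10 m20 m21
    ext c c'
    rw [gram_apply]
    fin_cases c <;> fin_cases c' <;>
      simp [q0, q1, q2, m0, m1, m2, m10, m20, m21, lorentz, rpair_comm hB (e0 j) (e1 j),
        rpair_comm hB (e0 j) (e2 j), rpair_comm hB (e1 j) (e2 j)]

end FrameDense

section WeightPos

variable {N : ℕ} {B : Matrix (Fin N) (Fin N) ℤ} {D : Set (Fin N → ℂ)}

lemma ray_const_of_frame (hN : 6 ≤ N) (hB : Hyp B) (hdet : B.det ≠ 0) (hD : IsComponent B D)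
    {Γ : Set (Matrix (Fin N) (Fin N) ℤ)} {χ : Matrix (Fin N) (Fin N) ℤ → ℂ}
    (hΓ : IsFiniteIndexSubgroup B D Γ) (hχ : IsCharacter Γ χ) {k : ℤ} (hk : k ≤ 0)
    {F : (Fin N → ℂ) → ℂ} (hF : IsModularForm B D Γ χ k F) {X : Matrix (Fin N) (Fin 3) ℝ}
    (hX : IsFrame B X) (hXD : pt X ∈ D) :
    (∀ s : ℂ, ‖s‖ < 2 → F (ray (pt X) (fun i => X i 2) s) = F (pt X)) ∧
      (k < 0 → F (pt X) = 0) := by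
  obtain ⟨q, hq, C, hC⟩ := exists_anisotropic_class hN hB.symm hdet
  obtain ⟨c, T, hcT⟩ := tendsto_scaled_class q hq C X
  obtain ⟨P, hP, hPF⟩ := exists_frame_near hB.symm hX hcT
  obtain ⟨Y, hY⟩ : ∃ Y : ℕ → Matrix (Fin N) (Fin 3) ℝ,
      Y = fun j : ℕ => c j • toR (C + q • T j) * P j := ⟨_, rfl⟩
  have hYt : Filter.Tendsto Y Filter.atTop (nhds X) := hY ▸ hP
  have hYF : ∀ᶠ j in Filter.atTop, IsFrame B (Y j) := by
    filter_upwards [hPF] with j hj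
    rw [hY]
    exact hj
  have hpt : Filter.Tendsto (fun j => pt (Y j)) Filter.atTop (nhds (pt X)) :=
    (continuous_pt.tendsto X).comp hYt
  have hYD : ∀ᶠ j in Filter.atTop, pt (Y j) ∈ D :=
    hD.eventually_mem hB hXD hpt (hYF.mono fun j hj => hj.cpair_pt.1)
  have hlim := ((hF.holo.continuousOn) (pt X) hXD).tendsto.comp
    (tendsto_nhdsWithin_iff.2 ⟨hpt, hYD⟩)
  have hcases : ∀ᶠ j in Filter.atTop,
      (∀ s : ℂ, ‖s‖ < 2 → F (ray (pt (Y j)) (fun i => Y j i 2) s) = F (pt (Y j))) ∧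
        (k < 0 → F (pt (Y j)) = 0) := by
    filter_upwards [hYF, hYD] with j hj hjD
    have e : Y j = toR (C + q • T j) * (c j • P j) := by
      simp only [hY, Matrix.mul_smul, Matrix.smul_mul]
    rw [e] at hj hjD ⊢
    exact hj.ray_const hB hdet hD hΓ hχ hk hF (hC _) hjD
  constructor
  · intro s hs
    have hray : Filter.Tendsto (fun j => ray (pt (Y j)) (fun i => Y j i 2) s) Filter.atTop
        (nhds (ray (pt X) (fun i => X i 2) s)) := by
      have hc : Continuous fun A : Matrix (Fin N) (Fin 3) ℝ => ray (pt A) (fun i => A i 2) s := by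
        unfold ray realC
        have := (continuous_cj (n := N)).comp (continuous_pt (N := N))
        simp only [Function.comp_def] at this
        fun_prop
      exact (hc.tendsto X).comp hYt
    have hrayD : ∀ᶠ j in Filter.atTop, ray (pt (Y j)) (fun i => Y j i 2) s ∈ D := by
      filter_upwards [hYF, hYD] with j hj hjD
      exact hj.ray_mem hB hD hjD hs
    have h := ((hF.holo.continuousOn) _ (hX.ray_mem hB hD hXD hs)).tendsto.comp
      (tendsto_nhdsWithin_iff.2 ⟨hray, hrayD⟩)
    refine tendsto_nhds_unique h (hlim.congr' ?_)
    filter_upwards [hcases] with j hj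
    exact (hj.1 s hs).symm
  · intro hk
    refine tendsto_nhds_unique hlim (tendsto_const_nhds.congr' ?_)
    filter_upwards [hcases] with j hj
    exact (hj.2 hk).symm

/-- Every point of the cone with an orthogonal real vector comes from a frame. -/
lemma exists_frame_of_orth (hB : Hyp B) {Z : Fin N → ℂ} (hZ : Z ∈ Cone B) {v : Fin N → ℝ}
    (hv : v ≠ 0) (h : cpair B Z (realC v) = 0) :
    ∃ (X : Matrix (Fin N) (Fin 3) ℝ) (r t : ℝ), IsFrame B X ∧ 0 < r ∧ 0 < t ∧
      Z = (r : ℂ) • pt X ∧ realC v = (t : ℂ) • realC fun i => X i 2 := by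
  have hneg := hB.neg_of_orth hZ hv h
  obtain ⟨h1, h2, h3⟩ := cone_re_im hB.symm hZ
  have hpos : 0 < rpair B (reV Z) (reV Z) := by
    have := (mem_cone.1 hZ).2
    rw [h3] at this
    linarith
  have hr := Real.sqrt_pos.2 hpos
  have hr2 := Real.sq_sqrt hpos.le
  have ht := Real.sqrt_pos.2 (neg_pos.2 hneg)
  have ht2 := Real.sq_sqrt (neg_pos.2 hneg).le
  obtain ⟨r, hr'⟩ : ∃ r, r = √(rpair B (reV Z) (reV Z)) := ⟨_, rfl⟩
  obtain ⟨t, ht'⟩ : ∃ t, t = √(-rpair B v v) := ⟨_, rfl⟩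
  rw [← hr'] at hr hr2
  rw [← ht'] at ht ht2
  have hov : rpair B (reV Z) v = 0 ∧ rpair B (imV Z) v = 0 := by
    rw [← realC_add_im Z, cpair_add_left, cpair_smul_left, cpair_realC, cpair_realC] at h
    have h4 := congrArg Complex.re h
    have h5 := congrArg Complex.im h
    simpa using And.intro h4 h5
  obtain ⟨X, q0, q1, q2⟩ : ∃ X : Matrix (Fin N) (Fin 3) ℝ, (fun i => X i 0) = r⁻¹ • reV Z ∧
      (fun i => X i 1) = r⁻¹ • imV Z ∧ (fun i => X i 2) = t⁻¹ • v :=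
    ⟨Matrix.of fun i => ![r⁻¹ * reV Z i, r⁻¹ * imV Z i, t⁻¹ * v i], rfl, rfl, rfl⟩
  refine ⟨X, r, t, ?_, hr, ht, ?_, ?_⟩
  · have n0 : r⁻¹ * (r⁻¹ * rpair B (reV Z) (reV Z)) = 1 := by rw [← hr2]; field_simp
    have n1 : r⁻¹ * (r⁻¹ * rpair B (imV Z) (imV Z)) = 1 := by rw [← h2, n0]
    have n2 : t⁻¹ * (t⁻¹ * rpair B v v) = -1 := by
      rw [show rpair B v v = -t ^ 2 by linarith]; field_simp
    ext c c'
    rw [gram_apply]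
    fin_cases c <;> fin_cases c' <;>
      simp [q0, q1, q2, lorentz, rpair_smul_left, rpair_smul_right, n0, n1, n2, h1, hov.1, hov.2,
        rpair_comm hB.symm v, rpair_comm hB.symm (imV Z) (reV Z)]
  · have hr0 : (r : ℂ) ≠ 0 := by exact_mod_cast hr.ne'
    conv_lhs => rw [← realC_add_im Z]
    rw [pt, q0, q1]
    ext i
    simp only [realC, Pi.add_apply, Pi.smul_apply, smul_eq_mul]
    push_cast
    field_simp
  · have ht0 : (t : ℂ) ≠ 0 := by exact_mod_cast ht.ne'
    rw [q2]
    ext i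
    simp only [realC, Pi.smul_apply, smul_eq_mul]
    push_cast
    field_simp

lemma exists_real_orth (hN : 3 ≤ N) (Z : Fin N → ℂ) :
    ∃ v : Fin N → ℝ, v ≠ 0 ∧ cpair B Z (realC v) = 0 := by
  let f : (Fin N → ℝ) →ₗ[ℝ] ℂ :=
    { toFun := fun v => cpair B Z (realC v)
      map_add' := fun v w => by rw [realC_add, cpair_add_right]
      map_smul' := fun c v => by
        rw [realC_smul, cpair_smul_right]
        simp }
  have h : LinearMap.ker f ≠ ⊥ := by
    apply LinearMap.ker_ne_bot_of_finrank_lt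
    rw [Complex.finrank_real_complex, Module.finrank_fin_fun]
    omega
  obtain ⟨v, hv, hv0⟩ := (Submodule.ne_bot_iff _).1 h
  exact ⟨v, hv0, hv⟩

/-- A modular form of nonpositive weight is constant. -/
theorem weight_pos (hN : 6 ≤ N) (hB : Hyp B) (hdet : B.det ≠ 0) (hD : IsComponent B D)
    {Γ : Set (Matrix (Fin N) (Fin N) ℤ)} {χ : Matrix (Fin N) (Fin N) ℤ → ℂ}
    (hΓ : IsFiniteIndexSubgroup B D Γ) (hχ : IsCharacter Γ χ) {k : ℤ}
    {F : (Fin N → ℂ) → ℂ} (hF : IsModularForm B D Γ χ k F) (hne : NonConstantOn D F) :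
    0 < k := by
  by_contra hk
  rw [not_lt] at hk
  apply hne
  have hpt : ∀ {Z : Fin N → ℂ}, Z ∈ D → ∀ {X : Matrix (Fin N) (Fin 3) ℝ} {r : ℝ}, 0 < r →
      Z = (r : ℂ) • pt X → pt X ∈ D := by
    intro Z hZ X r hr e
    have hr0 : (r : ℂ) ≠ 0 := by exact_mod_cast hr.ne'
    have : pt X = (r : ℂ)⁻¹ • Z := by rw [e, smul_smul, inv_mul_cancel₀ hr0, one_smul]
    rw [this]
    exact hD.smul_mem hB hZ (inv_ne_zero hr0)
  rcases hk.lt_or_eq with hk0 | rfl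
  · refine ⟨0, fun Z hZ => ?_⟩
    obtain ⟨v, hv, hZv⟩ := exists_real_orth (B := B) (by omega) Z
    obtain ⟨X, r, t, hX, hr, -, e, -⟩ := exists_frame_of_orth hB (hD.subset hZ) hv hZv
    have hXD := hpt hZ hr e
    rw [e, hF.homogeneous _ (by exact_mod_cast hr.ne') _ hXD,
      (ray_const_of_frame hN hB hdet hD hΓ hχ hk hF hX hXD).2 hk0, mul_zero]
  have hsc : ∀ t : ℂ, t ≠ 0 → ∀ Z ∈ D, F (t • Z) = F Z := by
    intro t ht Z hZ
    rw [hF.homogeneous t ht Z hZ, neg_zero, zpow_zero, one_mul]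
  have hder : ∀ Z ∈ D, ∀ w, cpair B Z w = 0 → fderivWithin ℂ F D Z w = 0 := by
    intro Z hZ w hw
    have hf := (hF.holo Z hZ).hasFDerivWithinAt
    have curve : ∀ {c : ℂ → Fin N → ℂ} {c' : Fin N → ℂ}, HasDerivAt c c' 0 → c 0 = Z →
        (∀ᶠ s in nhds 0, c s ∈ D ∧ F (c s) = F Z) → fderivWithin ℂ F D Z c' = 0 := by
      intro c c' hc h0 hs
      have h1 : HasDerivWithinAt (F ∘ c) (fderivWithin ℂ F D Z c') {s | c s ∈ D} 0 :=
        HasFDerivWithinAt.comp_hasDerivWithinAt (t := D) 0 (by rw [h0]; exact hf)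
          hc.hasDerivWithinAt fun s hs => hs
      have h2 := h1.hasDerivAt (hs.mono fun s h => h.1)
      have h3 : HasDerivAt (F ∘ c) 0 0 := by
        refine (hasDerivAt_const (0 : ℂ) (F Z)).congr_of_eventuallyEq ?_
        filter_upwards [hs] with s h
        exact h.2
      exact h2.unique h3
    have hreal : ∀ v : Fin N → ℝ, cpair B Z (realC v) = 0 →
        fderivWithin ℂ F D Z (realC v) = 0 := by
      intro v hv
      rcases eq_or_ne v 0 with rfl | hv0
      · rw [show realC (0 : Fin N → ℝ) = 0 by ext; simp [realC], map_zero]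
      obtain ⟨X, r, t, hX, hr, ht, e, e'⟩ := exists_frame_of_orth hB (hD.subset hZ) hv0 hv
      have hXD := hpt hZ hr e
      have hr0 : (r : ℂ) ≠ 0 := by exact_mod_cast hr.ne'
      have h : HasDerivAt (fun s => (r : ℂ) • ray (pt X) (fun i => X i 2) s)
          ((r : ℂ) • realC fun i => X i 2) 0 := by
        have h1 : HasDerivAt (ray (pt X) fun i => X i 2)
            ((1 : ℂ) • (realC fun i => X i 2) + ((2 * 0 : ℂ) / 4) • cj (pt X)) 0 := by
          unfold ray
          refine (((hasDerivAt_id (0 : ℂ)).smul_const _).const_add (pt X)).add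
            (HasDerivAt.smul_const ?_ _)
          simpa using ((hasDerivAt_id (0 : ℂ)).pow 2).div_const 4
        refine (h1.const_smul (r : ℂ)).congr_deriv ?_
        simp
      have h0 := curve h (by rw [ray_zero, ← e]) (by
        filter_upwards [Metric.ball_mem_nhds (0 : ℂ) two_pos] with s hs
        have hs' : ‖s‖ < 2 := by simpa using hs
        have hm := hX.ray_mem hB hD hXD hs'
        refine ⟨hD.smul_mem hB hm hr0, ?_⟩
        rw [hsc _ hr0 _ hm, (ray_const_of_frame hN hB hdet hD hΓ hχ hk hF hX hXD).1 s hs', e,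
          hsc _ hr0 _ hXD])
      rw [map_smul, smul_eq_mul] at h0
      rw [e', map_smul, (mul_eq_zero.1 h0).resolve_left hr0, smul_zero]
    have hself : fderivWithin ℂ F D Z Z = 0 := by
      refine curve (c := fun s => (1 + s) • Z) ?_ (by simp) ?_
      · simpa using (((hasDerivAt_id (0 : ℂ)).const_add 1).smul_const Z)
      · have : ∀ᶠ s : ℂ in nhds 0, 1 + s ≠ 0 :=
          (continuous_const.add continuous_id).continuousAt.eventually_ne (by simp)
        filter_upwards [this] with s hs
        exact ⟨hD.smul_mem hB hZ hs, hsc _ hs _ hZ⟩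
    have hZc := hD.subset hZ
    have hJ : coefJ B Z w = 0 := by rw [coefJ, cpair_comm hB.symm, hw, zero_div]
    have p1 := cpair_perp hB.symm hZc w
    have p2 := cpair_cj_perp hB.symm hZc w
    have p3 : cpair B Z (cj (perp B Z w)) = 0 := by
      have h := cpair_cj (B := B) (cj Z) (perp B Z w)
      rwa [cj_cj, p2, map_zero] at h
    have hre : cpair B Z (realC (reV (perp B Z w))) = 0 := by
      have : realC (reV (perp B Z w)) = (1 / 2 : ℂ) • (perp B Z w + cj (perp B Z w)) := by
        ext i
        simp [realC, reV, cj, Complex.add_conj]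
      rw [this, cpair_smul_right, cpair_add_right, p1, p3, add_zero, mul_zero]
    have him : cpair B Z (realC (imV (perp B Z w))) = 0 := by
      have h := p1
      rw [← realC_add_im (perp B Z w), cpair_add_right, hre, zero_add, cpair_smul_right] at h
      exact (mul_eq_zero.1 h).resolve_left Complex.I_ne_zero
    rw [decomp (B := B) Z w, hJ, zero_smul, add_zero, map_add, map_smul, hself, smul_zero, zero_add,
      ← realC_add_im (perp B Z w), map_add, map_smul, hreal _ hre, hreal _ him, smul_zero, add_zero]
  obtain ⟨Z, hZ⟩ := hD.nonempty
  refine ⟨F Z, fun W hW => ?_⟩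
  have hZc := hD.subset hZ
  have hd : ∀ t ∈ Metric.closedBall (0 : ℂ) 1,
      HasDerivWithinAt (F ∘ disc B Z W) 0 (Metric.closedBall (0 : ℂ) 1) t := by
    intro t ht
    have hm := hD.disc_mem hB hZ hW (t := t) (by simpa using ht)
    have hc : HasDerivAt (disc B Z W) ((2 * t * coefJ B Z W) • cj Z + perp B Z W) t := by
      unfold disc
      have h1 : HasDerivAt (fun t : ℂ => t ^ 2 * coefJ B Z W) (2 * t * coefJ B Z W) t := by
        simpa using ((hasDerivAt_id t).pow 2).mul_const (coefJ B Z W)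
      refine (((h1.smul_const (cj Z)).const_add (coefZ B Z W • Z)).add
        ((hasDerivAt_id t).smul_const (perp B Z W))).congr_deriv ?_
      simp
    have h := HasFDerivWithinAt.comp_hasDerivWithinAt (t := D) t
      (hF.holo _ hm).hasFDerivWithinAt (hc.hasDerivWithinAt (s := Metric.closedBall (0 : ℂ) 1))
      fun s hs => hD.disc_mem hB hZ hW (by simpa using hs)
    rwa [hder _ hm] at h
    have p1 := cpair_perp hB.symm hZc W
    have p2 := cpair_cj_perp hB.symm hZc W
    have p2' := (cpair_comm hB.symm (perp B Z W) (cj Z)).trans p2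
    have p3 := cpair_cj_cj_self hB.symm hZc
    have p4 := cpair_self_perp hB.symm hZc W
    rw [(hD.subset hW).1] at p4
    rw [disc]
    simp only [cpair_add_left, cpair_add_right, cpair_smul_left, cpair_smul_right, p1, p2, p2', p3]
    linear_combination -t * p4
  have h := Convex.norm_image_sub_le_of_norm_hasDerivWithin_le hd (C := 0) (fun _ _ => by simp)
    (convex_closedBall 0 1) (show (0 : ℂ) ∈ _ by simp) (show (1 : ℂ) ∈ _ by simp)
  rw [zero_mul, norm_le_zero_iff, sub_eq_zero] at h
  simp only [Function.comp_apply, disc_one, disc_zero] at h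
  rw [h, hsc _ (hD.coefZ_ne_zero hB hZ hW) _ hZ]

end WeightPos

section HolomorphicLimits

open Metric Filter Topology

/-- A uniform limit of holomorphic functions on a ball in a complex normed space is holomorphic at
the centre. -/
lemma differentiableAt_of_tendstoUniformlyOn {E : Type*} [NormedAddCommGroup E] [NormedSpace ℂ E]
    {h : ℕ → E → ℂ} {g : E → ℂ} {x : E} {ε : ℝ} (hε : 0 < ε)
    (hd : ∀ j, DifferentiableOn ℂ (h j) (ball x ε))
    (hu : TendstoUniformlyOn h g atTop (ball x ε)) : DifferentiableAt ℂ g x := by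
  have hε2 : 0 < ε / 2 := by positivity
  have hsub : ∀ y ∈ ball x (ε / 2), ball y (ε / 2) ⊆ ball x ε := fun y hy z hz => by
    rw [mem_ball] at *
    linarith [dist_triangle z y x]
  have hdat : ∀ j, ∀ y ∈ ball x (ε / 2), DifferentiableAt ℂ (h j) y := fun j y hy =>
    (hd j).differentiableAt (isOpen_ball.mem_nhds (ball_subset_ball (by linarith) hy))
  have hcau : UniformCauchySeqOn (fun j => fderiv ℂ (h j)) atTop (ball x (ε / 2)) := by
    rw [Metric.uniformCauchySeqOn_iff]
    intro δ hδ
    obtain ⟨J, hJ⟩ := (Metric.uniformCauchySeqOn_iff.1 hu.uniformCauchySeqOn)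
      (δ * (ε / 2) / 4) (by positivity)
    refine ⟨J, fun i hi j hj y hy => ?_⟩
    have hdf : DifferentiableOn ℂ (fun z => h i z - h j z) (ball y (ε / 2)) :=
      ((hd i).sub (hd j)).mono (hsub y hy)
    have h1 : ∀ z ∈ ball y (ε / 2), ‖h i z - h j z‖ ≤ δ * (ε / 2) / 4 := fun z hz => by
      rw [← dist_eq_norm]
      exact (hJ i hi j hj z (hsub y hy hz)).le
    have h2 := Complex.norm_fderiv_le_div_of_mapsTo_ball (R₂ := δ * (ε / 2) / 2) hdf
      (fun z hz => by
        rw [mem_closedBall, dist_eq_norm]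
        refine (norm_sub_le _ _).trans ?_
        linarith [h1 z hz, h1 y (mem_ball_self hε2)]) hε2
    rw [fderiv_fun_sub (hdat i y hy) (hdat j y hy)] at h2
    rw [dist_eq_norm]
    refine h2.trans_lt ?_
    rw [div_lt_iff₀ hε2]
    nlinarith [mul_pos hδ hε2]
  have hlim : ∀ y ∈ ball x (ε / 2), ∃ l, Tendsto (fun j => fderiv ℂ (h j) y) atTop (𝓝 l) :=
    fun y hy => cauchySeq_tendsto_of_complete (hcau.cauchySeq hy)
  choose! g' hg' using hlim
  exact (hasFDerivAt_of_tendstoUniformlyOn isOpen_ball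
    (hcau.tendstoUniformlyOn_of_tendsto hg') (fun j y hy => (hdat j y hy).hasFDerivAt)
    (fun y hy => hu.tendsto_at (ball_subset_ball (by linarith) hy))
    (mem_ball_self hε2)).differentiableAt

lemma exists_quotient {f : ℂ → ℂ} {ε : ℝ} (hε : 0 < ε) (hf : DifferentiableOn ℂ f (ball 0 ε))
    {m : ℕ} (hm : (m : ℕ∞) ≤ analyticOrderAt f 0) :
    ∃ q : ℂ → ℂ, DifferentiableOn ℂ q (ball 0 ε) ∧ ∀ s, s ≠ 0 → q s = f s / s ^ m := by
  have ha : AnalyticAt ℂ f 0 := hf.analyticAt (ball_mem_nhds 0 hε)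
  obtain ⟨g, hg, hgf⟩ := (natCast_le_analyticOrderAt ha).1 hm
  refine ⟨fun s => if s = 0 then g 0 else f s / s ^ m, ?_, fun s hs => by simp [hs]⟩
  rw [← Complex.differentiableOn_compl_singleton_and_continuousAt_iff (ball_mem_nhds 0 hε)]
  constructor
  · refine DifferentiableOn.congr (f := fun s => f s / s ^ m) ?_ fun s hs => ?_
    · intro s hs
      exact ((hf s hs.1).mono Set.sdiff_subset).div (by fun_prop) (pow_ne_zero _ hs.2)
    · simp [show s ≠ 0 from hs.2]
  · refine hg.continuousAt.congr ?_
    filter_upwards [hgf] with s hs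
    by_cases h0 : s = 0
    · simp [h0]
    · simp only [h0, if_false]
      rw [hs, sub_zero, smul_eq_mul, mul_div_cancel_left₀ _ (pow_ne_zero _ h0)]

/-- The leading coefficient of a holomorphic family of functions vanishing to order at least `m`
depends holomorphically on the parameter, and is a locally uniform limit. -/
lemma exists_leading_coeff {E : Type*} [NormedAddCommGroup E] [NormedSpace ℂ E] {h : E → ℂ → ℂ}
    {x₀ : E} {ε M : ℝ} (hε : 0 < ε) (hd : ∀ x ∈ ball x₀ ε, DifferentiableOn ℂ (h x) (ball 0 ε))
    (hd' : ∀ s ∈ ball (0 : ℂ) ε, DifferentiableOn ℂ (fun x => h x s) (ball x₀ ε))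
    (hM : ∀ x ∈ ball x₀ ε, ∀ s ∈ ball (0 : ℂ) ε, ‖h x s‖ ≤ M) {m : ℕ}
    (hm : ∀ x ∈ ball x₀ ε, (m : ℕ∞) ≤ analyticOrderAt (h x) 0) :
    ∃ g : E → ℂ, DifferentiableAt ℂ g x₀ ∧ ∃ K δ : ℝ, 0 < δ ∧ ∀ x ∈ ball x₀ ε, ∀ s ∈ ball (0 : ℂ) δ,
      s ≠ 0 → ‖h x s / s ^ m - g x‖ ≤ K * ‖s‖ := by
  choose! q hq hqs using fun x hx => exists_quotient hε (hd x hx) (hm x hx)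
  have hρ : 0 < ε / 2 := by positivity
  have hM0 : 0 ≤ M := (norm_nonneg _).trans (hM x₀ (mem_ball_self hε) 0 (mem_ball_self hε))
  set M' := M / (ε / 2) ^ m with hM'
  have hb : ∀ x ∈ ball x₀ ε, ∀ s ∈ ball (0 : ℂ) (ε / 2), ‖q x s‖ ≤ M' := by
    intro x hx s hs
    refine Complex.norm_le_of_forall_mem_frontier_norm_le (isBounded_ball (x := 0) (r := ε / 2))
      (DifferentiableOn.diffContOnCl_ball (U := ball 0 ε) (hq x hx)
        (closedBall_subset_ball (by linarith)))
      (fun z hz => ?_) (subset_closure hs)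
    rw [frontier_ball _ hρ.ne', mem_sphere_zero_iff_norm] at hz
    have hz0 : z ≠ 0 := norm_pos_iff.1 (hz ▸ hρ)
    rw [hqs x hx z hz0, norm_div, norm_pow, hz]
    refine div_le_div_of_nonneg_right ?_ (by positivity)
    exact hM x hx z (by rw [mem_ball_zero_iff, hz]; linarith)
  set K := 2 * M' / (ε / 2) with hK
  have hmain : ∀ x ∈ ball x₀ ε, ∀ s ∈ ball (0 : ℂ) (ε / 2), s ≠ 0 →
      ‖h x s / s ^ m - q x 0‖ ≤ K * ‖s‖ := by
    intro x hx s hs hs0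
    have h2 := Complex.dist_le_div_mul_dist_of_mapsTo_ball (R₂ := 2 * M') (z := s)
      ((hq x hx).mono (ball_subset_ball (show ε / 2 ≤ ε by linarith)))
      (fun z hz => by
        rw [mem_closedBall, dist_eq_norm]
        refine (norm_sub_le _ _).trans ?_
        linarith [hb x hx z hz, hb x hx 0 (mem_ball_self hρ)]) hs
    rwa [dist_eq_norm, dist_zero_right, hqs x hx s hs0] at h2
  have hK0 : 0 ≤ K := by positivity
  refine ⟨fun x => q x 0, ?_, K, ε / 2, hρ, hmain⟩
  obtain ⟨σ, hσ, hσ'⟩ : ∃ σ : ℕ → ℂ, (∀ j, σ j ∈ ball (0 : ℂ) (ε / 2) ∧ σ j ≠ 0) ∧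
      Tendsto σ atTop (𝓝 0) := by
    have ht : Tendsto (fun j : ℕ => ((ε / 4 * (1 / ((j : ℝ) + 1)) : ℝ) : ℂ)) atTop (𝓝 0) := by
      have := (tendsto_one_div_add_atTop_nhds_zero_nat (𝕜 := ℝ)).const_mul (ε / 4)
      rw [mul_zero] at this
      exact_mod_cast (Complex.continuous_ofReal.tendsto 0).comp this
    refine ⟨_, fun j => ⟨?_, ?_⟩, ht⟩
    · rw [mem_ball_zero_iff, Complex.norm_real, Real.norm_of_nonneg (by positivity)]
      have : 1 / ((j : ℝ) + 1) ≤ 1 := by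
        rw [div_le_one (by positivity)]
        linarith [Nat.cast_nonneg (α := ℝ) j]
      nlinarith
    · rw [Complex.ofReal_ne_zero]
      positivity
  refine differentiableAt_of_tendstoUniformlyOn hε
    (h := fun j x => h x (σ j) / σ j ^ m) (fun j => ?_) ?_
  · have hs : σ j ∈ ball (0 : ℂ) ε := ball_subset_ball (by linarith) (hσ j).1
    simpa only [div_eq_mul_inv] using (hd' _ hs).mul_const (σ j ^ m)⁻¹
  · rw [Metric.tendstoUniformlyOn_iff]
    intro δ hδ
    have : Tendsto (fun j => K * ‖σ j‖) atTop (𝓝 0) := by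
      simpa using hσ'.norm.const_mul K
    filter_upwards [this.eventually_lt_const hδ] with j hj x hx
    rw [dist_comm, dist_eq_norm]
    exact (hmain x hx _ (hσ j).1 (hσ j).2).trans_lt hj

/-- Minimum modulus principle for a holomorphic function without zeros. -/
lemma le_norm_of_ne_zero {f : ℂ → ℂ} {r δ : ℝ} (hr : 0 < r) (hδ : 0 < δ)
    (hf : DifferentiableOn ℂ f (closedBall 0 r)) (h0 : ∀ t ∈ closedBall (0 : ℂ) r, f t ≠ 0)
    (hs : ∀ t, ‖t‖ = r → δ ≤ ‖f t‖) : δ ≤ ‖f 0‖ := by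
  have h := Complex.norm_le_of_forall_mem_frontier_norm_le (f := fun t => (f t)⁻¹) (C := δ⁻¹)
    (isBounded_ball (x := 0) (r := r)) (DifferentiableOn.diffContOnCl_ball (hf.inv h0) subset_rfl)
    (fun z hz => by
      rw [frontier_ball _ hr.ne', mem_sphere_zero_iff_norm] at hz
      rw [norm_inv]
      exact inv_anti₀ hδ (hs z hz)) (subset_closure (mem_ball_self hr))
  rw [norm_inv] at h
  exact (inv_le_inv₀ (norm_pos_iff.2 (h0 0 (mem_closedBall_self hr.le))) hδ).1 h

end HolomorphicLimits

section DirectSum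

variable {m n : ℕ} (A : Matrix (Fin m) (Fin m) ℤ) (C : Matrix (Fin n) (Fin n) ℤ)

@[simp] lemma dsum_castAdd_castAdd (i j : Fin m) :
    dsum A C (Fin.castAdd n i) (Fin.castAdd n j) = A i j := by simp [dsum]

@[simp] lemma dsum_natAdd_natAdd (i j : Fin n) :
    dsum A C (Fin.natAdd m i) (Fin.natAdd m j) = C i j := by simp [dsum]

@[simp] lemma dsum_castAdd_natAdd (i : Fin m) (j : Fin n) :
    dsum A C (Fin.castAdd n i) (Fin.natAdd m j) = 0 := by simp [dsum]

@[simp] lemma dsum_natAdd_castAdd (i : Fin n) (j : Fin m) :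
    dsum A C (Fin.natAdd m i) (Fin.castAdd n j) = 0 := by simp [dsum]

lemma cpair_dsum (Z W : Fin m → ℂ) (S T : Fin n → ℂ) :
    cpair (dsum A C) (Fin.append Z S) (Fin.append W T) = cpair A Z W + cpair C S T := by
  simp [cpair, Fin.sum_univ_add]

lemma rpair_dsum (Z W : Fin m → ℝ) (S T : Fin n → ℝ) :
    rpair (dsum A C) (Fin.append Z S) (Fin.append W T) = rpair A Z W + rpair C S T := by
  simp [rpair, Fin.sum_univ_add]

lemma dotProduct_dsum (x y : Fin m → ℤ) (s t : Fin n → ℤ) :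
    Fin.append x s ⬝ᵥ dsum A C *ᵥ Fin.append y t = x ⬝ᵥ A *ᵥ y + s ⬝ᵥ C *ᵥ t := by
  simp [dotProduct, mulVec, Fin.sum_univ_add]

lemma qnorm_dsum (x : Fin m → ℤ) (s : Fin n → ℤ) :
    qnorm (dsum A C) (Fin.append x s) = qnorm A x + qnorm C s := dotProduct_dsum A C x x s s

lemma cpair_neg_matrix (Z W : Fin n → ℂ) : cpair (-C) Z W = -cpair C Z W := by
  simp [cpair]

lemma rpair_neg_matrix (Z W : Fin n → ℝ) : rpair (-C) Z W = -rpair C Z W := by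
  simp [rpair]

lemma qnorm_neg_matrix (x : Fin n → ℤ) : qnorm (-C) x = -qnorm C x := by
  simp [qnorm, neg_mulVec]

lemma append_surj {α : Type*} (f : Fin (m + n) → α) : ∃ x y, f = Fin.append x y :=
  ⟨_, _, (Fin.append_castAdd_natAdd (f := f)).symm⟩

lemma cj_append (Z : Fin m → ℂ) (S : Fin n → ℂ) :
    cj (Fin.append Z S) = Fin.append (cj Z) (cj S) := by
  ext i
  refine Fin.addCases (fun i => ?_) (fun i => ?_) i <;> simp [cj]

lemma intC_append (x : Fin m → ℤ) (y : Fin n → ℤ) :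
    intC (Fin.append x y) = Fin.append (intC x) (intC y) := by
  ext i
  refine Fin.addCases (fun i => ?_) (fun i => ?_) i <;> simp [intC]

lemma smul_append (c : ℂ) (Z : Fin m → ℂ) (S : Fin n → ℂ) :
    c • Fin.append Z S = Fin.append (c • Z) (c • S) := by
  ext i
  refine Fin.addCases (fun i => ?_) (fun i => ?_) i <;> simp

lemma actC_dsum (g : Matrix (Fin m) (Fin m) ℤ) (Z : Fin m → ℂ) (S : Fin n → ℂ) :
    actC (dsum g 1) (Fin.append Z S) = Fin.append (actC g Z) S := by
  ext i
  refine Fin.addCases (fun i => ?_) (fun i => ?_) i <;>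
    simp [actC, mulVec, dotProduct, Fin.sum_univ_add, Matrix.one_apply]

lemma dsum_mul (a b : Matrix (Fin m) (Fin m) ℤ) (c d : Matrix (Fin n) (Fin n) ℤ) :
    dsum a c * dsum b d = dsum (a * b) (c * d) := by
  simp only [dsum, reindex_apply, submatrix_mul_equiv, fromBlocks_multiply]
  simp

lemma dsum_one : dsum (1 : Matrix (Fin m) (Fin m) ℤ) (1 : Matrix (Fin n) (Fin n) ℤ) = 1 := by
  simp [dsum]

lemma dsum_transpose : (dsum A C)ᵀ = dsum Aᵀ Cᵀ := by
  simp [dsum, fromBlocks_transpose]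

lemma dsum_det : (dsum A C).det = A.det * C.det := by
  simp [dsum]

lemma dsum_isometry {B : Matrix (Fin m) (Fin m) ℤ} {g : Matrix (Fin m) (Fin m) ℤ}
    (hg : gᵀ * B * g = B) : (dsum g 1)ᵀ * dsum B C * dsum g 1 = dsum B C := by
  simp only [dsum_transpose, dsum_mul, hg, transpose_one, Matrix.one_mul, Matrix.mul_one]

lemma Hyp.dsum_neg {B : Matrix (Fin m) (Fin m) ℤ} (hB : Hyp B) {L : Matrix (Fin n) (Fin n) ℤ}
    (hL : L.IsSymm) (hpos : ∀ x : Fin n → ℝ, x ≠ 0 → 0 < rpair L x x) : Hyp (dsum B (-L)) := by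
  constructor
  · rw [IsSymm, dsum_transpose, transpose_neg, hL.eq, hB.symm.eq]
  · obtain ⟨T, hT⟩ := hB.neg
    refine ⟨T ∘ₗ LinearMap.funLeft ℝ ℝ (Fin.castAdd n), fun w hw h => ?_⟩
    obtain ⟨x, y, rfl⟩ := append_surj w
    have hx : LinearMap.funLeft ℝ ℝ (Fin.castAdd n) (Fin.append x y) = x := by
      ext i
      simp [LinearMap.funLeft_apply]
    rw [LinearMap.comp_apply, hx] at h
    rw [rpair_dsum, rpair_neg_matrix]
    have hy : y ≠ 0 → 0 < rpair L y y := hpos y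
    by_cases hx0 : x = 0
    · have hy0 : y ≠ 0 := by
        rintro rfl
        apply hw
        ext i
        refine Fin.addCases (fun i => ?_) (fun i => ?_) i <;> simp [hx0]
      have := hpos y hy0
      subst hx0
      simp only [rpair, Pi.zero_apply, mul_zero, Finset.sum_const_zero] at this ⊢
      linarith
    · have h1 := hT x hx0 h
      by_cases hy0 : y = 0
      · subst hy0
        simpa [rpair] using h1
      · linarith [hpos y hy0]

end DirectSum

section Signature

variable {N n : ℕ} {B : Matrix (Fin N) (Fin N) ℤ}

lemma hyp_of_signature (hB : IsEvenLatticeOfSignature B 2 n) : Hyp B ∧ (Cone B).Nonempty := by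
  obtain ⟨rfl, hs, -, -, P, hP, e⟩ := hB
  have key : ∀ x y : Fin (2 + n) → ℝ, rpair B (P *ᵥ x) (P *ᵥ y) =
      ∑ i : Fin (2 + n), x i * ((if (i : ℕ) < 2 then (1 : ℝ) else -1) * y i) := by
    intro x y
    rw [rpair_eq_dotProduct, mulVec_mulVec, dotProduct_mulVec, vecMul_mulVec, ← dotProduct_mulVec,
      ← Matrix.mul_assoc, e]
    simp [dotProduct, mulVec_diagonal]
  refine ⟨⟨hs, LinearMap.funLeft ℝ ℝ (Fin.castAdd n) ∘ₗ (P⁻¹).mulVecLin, fun w hw h => ?_⟩, ?_⟩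
  · have hw' : P *ᵥ (P⁻¹ *ᵥ w) = w := by
      rw [mulVec_mulVec, Matrix.mul_nonsing_inv P hP, one_mulVec]
    set y := P⁻¹ *ᵥ w with hy
    have hy0 : ∀ i : Fin 2, y (Fin.castAdd n i) = 0 := fun i => congrFun h i
    have hne : ∃ i : Fin n, y (Fin.natAdd 2 i) ≠ 0 := by
      by_contra! hc
      apply hw
      rw [← hw', show y = 0 from funext fun i => Fin.addCases hy0 hc i, mulVec_zero]
    rw [← hw', key, Fin.sum_univ_add]
    simp only [hy0, zero_mul, Finset.sum_const_zero, zero_add, Fin.val_natAdd]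
    obtain ⟨i, hi⟩ := hne
    refine Finset.sum_neg' (fun j _ => ?_) ⟨i, Finset.mem_univ _, ?_⟩
    · rw [if_neg (by lia)]
      nlinarith [mul_self_nonneg (y (Fin.natAdd 2 j))]
    · rw [if_neg (by lia)]
      nlinarith [mul_self_pos.2 hi]
  · set a : Fin (2 + n) := Fin.castAdd n 0
    set b : Fin (2 + n) := Fin.castAdd n 1
    have hab : a ≠ b := by simp [a, b]
    have e1 : rpair B (P *ᵥ Pi.single a 1) (P *ᵥ Pi.single a 1) = 1 := by
      rw [key]; simp [Pi.single_apply, a]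
    have e2 : rpair B (P *ᵥ Pi.single b 1) (P *ᵥ Pi.single b 1) = 1 := by
      rw [key]; simp [Pi.single_apply, b]
    have e3 : rpair B (P *ᵥ Pi.single a 1) (P *ᵥ Pi.single b 1) = 0 := by
      rw [key]; simp [Pi.single_apply, hab.symm]
    generalize P *ᵥ Pi.single a 1 = x at *
    generalize P *ᵥ Pi.single b 1 = y at *
    have e4 := (rpair_comm hs y x).trans e3
    refine ⟨realC x + Complex.I • realC y, ?_⟩
    rw [mem_cone, cj_add, cj_smul, cj_realC, cj_realC]
    simp only [cpair_add_left, cpair_add_right, cpair_smul_left, cpair_smul_right, cpair_realC, e1,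
      e2, e3, e4]
    constructor
    · simp
    · simp

end Signature

section Generic

open Topology Filter

variable {n : ℕ} {B : Matrix (Fin n) (Fin n) ℤ}

/-- A nonempty open set contains a vector orthogonal to no nonzero integral vector. -/
lemma exists_generic (hdet : B.det ≠ 0) {O : Set (Fin n → ℝ)} (hO : IsOpen O) (hne : O.Nonempty) :
    ∃ x ∈ O, ∀ a : Fin n → ℤ, a ≠ 0 → rpair B x (intR a) ≠ 0 := by
  have hc : ∀ a : Fin n → ℤ, Continuous fun x => rpair B x (intR a) := fun a =>
    continuous_rpair_comp B continuous_id continuous_const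
  have hd : Dense (⋂ a : {a : Fin n → ℤ // a ≠ 0}, {x | rpair B x (intR a.1) ≠ 0}) := by
    refine dense_iInter_of_isOpen (fun a => isOpen_ne_fun (hc a.1) continuous_const) fun a => ?_
    have hv : ∃ v : Fin n → ℝ, rpair B v (intR a.1) ≠ 0 := by
      by_contra! h
      have h0 : B *ᵥ a.1 = 0 := by
        ext i
        have := h (intR (Pi.single i 1))
        rw [rpair_intR, single_dotProduct, one_mul] at this
        exact_mod_cast this
      exact a.2 (eq_zero_of_mulVec_eq_zero hdet h0)
    obtain ⟨v, hv⟩ := hv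
    intro x
    by_cases hx : rpair B x (intR a.1) = 0
    · have ht : Tendsto (fun t : ℝ => x + t • v) (𝓝[≠] 0) (𝓝 x) := by
        have : Continuous fun t : ℝ => x + t • v := by fun_prop
        simpa using (this.tendsto 0).mono_left nhdsWithin_le_nhds
      refine mem_closure_of_tendsto ht ?_
      filter_upwards [self_mem_nhdsWithin] with t ht
      rw [rpair_add_left, hx, zero_add, rpair_smul_left]
      exact mul_ne_zero ht hv
    · exact subset_closure hx
  obtain ⟨x, hx, hxO⟩ := hd.exists_mem_open hO hne
  exact ⟨x, hxO, fun a ha => (Set.mem_iInter.1 hx) ⟨a, ha⟩⟩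

/-- The cone contains a point orthogonal to no nonzero integral vector. -/
lemma exists_generic_cone (hB : B.IsSymm) (hdet : B.det ≠ 0) (hne : (Cone B).Nonempty) :
    ∃ Z ∈ Cone B, ∀ a : Fin n → ℤ, a ≠ 0 → cpair B Z (intC a) ≠ 0 := by
  obtain ⟨Z₀, hZ₀⟩ := hne
  obtain ⟨h1, h2, h3⟩ := cone_re_im hB hZ₀
  set x₀ := reV Z₀
  set y₀ := imV Z₀
  have hp : 0 < rpair B x₀ x₀ := by
    have := hZ₀.2
    change 0 < (cpair B Z₀ (cj Z₀)).re at this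
    linarith
  have hc1 : Continuous fun x => rpair B x x := continuous_rpair_comp B continuous_id continuous_id
  have hc2 : Continuous fun x => rpair B x x * rpair B y₀ y₀ - rpair B x y₀ ^ 2 :=
    (hc1.mul continuous_const).sub
      ((continuous_rpair_comp B continuous_id continuous_const).pow 2)
  obtain ⟨x, ⟨hx1, hx2⟩, hx⟩ := exists_generic hdet
    ((isOpen_lt continuous_const hc1).inter (isOpen_lt continuous_const hc2))
    (show ({x | 0 < rpair B x x} ∩
      {x | 0 < rpair B x x * rpair B y₀ y₀ - rpair B x y₀ ^ 2}).Nonempty from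
      ⟨x₀, hp, show 0 < rpair B x₀ x₀ * rpair B y₀ y₀ - rpair B x₀ y₀ ^ 2 by
        rw [h1, ← h2]; nlinarith⟩)
  replace hx1 : 0 < rpair B x x := hx1
  replace hx2 : 0 < rpair B x x * rpair B y₀ y₀ - rpair B x y₀ ^ 2 := hx2
  set y := rpair B x x • y₀ - rpair B x y₀ • x with hy
  have hxy : rpair B x y = 0 := by
    rw [hy, rpair_sub_right, rpair_smul_right, rpair_smul_right]
    ring
  have hyy : rpair B y y =
      rpair B x x * (rpair B x x * rpair B y₀ y₀ - rpair B x y₀ ^ 2) := by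
    rw [hy]
    simp only [rpair_sub_right, rpair_smul_right, rpair_sub_left, rpair_smul_left,
      rpair_comm hB y₀ x]
    ring
  have hyy0 : 0 < rpair B y y := hyy ▸ mul_pos hx1 hx2
  set c := Real.sqrt (rpair B x x / rpair B y y) with hcdef
  have hc : c ^ 2 * rpair B y y = rpair B x x := by
    rw [hcdef, Real.sq_sqrt (by positivity), div_mul_cancel₀ _ hyy0.ne']
  have hcx : ∀ a : Fin n → ℤ, cpair B (realC x + Complex.I • realC (c • y)) (intC a) =
      (rpair B x (intR a) : ℂ) + Complex.I * (rpair B (c • y) (intR a) : ℂ) := fun a => by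
    rw [intC_eq_realC, cpair_add_left, cpair_smul_left, cpair_realC, cpair_realC]
  refine ⟨realC x + Complex.I • realC (c • y), ?_, fun a ha h0 => ?_⟩
  · have e2 : rpair B x (c • y) = 0 := by rw [rpair_smul_right, hxy, mul_zero]
    have e3 : rpair B (c • y) x = 0 := (rpair_comm hB _ _).trans e2
    have e4 : rpair B (c • y) (c • y) = rpair B x x := by
      rw [rpair_smul_right, rpair_smul_left, ← hc]
      ring
    rw [mem_cone, cj_add, cj_smul, cj_realC, cj_realC]
    simp only [cpair_add_left, cpair_add_right, cpair_smul_left, cpair_smul_right, cpair_realC, e2,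
      e3, e4]
    constructor
    · simp only [Complex.ofReal_zero]
      linear_combination (rpair B x x : ℂ) * Complex.I_mul_I
    · simpa using hx1
  · rw [hcx] at h0
    have := congrArg Complex.re h0
    exact hx a ha (by simpa using this)

end Generic

section LocalFiniteness

open Topology Filter

variable {n : ℕ} {B : Matrix (Fin n) (Fin n) ℤ}

lemma Hyp.eventually_neg (hB : Hyp B) {X₀ : Fin n → ℂ} (hX : X₀ ∈ Cone B) :
    ∃ c : ℝ, 0 < c ∧ ∀ᶠ X in 𝓝 X₀, ∀ w : Fin n → ℝ, cpair B X (realC w) = 0 →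
      rpair B w w ≤ -(c * ‖w‖ ^ 2) := by
  set φ : (Fin n → ℂ) × (Fin n → ℝ) → ℝ := fun p => ‖cpair B p.1 (realC p.2)‖ +
    max 0 (-rpair B p.2 p.2) with hφ
  have hr : Continuous (realC : (Fin n → ℝ) → Fin n → ℂ) :=
    continuous_pi fun i => Complex.continuous_ofReal.comp (continuous_apply i)
  have hφc : Continuous φ := by
    refine ((continuous_cpair_comp B continuous_fst (hr.comp continuous_snd)).norm).add ?_
    exact continuous_const.max (continuous_rpair_comp B continuous_snd continuous_snd).neg
  have hK : IsCompact (Metric.sphere (0 : Fin n → ℝ) 1) := isCompact_sphere _ _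
  have hpos : ∀ w ∈ Metric.sphere (0 : Fin n → ℝ) 1, 0 < φ (X₀, w) := by
    intro w hw
    have hw0 : w ≠ 0 := by
      rintro rfl
      simp at hw
    by_cases h : cpair B X₀ (realC w) = 0
    · have := hB.neg_of_orth hX hw0 h
      simp only [hφ, h, norm_zero, zero_add]
      exact lt_max_of_lt_right (by linarith)
    · have := norm_pos_iff.2 h
      simp only [hφ]
      have := le_max_left 0 (-rpair B w w)
      linarith
  obtain ⟨c, hc, hcb⟩ : ∃ c : ℝ, 0 < c ∧ ∀ w ∈ Metric.sphere (0 : Fin n → ℝ) 1, c < φ (X₀, w) := by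
    rcases (Metric.sphere (0 : Fin n → ℝ) 1).eq_empty_or_nonempty with he | hne
    · exact ⟨1, one_pos, by simp [he]⟩
    · obtain ⟨w, hw, hmin⟩ := hK.exists_isMinOn hne
        (hφc.comp (Continuous.prodMk_right X₀)).continuousOn
      exact ⟨φ (X₀, w) / 2, half_pos (hpos w hw), fun z hz =>
        (half_lt_self (hpos w hw)).trans_le (hmin hz)⟩
  refine ⟨c, hc, ?_⟩
  have hev : ∀ᶠ X in 𝓝 X₀, ∀ w ∈ Metric.sphere (0 : Fin n → ℝ) 1, c < φ (X, w) :=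
    hK.eventually_forall_of_forall_eventually (P := fun X w => c < φ (X, w)) fun w hw =>
      (hφc.tendsto _).eventually_const_lt (hcb w hw)
  filter_upwards [hev] with X hX w hw
  by_cases hw0 : w = 0
  · subst hw0
    simp [rpair]
  have hn : 0 < ‖w‖ := norm_pos_iff.2 hw0
  have h := hX (‖w‖⁻¹ • w) (by simp [norm_smul, hn.ne'])
  simp only [hφ, realC_smul, cpair_smul_right, hw, mul_zero, norm_zero, zero_add] at h
  have h2 := (lt_max_iff.1 h).resolve_left (not_lt.2 hc.le)
  rw [rpair_smul_left, rpair_smul_right] at h2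
  have h3 : ‖w‖⁻¹ * (‖w‖⁻¹ * rpair B w w) * ‖w‖ ^ 2 = rpair B w w := by
    field_simp
  nlinarith [sq_pos_of_pos hn]

/-- Local finiteness of the hyperplanes orthogonal to integral vectors of bounded norm. -/
lemma Hyp.eventually_orth (hB : Hyp B) {X₀ : Fin n → ℂ} (hX : X₀ ∈ Cone B) (C : ℤ) :
    ∀ᶠ X in 𝓝 X₀, ∀ v : Fin n → ℤ, -C ≤ qnorm B v → OrthZ B X v → OrthZ B X₀ v := by
  obtain ⟨c, hc, hev⟩ := hB.eventually_neg hX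
  obtain ⟨R, hR1, hR⟩ : ∃ R : ℕ, (1 : ℝ) ≤ R ∧ (C : ℝ) < c * R := by
    obtain ⟨R, hR⟩ := exists_nat_gt (max 1 ((C : ℝ) / c))
    have hR2 := (le_max_right _ _).trans_lt hR
    exact ⟨R, (le_max_left _ _).trans hR.le, by rwa [div_lt_iff₀' hc] at hR2⟩
  have hfin : (Set.Icc (fun _ => -(R : ℤ)) (fun _ => (R : ℤ)) : Set (Fin n → ℤ)).Finite :=
    Set.finite_Icc _ _
  have hev2 : ∀ᶠ X in 𝓝 X₀, ∀ v ∈ (Set.Icc (fun _ => -(R : ℤ)) (fun _ => (R : ℤ)) :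
      Set (Fin n → ℤ)), OrthZ B X v → OrthZ B X₀ v := by
    rw [eventually_all_finite hfin]
    intro v _
    by_cases h : OrthZ B X₀ v
    · exact Eventually.of_forall fun _ _ => h
    · have hc : Continuous fun X => cpair B X (intC v) :=
        continuous_cpair_comp B continuous_id continuous_const
      filter_upwards [(hc.tendsto X₀).eventually_ne h] with X hX h'
      exact absurd h' hX
  filter_upwards [hev, hev2] with X h1 h2 v hv ho
  refine h2 v ?_ ho
  have h3 := h1 (intR v) (by rw [← intC_eq_realC]; exact ho)
  rw [rpair_intR_self] at h3
  have hv' : -(C : ℝ) ≤ qnorm B v := by exact_mod_cast hv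
  have h4 : ‖intR v‖ ≤ R := by
    by_contra! h
    have h6 : (R : ℝ) ≤ ‖intR v‖ ^ 2 := by nlinarith
    nlinarith [mul_le_mul_of_nonneg_left h6 hc.le]
  have h5 : ∀ i, |v i| ≤ R := fun i => by
    have := (norm_le_pi_norm (intR v) i).trans h4
    rw [intR, Real.norm_eq_abs] at this
    exact_mod_cast this
  exact ⟨fun i => (abs_le.1 (h5 i)).1, fun i => (abs_le.1 (h5 i)).2⟩

end LocalFiniteness

section Lift

open Topology Filter Metric

variable {n r : ℕ}

/-- The family of isotropic vectors `s ↦ (Z + c(s) Y, s u)` of `M ⊕ L(-1)`, equal to `(Z, 0)` at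
`s = 0` when `Z` is isotropic. -/
noncomputable def lift (B : Matrix (Fin n) (Fin n) ℤ) (L : Matrix (Fin r) (Fin r) ℤ)
    (Y : Fin n → ℂ) (u : Fin r → ℝ) (Z : Fin n → ℂ) (s : ℂ) : Fin (n + r) → ℂ :=
  Fin.append (Z + ((s ^ 2 * (rpair L u u : ℂ) - cpair B Z Z) / (2 * cpair B Z Y)) • Y) (s • realC u)

/-- The projection along `Y` onto the isotropic vectors. -/
noncomputable def retract (B : Matrix (Fin n) (Fin n) ℤ) (Y Z : Fin n → ℂ) : Fin n → ℂ :=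
  Z - (cpair B Z Z / (2 * cpair B Z Y)) • Y

variable {B : Matrix (Fin n) (Fin n) ℤ} {L : Matrix (Fin r) (Fin r) ℤ} {Y Z : Fin n → ℂ}
  {u : Fin r → ℝ}

lemma cpair_retract_left (hY : cpair B Y Y = 0) : cpair B (retract B Y Z) Y = cpair B Z Y := by
  rw [retract, cpair_sub_left, cpair_smul_left, hY, mul_zero, sub_zero]

lemma cpair_retract (hB : B.IsSymm) (hY : cpair B Y Y = 0) (h : cpair B Z Y ≠ 0) :
    cpair B (retract B Y Z) (retract B Y Z) = 0 := by
  rw [retract]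
  simp only [cpair_sub_left, cpair_sub_right, cpair_smul_left, cpair_smul_right, hY,
    cpair_comm hB Y Z]
  field_simp
  ring

lemma retract_eq_self (h : cpair B Z Z = 0) : retract B Y Z = Z := by simp [retract, h]

lemma lift_retract (hB : B.IsSymm) (hY : cpair B Y Y = 0) (h : cpair B Z Y ≠ 0) (s : ℂ) :
    lift B L Y u (retract B Y Z) s = lift B L Y u Z s := by
  rw [lift, lift, cpair_retract hB hY h, cpair_retract_left hY, retract]
  congr 1
  rw [sub_zero, sub_div, sub_smul]
  abel

lemma cpair_lift (hB : B.IsSymm) (hY : cpair B Y Y = 0) (h : cpair B Z Y ≠ 0) (s : ℂ) :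
    cpair (dsum B (-L)) (lift B L Y u Z s) (lift B L Y u Z s) = 0 := by
  rw [lift, cpair_dsum, cpair_neg_matrix]
  simp only [cpair_add_left, cpair_add_right, cpair_smul_left, cpair_smul_right, hY,
    cpair_comm hB Y Z, cpair_realC]
  field_simp
  ring

lemma lift_zero (h : cpair B Z Z = 0) : lift B L Y u Z 0 = Fin.append Z 0 := by
  simp [lift, h]

lemma lift_smul {t : ℂ} (ht : t ≠ 0) (s : ℂ) :
    lift B L Y u (t • Z) (t * s) = t • lift B L Y u Z s := by
  rw [lift, lift, smul_append, smul_add, smul_smul, smul_smul]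
  congr 3
  simp only [cpair_smul_left, cpair_smul_right]
  by_cases h : cpair B Z Y = 0
  · simp [h]
  · field_simp

lemma differentiableAt_append {E : Type*} [NormedAddCommGroup E] [NormedSpace ℂ E]
    {f : E → Fin n → ℂ} {g : E → Fin r → ℂ} {x : E} (hf : DifferentiableAt ℂ f x)
    (hg : DifferentiableAt ℂ g x) : DifferentiableAt ℂ (fun a => Fin.append (f a) (g a)) x := by
  refine differentiableAt_pi.2 fun i => ?_
  refine Fin.addCases (fun i => ?_) (fun i => ?_) i
  · simpa using differentiableAt_pi.1 hf i
  · simpa using differentiableAt_pi.1 hg i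

lemma differentiableAt_lift {p : (Fin n → ℂ) × ℂ} (h : cpair B p.1 Y ≠ 0) :
    DifferentiableAt ℂ (fun p : (Fin n → ℂ) × ℂ => lift B L Y u p.1 p.2) p := by
  have h1 : DifferentiableAt ℂ (fun p : (Fin n → ℂ) × ℂ => p.1) p := differentiableAt_fst
  have h2 : DifferentiableAt ℂ (fun p : (Fin n → ℂ) × ℂ => p.2) p := differentiableAt_snd
  refine differentiableAt_append (h1.add (DifferentiableAt.fun_smul ?_ (differentiableAt_const _)))
    (h2.smul (differentiableAt_const _))
  have h3 : DifferentiableAt ℂ (fun p : (Fin n → ℂ) × ℂ =>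
      p.2 ^ 2 * (rpair L u u : ℂ) - cpair B p.1 p.1) p :=
    ((h2.fun_pow 2).fun_mul (differentiableAt_const _)).fun_sub (differentiableAt_cpair B h1 h1)
  have h4 : DifferentiableAt ℂ (fun p : (Fin n → ℂ) × ℂ => 2 * cpair B p.1 Y) p :=
    (differentiableAt_cpair B h1 (differentiableAt_const _)).const_mul 2
  simp only [div_eq_mul_inv]
  exact h3.fun_mul (h4.fun_inv (mul_ne_zero two_ne_zero h))

/-- A component of the cone of `M`, embedded in a component of the cone of `M ⊕ L(-1)`, with an
isotropic vector `Y` orthogonal to none of its points. -/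
structure Embeds (B : Matrix (Fin n) (Fin n) ℤ) (L : Matrix (Fin r) (Fin r) ℤ)
    (D : Set (Fin n → ℂ)) (D' : Set (Fin (n + r) → ℂ)) (Y : Fin n → ℂ) : Prop where
  hyp : Hyp B
  hyp' : Hyp (dsum B (-L))
  comp : IsComponent B D
  comp' : IsComponent (dsum B (-L)) D'
  iso : cpair B Y Y = 0
  ne : ∀ Z ∈ D, cpair B Z Y ≠ 0
  append_mem : ∀ Z ∈ D, Fin.append Z 0 ∈ D'

variable {D : Set (Fin n → ℂ)} {D' : Set (Fin (n + r) → ℂ)}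

lemma Embeds.eventually (h : Embeds B L D D' Y) (u : Fin r → ℝ) (hZ : Z ∈ D) :
    ∀ᶠ p : (Fin n → ℂ) × ℂ in 𝓝 (Z, 0),
      cpair B p.1 Y ≠ 0 ∧ retract B Y p.1 ∈ D ∧ lift B L Y u p.1 p.2 ∈ D' := by
  have hZ0 := (h.comp.subset hZ).1
  have h1 : ∀ᶠ p : (Fin n → ℂ) × ℂ in 𝓝 (Z, 0), cpair B p.1 Y ≠ 0 :=
    ((continuous_cpair_comp B continuous_fst continuous_const).tendsto (Z, (0 : ℂ))).eventually_ne
      (h.ne Z hZ)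
  have h2 : Tendsto (fun p : (Fin n → ℂ) × ℂ => lift B L Y u p.1 p.2) (𝓝 (Z, 0))
      (𝓝 (Fin.append Z 0)) := by
    have := (differentiableAt_lift (L := L) (u := u) (p := (Z, (0 : ℂ)))
      (h.ne Z hZ)).continuousAt.tendsto
    rwa [lift_zero hZ0] at this
  have h3 : Tendsto (fun p : (Fin n → ℂ) × ℂ => retract B Y p.1) (𝓝 (Z, 0)) (𝓝 Z) := by
    have hc : ContinuousAt (fun p : (Fin n → ℂ) × ℂ => retract B Y p.1) (Z, 0) := by
      refine continuousAt_fst.sub (ContinuousAt.fun_smul (ContinuousAt.div ?_ ?_ ?_) continuousAt_const)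
      · exact (continuous_cpair_comp B continuous_fst continuous_fst).continuousAt
      · exact (continuous_const.mul
          (continuous_cpair_comp B continuous_fst continuous_const)).continuousAt
      · exact mul_ne_zero two_ne_zero (h.ne Z hZ)
    have := hc.tendsto
    rwa [retract_eq_self (by exact hZ0)] at this
  have h4 := h.comp.eventually_mem h.hyp hZ h3
    (h1.mono fun p hp => cpair_retract h.hyp.symm h.iso hp)
  have h5 := h.comp'.eventually_mem h.hyp' (h.append_mem Z hZ) h2
    (h1.mono fun p hp => cpair_lift h.hyp.symm h.iso hp p.2)
  filter_upwards [h1, h4, h5] with p a b c using ⟨a, b, c⟩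

/-- The coefficient of `s ^ m` in `F (lift Z s)`, for a function vanishing there to order `m`. -/
noncomputable def leadCoeff (B : Matrix (Fin n) (Fin n) ℤ) (L : Matrix (Fin r) (Fin r) ℤ)
    (Y : Fin n → ℂ) (u : Fin r → ℝ) (F : (Fin (n + r) → ℂ) → ℂ) (m : ℕ) (Z : Fin n → ℂ) : ℂ :=
  limUnder (𝓝[≠] 0) fun s : ℂ => F (lift B L Y u Z s) / s ^ m

variable {F : (Fin (n + r) → ℂ) → ℂ} {m : ℕ}

lemma Embeds.eventually_differentiableAt (h : Embeds B L D D' Y) (hF : DifferentiableOn ℂ F D')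
    (u : Fin r → ℝ) (hZ : Z ∈ D) : ∀ᶠ p : (Fin n → ℂ) × ℂ in 𝓝 (Z, 0),
      DifferentiableAt ℂ (fun p : (Fin n → ℂ) × ℂ => F (lift B L Y u p.1 p.2)) p := by
  filter_upwards [(h.eventually u hZ).eventually_nhds] with p hp
  have h0 := hp.self_of_nhds
  have h1 : DifferentiableWithinAt ℂ F D' (lift B L Y u p.1 p.2) := hF _ h0.2.2
  have h2 : DifferentiableWithinAt ℂ (fun p : (Fin n → ℂ) × ℂ => F (lift B L Y u p.1 p.2))
      {q | lift B L Y u q.1 q.2 ∈ D'} p :=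
    DifferentiableWithinAt.comp (g := F) (f := fun p : (Fin n → ℂ) × ℂ => lift B L Y u p.1 p.2)
      (t := D') p h1 (differentiableAt_lift h0.1).differentiableWithinAt fun q hq => hq
  exact h2.differentiableAt (hp.mono fun q hq => hq.2.2)

lemma Embeds.leadCoeff_estimate (h : Embeds B L D D' Y) (hF : DifferentiableOn ℂ F D')
    (hm : ∀ Z ∈ D, (m : ℕ∞) ≤ analyticOrderAt (fun s => F (lift B L Y u Z s)) 0) (hZ : Z ∈ D) :
    DifferentiableAt ℂ (leadCoeff B L Y u F m) Z ∧ ∃ K ε : ℝ, 0 < ε ∧ ∀ X ∈ ball Z ε,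
      ∀ s ∈ ball (0 : ℂ) ε, s ≠ 0 →
        ‖F (lift B L Y u X s) / s ^ m - leadCoeff B L Y u F m X‖ ≤ K * ‖s‖ := by
  have hd := h.eventually_differentiableAt hF u hZ
  have hb : ∀ᶠ p : (Fin n → ℂ) × ℂ in 𝓝 (Z, 0),
      ‖F (lift B L Y u p.1 p.2)‖ < ‖F (lift B L Y u Z 0)‖ + 1 :=
    (hd.self_of_nhds.continuousAt.norm.tendsto).eventually_lt_const (lt_add_one _)
  obtain ⟨ε, hε, hε'⟩ := Metric.eventually_nhds_iff_ball.1 ((h.eventually u hZ).and (hd.and hb))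
  rw [← ball_prod_same] at hε'
  obtain ⟨g, hg, K, δ, hδ, hK⟩ := exists_leading_coeff (h := fun X s => F (lift B L Y u X s))
    (M := ‖F (lift B L Y u Z 0)‖ + 1) (m := m) hε
    (fun X hX s hs => by
      have h1 := (hε' (X, s) ⟨hX, hs⟩).2.1
      exact (DifferentiableAt.comp (f := fun s => (X, s)) s h1
        ((differentiableAt_const X).prodMk differentiableAt_fun_id)).differentiableWithinAt)
    (fun s hs X hX => by
      have h1 := (hε' (X, s) ⟨hX, hs⟩).2.1
      exact (DifferentiableAt.comp (f := fun X => (X, s)) X h1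
        (differentiableAt_fun_id.prodMk (differentiableAt_const s))).differentiableWithinAt)
    (fun X hX s hs => (hε' (X, s) ⟨hX, hs⟩).2.2.le)
    (fun X hX => by
      have h1 := (hε' (X, 0) ⟨hX, mem_ball_self hε⟩).1
      have h2 := hm _ h1.2.1
      simpa only [lift_retract h.hyp.symm h.iso h1.1] using h2)
  have hGg : ∀ X ∈ ball Z ε, leadCoeff B L Y u F m X = g X := by
    intro X hX
    refine Tendsto.limUnder_eq (tendsto_iff_norm_sub_tendsto_zero.2 ?_)
    have hl : Tendsto (fun s : ℂ => K * ‖s‖) (𝓝[≠] 0) (𝓝 0) := by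
      have : Continuous fun s : ℂ => K * ‖s‖ := by fun_prop
      simpa using (this.tendsto 0).mono_left nhdsWithin_le_nhds
    refine squeeze_zero' (Eventually.of_forall fun s => norm_nonneg _) ?_ hl
    filter_upwards [nhdsWithin_le_nhds (ball_mem_nhds (0 : ℂ) hδ), self_mem_nhdsWithin]
      with s hs hs0 using hK X hX s hs hs0
  refine ⟨hg.congr_of_eventuallyEq ?_, K, min ε δ, lt_min hε hδ, fun X hX s hs hs0 => ?_⟩
  · filter_upwards [ball_mem_nhds Z hε] with X hX using hGg X hX
  · have hX' := ball_subset_ball (min_le_left ε δ) hX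
    rw [hGg X hX']
    exact hK X hX' s (ball_subset_ball (min_le_right ε δ) hs) hs0

lemma Embeds.leadCoeff_tendsto (h : Embeds B L D D' Y) (hF : DifferentiableOn ℂ F D')
    (hm : ∀ Z ∈ D, (m : ℕ∞) ≤ analyticOrderAt (fun s => F (lift B L Y u Z s)) 0) (hZ : Z ∈ D)
    {X : ℂ → Fin n → ℂ} (hX : Tendsto X (𝓝[≠] 0) (𝓝 Z)) :
    Tendsto (fun s => F (lift B L Y u (X s) s) / s ^ m) (𝓝[≠] 0)
      (𝓝 (leadCoeff B L Y u F m Z)) := by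
  obtain ⟨hd, K, ε, hε, hK⟩ := h.leadCoeff_estimate hF hm hZ
  have h1 : Tendsto (fun s => leadCoeff B L Y u F m (X s)) (𝓝[≠] 0)
      (𝓝 (leadCoeff B L Y u F m Z)) := hd.continuousAt.tendsto.comp hX
  have hl : Tendsto (fun s : ℂ => K * ‖s‖) (𝓝[≠] 0) (𝓝 0) := by
    have : Continuous fun s : ℂ => K * ‖s‖ := by fun_prop
    simpa using (this.tendsto 0).mono_left nhdsWithin_le_nhds
  have h2 : Tendsto (fun s => F (lift B L Y u (X s) s) / s ^ m - leadCoeff B L Y u F m (X s))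
      (𝓝[≠] 0) (𝓝 0) := by
    refine squeeze_zero_norm' ?_ hl
    filter_upwards [nhdsWithin_le_nhds (ball_mem_nhds (0 : ℂ) hε), self_mem_nhdsWithin,
      hX.eventually (ball_mem_nhds Z hε)] with s hs hs0 hXs using hK _ hXs s hs hs0
  simpa using h2.add h1

end Lift

section LeadCoeff

open Topology Filter Metric

variable {n r : ℕ} {B : Matrix (Fin n) (Fin n) ℤ} {L : Matrix (Fin r) (Fin r) ℤ} {Y Z : Fin n → ℂ}
  {u : Fin r → ℝ} {D : Set (Fin n → ℂ)} {D' : Set (Fin (n + r) → ℂ)}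
  {F : (Fin (n + r) → ℂ) → ℂ} {m : ℕ}

lemma Embeds.eventually_lift_mem (h : Embeds B L D D' Y) (u : Fin r → ℝ) (hZ : Z ∈ D) :
    ∀ᶠ s : ℂ in 𝓝 0, lift B L Y u Z s ∈ D' := by
  have hc : Tendsto (fun s : ℂ => (Z, s)) (𝓝 0) (𝓝 (Z, 0)) :=
    (Continuous.prodMk_right Z).tendsto 0
  exact (hc.eventually (h.eventually u hZ)).mono fun s hs => hs.2.2

lemma Embeds.eventually_lift_mem' (h : Embeds B L D D' Y) (u : Fin r → ℝ) (hZ : Z ∈ D) :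
    ∀ᶠ s : ℂ in 𝓝[≠] 0, lift B L Y u Z s ∈ D' :=
  (h.eventually_lift_mem u hZ).filter_mono nhdsWithin_le_nhds

lemma Embeds.dsum_mem_OPlus (h : Embeds B L D D' Y) (hdet : (dsum B (-L)).det ≠ 0)
    {g : Matrix (Fin n) (Fin n) ℤ} (hg : g ∈ OPlus B D) : dsum g 1 ∈ OPlus (dsum B (-L)) D' := by
  obtain ⟨Z, hZ⟩ := h.comp.nonempty
  refine mem_OPlus_of_mem h.hyp' hdet h.comp' (dsum_isometry _ hg.1) (h.append_mem Z hZ) ?_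
  rw [actC_dsum]
  exact h.append_mem _ (OPlus_act hg hZ)

/-- The isometries of `M` whose extension by the identity of `L(-1)` lies in `Γ'`. -/
def restrictGroup (B : Matrix (Fin n) (Fin n) ℤ) (D : Set (Fin n → ℂ))
    (Γ' : Set (Matrix (Fin (n + r)) (Fin (n + r)) ℤ)) : Set (Matrix (Fin n) (Fin n) ℤ) :=
  {g | g ∈ OPlus B D ∧ dsum g 1 ∈ Γ'}

lemma exists_inv_OPlus (hB : Hyp B) (hdet : B.det ≠ 0) (hD : IsComponent B D)
    {g : Matrix (Fin n) (Fin n) ℤ} (hg : g ∈ OPlus B D) :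
    ∃ h ∈ OPlus B D, g * h = 1 ∧ h * g = 1 := by
  obtain ⟨h, h1, h2, h3⟩ := exists_inv_isometry hdet hg.1
  obtain ⟨Z, hZ⟩ := hD.nonempty
  refine ⟨h, mem_OPlus_of_mem hB hdet hD h3 (OPlus_act hg hZ) ?_, h1, h2⟩
  rwa [← actC_mul, h2, actC_one]

lemma mul_mem_OPlus (hB : Hyp B) (hdet : B.det ≠ 0) (hD : IsComponent B D)
    {g h : Matrix (Fin n) (Fin n) ℤ} (hg : g ∈ OPlus B D) (hh : h ∈ OPlus B D) :
    g * h ∈ OPlus B D := by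
  obtain ⟨Z, hZ⟩ := hD.nonempty
  refine mem_OPlus_of_mem hB hdet hD ?_ hZ ?_
  · rw [transpose_mul]
    calc hᵀ * gᵀ * B * (g * h) = hᵀ * (gᵀ * B * g) * h := by simp only [Matrix.mul_assoc]
      _ = B := by rw [hg.1, hh.1]
  · rw [actC_mul]
    exact OPlus_act hg (OPlus_act hh hZ)

lemma Embeds.isFiniteIndexSubgroup (h : Embeds B L D D' Y) (hdet : B.det ≠ 0)
    (hdet' : (dsum B (-L)).det ≠ 0) {Γ' : Set (Matrix (Fin (n + r)) (Fin (n + r)) ℤ)}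
    (hΓ : IsFiniteIndexSubgroup (dsum B (-L)) D' Γ') :
    IsFiniteIndexSubgroup B D (restrictGroup B D Γ') := by
  have one_mem : (1 : Matrix (Fin n) (Fin n) ℤ) ∈ OPlus B D := by
    obtain ⟨Z, hZ⟩ := h.comp.nonempty
    exact mem_OPlus_of_mem h.hyp hdet h.comp (by simp) hZ (by rwa [actC_one])
  refine ⟨fun g hg => hg.1, ⟨one_mem, ?_⟩, fun g hg k hk => ⟨?_, ?_⟩, fun g hg => ?_, ?_⟩
  · rw [dsum_one]
    exact hΓ.one_mem
  · exact mul_mem_OPlus h.hyp hdet h.comp hg.1 hk.1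
  · have := hΓ.mul_mem _ hg.2 _ hk.2
    rwa [dsum_mul, Matrix.one_mul] at this
  · obtain ⟨k, hk, h1, h2⟩ := exists_inv_OPlus h.hyp hdet h.comp hg.1
    refine ⟨k, ⟨hk, ?_⟩, h1, h2⟩
    obtain ⟨k', hk', h3, -⟩ := hΓ.inv_mem _ hg.2
    have : dsum k 1 = k' := by
      calc dsum k 1 = dsum k 1 * (dsum g 1 * k') := by rw [h3, Matrix.mul_one]
        _ = k' := by rw [← Matrix.mul_assoc, dsum_mul, h2, Matrix.mul_one, dsum_one, Matrix.one_mul]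
    rwa [this]
  · obtain ⟨S, hS⟩ := hΓ.finite_index
    classical
    let P : Matrix (Fin (n + r)) (Fin (n + r)) ℤ → Matrix (Fin n) (Fin n) ℤ → Prop :=
      fun s g => g ∈ OPlus B D ∧ ∃ γ ∈ Γ', dsum g 1 = s * γ
    let c : Matrix (Fin (n + r)) (Fin (n + r)) ℤ → Matrix (Fin n) (Fin n) ℤ :=
      fun s => if hs : ∃ g, P s g then hs.choose else 1
    refine ⟨S.image c, fun g hg => ?_⟩
    obtain ⟨s, hs, γ, hγ, e⟩ := hS _ (h.dsum_mem_OPlus hdet' hg)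
    have hP : ∃ g, P s g := ⟨g, hg, γ, hγ, e⟩
    have hc : P s (c s) := by
      simp only [c, dif_pos hP]
      exact hP.choose_spec
    obtain ⟨hc1, γ₁, hγ₁, e₁⟩ := hc
    obtain ⟨k, hk, h1, h2⟩ := exists_inv_OPlus h.hyp hdet h.comp hc1
    obtain ⟨δ, hδ, h3, h4⟩ := hΓ.inv_mem _ hγ₁
    refine ⟨c s, Finset.mem_image_of_mem _ hs, k * g,
      ⟨mul_mem_OPlus h.hyp hdet h.comp hk hg, ?_⟩, ?_⟩
    · have : dsum (k * g) 1 = δ * γ := by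
        have hs' : s = dsum (c s) 1 * δ := by rw [e₁, Matrix.mul_assoc, h3, Matrix.mul_one]
        calc dsum (k * g) (1 : Matrix (Fin r) (Fin r) ℤ)
            = dsum k 1 * dsum g 1 := by rw [dsum_mul, Matrix.mul_one]
          _ = dsum k 1 * (dsum (c s) 1 * δ * γ) := by rw [← hs', e]
          _ = dsum k 1 * dsum (c s) 1 * (δ * γ) := by simp only [Matrix.mul_assoc]
          _ = δ * γ := by rw [dsum_mul, h2, Matrix.mul_one, dsum_one, Matrix.one_mul]
      rw [this]
      exact hΓ.mul_mem _ hδ _ hγ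
    · rw [← Matrix.mul_assoc, h1, Matrix.one_mul]

lemma isCharacter_restrict {Γ' : Set (Matrix (Fin (n + r)) (Fin (n + r)) ℤ)}
    {χ : Matrix (Fin (n + r)) (Fin (n + r)) ℤ → ℂ} (hχ : IsCharacter Γ' χ) :
    IsCharacter (restrictGroup B D Γ') fun g => χ (dsum g 1) := by
  refine ⟨fun g hg => hχ.ne_zero _ hg.2, fun g hg k hk => ?_, hχ.finite_image.subset ?_⟩
  · have := hχ.map_mul _ hg.2 _ hk.2
    rwa [dsum_mul, Matrix.one_mul] at this
  · rintro _ ⟨g, hg, rfl⟩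
    exact ⟨_, hg.2, rfl⟩

lemma Embeds.exists_lift_actC (h : Embeds B L D D' Y) (u : Fin r → ℝ) (hZ : Z ∈ D)
    {g : Matrix (Fin n) (Fin n) ℤ} (hg : g ∈ OPlus B D) :
    ∃ X : ℂ → Fin n → ℂ, Tendsto X (𝓝 0) (𝓝 (actC g Z)) ∧
      ∀ s, actC (dsum g 1) (lift B L Y u Z s) = lift B L Y u (X s) s := by
  have hZ0 := (h.comp.subset hZ).1
  have hne := h.ne Z hZ
  refine ⟨fun s => actC g (Z + ((s ^ 2 * (rpair L u u : ℂ) - cpair B Z Z) /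
    (2 * cpair B Z Y)) • Y), ?_, fun s => ?_⟩
  · have hc : Continuous fun s : ℂ => actC g (Z + ((s ^ 2 * (rpair L u u : ℂ) - cpair B Z Z) /
        (2 * cpair B Z Y)) • Y) :=
      (continuous_actC g).comp (by fun_prop)
    simpa [hZ0] using hc.tendsto 0
  · rw [lift, actC_dsum]
    conv_rhs => rw [lift]
    congr 1
    have : cpair B (Z + ((s ^ 2 * (rpair L u u : ℂ) - cpair B Z Z) / (2 * cpair B Z Y)) • Y)
        (Z + ((s ^ 2 * (rpair L u u : ℂ) - cpair B Z Z) / (2 * cpair B Z Y)) • Y) =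
        s ^ 2 * (rpair L u u : ℂ) := by
      simp only [cpair_add_left, cpair_add_right, cpair_smul_left, cpair_smul_right, h.iso,
        cpair_comm h.hyp.symm Y Z, hZ0]
      field_simp
      ring
    rw [cpair_actC hg.1, this, sub_self, zero_div, zero_smul, add_zero]

lemma Embeds.isModularForm_leadCoeff (h : Embeds B L D D' Y)
    {Γ' : Set (Matrix (Fin (n + r)) (Fin (n + r)) ℤ)}
    {χ : Matrix (Fin (n + r)) (Fin (n + r)) ℤ → ℂ} {k : ℤ}
    (hF : IsModularForm (dsum B (-L)) D' Γ' χ k F)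
    (hm : ∀ Z ∈ D, (m : ℕ∞) ≤ analyticOrderAt (fun s => F (lift B L Y u Z s)) 0) :
    IsModularForm B D (restrictGroup B D Γ') (fun g => χ (dsum g 1)) (k + m)
      (leadCoeff B L Y u F m) := by
  refine ⟨fun Z hZ => (h.leadCoeff_estimate hF.holo hm hZ).1.differentiableWithinAt,
    fun t ht Z hZ => ?_, fun g hg Z hZ => ?_⟩
  · have h1 := h.leadCoeff_tendsto hF.holo hm (h.comp.smul_mem h.hyp hZ ht)
      (tendsto_const_nhds (x := t • Z))
    have h2 : Tendsto (fun s : ℂ => t * s) (𝓝[≠] 0) (𝓝[≠] 0) := by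
      refine tendsto_nhdsWithin_iff.2 ⟨?_, ?_⟩
      · have : Continuous fun s : ℂ => t * s := by fun_prop
        simpa using (this.tendsto 0).mono_left nhdsWithin_le_nhds
      · filter_upwards [self_mem_nhdsWithin] with s hs using mul_ne_zero ht hs
    have h3 := (h.leadCoeff_tendsto hF.holo hm hZ
      (tendsto_const_nhds (x := Z))).const_mul (t ^ (-(k + m) : ℤ))
    refine tendsto_nhds_unique ((h1.comp h2).congr' ?_) h3
    filter_upwards [h.eventually_lift_mem' u hZ, self_mem_nhdsWithin] with s hs hs0
    simp only [Function.comp_apply]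
    rw [lift_smul ht, hF.homogeneous t ht _ hs, neg_add, zpow_add₀ ht, zpow_neg t m, zpow_natCast,
      mul_pow]
    field_simp
  · obtain ⟨X, hX, hXs⟩ := h.exists_lift_actC u hZ hg.1
    have h1 := h.leadCoeff_tendsto hF.holo hm (OPlus_act hg.1 hZ)
      (hX.mono_left nhdsWithin_le_nhds)
    have h3 := (h.leadCoeff_tendsto hF.holo hm hZ
      (tendsto_const_nhds (x := Z))).const_mul (χ (dsum g 1))
    refine tendsto_nhds_unique (h1.congr' ?_) h3
    filter_upwards [h.eventually_lift_mem' u hZ] with s hs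
    rw [← hXs, hF.equivariant _ hg.2 _ hs, mul_div_assoc]

lemma Embeds.leadCoeff_ne_zero (h : Embeds B L D D' Y) (hF : DifferentiableOn ℂ F D')
    (hm : ∀ Z ∈ D, (m : ℕ∞) ≤ analyticOrderAt (fun s => F (lift B L Y u Z s)) 0) (hZ : Z ∈ D)
    (hZm : analyticOrderAt (fun s => F (lift B L Y u Z s)) 0 = m) :
    leadCoeff B L Y u F m Z ≠ 0 := by
  have han : AnalyticAt ℂ (fun s => F (lift B L Y u Z s)) 0 := by
    have hd := h.eventually_differentiableAt hF u hZ
    have hc : Tendsto (fun s : ℂ => (Z, s)) (𝓝 0) (𝓝 (Z, 0)) :=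
      (Continuous.prodMk_right Z).tendsto 0
    rw [Complex.analyticAt_iff_eventually_differentiableAt]
    filter_upwards [hc.eventually hd] with s hs
    exact DifferentiableAt.comp (f := fun s => (Z, s)) s hs
      ((differentiableAt_const Z).prodMk differentiableAt_fun_id)
  obtain ⟨g, hg, hg0, he⟩ := (han.analyticOrderAt_eq_natCast).1 hZm
  have h1 := h.leadCoeff_tendsto hF hm hZ (tendsto_const_nhds (x := Z))
  have h2 : Tendsto g (𝓝[≠] 0) (𝓝 (g 0)) := hg.continuousAt.tendsto.mono_left nhdsWithin_le_nhds
  rw [tendsto_nhds_unique (h1.congr' ?_) h2]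
  · exact hg0
  · filter_upwards [he.filter_mono nhdsWithin_le_nhds, self_mem_nhdsWithin] with s hs hs0
    have : s ^ m ≠ 0 := pow_ne_zero _ hs0
    rw [hs, sub_zero, smul_eq_mul, mul_div_cancel_left₀ _ this]

end LeadCoeff

section Zeros

open Topology Filter Metric

variable {n r : ℕ} {B : Matrix (Fin n) (Fin n) ℤ} {L : Matrix (Fin r) (Fin r) ℤ} {Y Z : Fin n → ℂ}
  {u : Fin r → ℝ} {D : Set (Fin n → ℂ)} {D' : Set (Fin (n + r) → ℂ)}
  {F : (Fin (n + r) → ℂ) → ℂ} {m : ℕ} {V : Set (Fin (n + r) → ℤ)} {C : ℤ}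

lemma cpair_append_intC (X : Fin n → ℂ) (S : Fin r → ℂ) (a : Fin n → ℤ) (b : Fin r → ℤ) :
    cpair (dsum B (-L)) (Fin.append X S) (intC (Fin.append a b)) =
      cpair B X (intC a) - cpair L S (intC b) := by
  rw [intC_append, cpair_dsum, cpair_neg_matrix, sub_eq_add_neg]

lemma cpair_zero_left (C : Matrix (Fin n) (Fin n) ℤ) (W : Fin n → ℂ) : cpair C 0 W = 0 := by
  simp [cpair]

/-- A point of `D` orthogonal to no nonzero integral vector: the pulled back function does not
vanish identically there. -/
lemma Embeds.exists_lift_ne_zero (h : Embeds B L D D' Y) (hV : ∀ v ∈ V, v ≠ 0)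
    (hz : ∀ W ∈ D', F W = 0 → ∃ v ∈ V, OrthZ (dsum B (-L)) W v)
    (hu : ∀ b : Fin r → ℤ, b ≠ 0 → rpair L u (intR b) ≠ 0) (hZ : Z ∈ D)
    (hg : ∀ a : Fin n → ℤ, a ≠ 0 → cpair B Z (intC a) ≠ 0) :
    ∃ᶠ s in 𝓝 0, F (lift B L Y u Z s) ≠ 0 := by
  intro hev
  have hZ0 := (h.comp.subset hZ).1
  have hs : ∀ᶠ s : ℂ in 𝓝 0, ∃ v ∈ V, OrthZ (dsum B (-L)) (lift B L Y u Z s) v := by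
    filter_upwards [hev, h.eventually_lift_mem u hZ] with s h1 h2
    exact hz _ h2 (not_not.1 h1)
  have hc : (⋃ v ∈ V, {s | OrthZ (dsum B (-L)) (lift B L Y u Z s) v}).Countable := by
    refine Set.Countable.biUnion V.to_countable fun v hv => Set.Finite.countable ?_
    obtain ⟨a, b, rfl⟩ := append_surj v
    have hab : a = 0 → b ≠ 0 := by
      rintro rfl rfl
      refine hV _ hv ?_
      ext i
      refine Fin.addCases (fun i => ?_) (fun i => ?_) i <;> simp
    set p : Polynomial ℂ := Polynomial.C (rpair L u u / (2 * cpair B Z Y) * cpair B Y (intC a)) *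
      Polynomial.X ^ 2 - Polynomial.C (rpair L u (intR b) : ℂ) * Polynomial.X +
      Polynomial.C (cpair B Z (intC a)) with hp
    have hp0 : p ≠ 0 := by
      intro e
      by_cases ha : a = 0
      · have := congrArg (fun q => Polynomial.coeff q 1) e
        refine hu b (hab ha) ?_
        rw [hp] at this
        simp only [Polynomial.coeff_add, Polynomial.coeff_sub, Polynomial.coeff_C_mul,
          Polynomial.coeff_X_pow, Polynomial.coeff_X_one, Polynomial.coeff_C] at this
        simpa using this
      · have := congrArg (fun q => Polynomial.coeff q 0) e
        refine hg a ha ?_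
        simpa [hp, Polynomial.coeff_X_pow] using this
    refine (Polynomial.finite_setOfPred_isRoot hp0).subset fun s hs => ?_
    change OrthZ (dsum B (-L)) (lift B L Y u Z s) (Fin.append a b) at hs
    rw [OrthZ, lift, cpair_append_intC, hZ0, sub_zero, cpair_add_left, cpair_smul_left,
      cpair_smul_left, intC_eq_realC b, cpair_realC] at hs
    change p.IsRoot s
    rw [Polynomial.IsRoot, ← hs, hp]
    simp only [Polynomial.eval_add, Polynomial.eval_sub, Polynomial.eval_mul, Polynomial.eval_C,
      Polynomial.eval_pow, Polynomial.eval_X]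
    ring
  obtain ⟨s, hs1, hs2⟩ := ((hc.dense_compl ℂ).inter_nhds_nonempty hs)
  obtain ⟨v, hv, h2⟩ := hs2
  exact hs1 (Set.mem_biUnion hv h2)

/-- Away from the divisors orthogonal to `V`, the function does not vanish close to `D`. -/
lemma Embeds.eventually_ne_zero (h : Embeds B L D D' Y)
    (hV : ∀ v ∈ V, v ≠ 0 ∧ -C ≤ qnorm (dsum B (-L)) v)
    (hz : ∀ W ∈ D', F W = 0 → ∃ v ∈ V, OrthZ (dsum B (-L)) W v)
    (hu : ∀ b : Fin r → ℤ, b ≠ 0 → rpair L u (intR b) ≠ 0) (hZ : Z ∈ D)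
    (hn : ∀ a b, a ≠ 0 → Fin.append a b ∈ V → ¬ OrthZ B Z a) :
    ∀ᶠ p : (Fin n → ℂ) × ℂ in 𝓝 (Z, 0), p.2 ≠ 0 → F (lift B L Y u p.1 p.2) ≠ 0 := by
  have hZ0 := (h.comp.subset hZ).1
  have ht : Tendsto (fun p : (Fin n → ℂ) × ℂ => lift B L Y u p.1 p.2) (𝓝 (Z, 0))
      (𝓝 (Fin.append Z 0)) := by
    have := (differentiableAt_lift (L := L) (u := u) (p := (Z, (0 : ℂ)))
      (h.ne Z hZ)).continuousAt.tendsto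
    rwa [lift_zero hZ0] at this
  filter_upwards [ht.eventually (h.hyp'.eventually_orth (h.comp'.subset (h.append_mem Z hZ)) C),
    h.eventually u hZ] with p h1 h2 hp0 hF
  obtain ⟨v, hv, ho⟩ := hz _ h2.2.2 hF
  have ho' := h1 v (hV v hv).2 ho
  obtain ⟨a, b, rfl⟩ := append_surj v
  rw [OrthZ, cpair_append_intC] at ho'
  have ha : a = 0 := by
    by_contra ha
    refine hn a b ha hv ?_
    rwa [cpair_zero_left, sub_zero] at ho'
  subst ha
  have hb : b ≠ 0 := by
    rintro rfl
    refine (hV _ hv).1 ?_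
    ext i
    refine Fin.addCases (fun i => ?_) (fun i => ?_) i <;> simp
  rw [OrthZ, lift, cpair_append_intC, cpair_smul_left, intC_eq_realC b, cpair_realC] at ho
  have h0 : ∀ X : Fin n → ℂ, cpair B X (intC 0) = 0 := fun X => by simp [cpair, intC]
  rw [h0, zero_sub, neg_eq_zero] at ho
  exact mul_ne_zero hp0 (Complex.ofReal_ne_zero.2 (hu b hb)) ho

lemma Embeds.leadCoeff_zero (h : Embeds B L D D' Y) (hF : DifferentiableOn ℂ F D')
    (hm : ∀ Z ∈ D, (m : ℕ∞) ≤ analyticOrderAt (fun s => F (lift B L Y u Z s)) 0)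
    (hsc : ∀ t : ℂ, t ≠ 0 → ∀ X ∈ D, leadCoeff B L Y u F m X ≠ 0 →
      leadCoeff B L Y u F m (t • X) ≠ 0)
    {X : Fin n → ℂ} (hX : X ∈ D) (hX0 : leadCoeff B L Y u F m X ≠ 0)
    (hV : ∀ v ∈ V, v ≠ 0 ∧ -C ≤ qnorm (dsum B (-L)) v)
    (hz : ∀ W ∈ D', F W = 0 → ∃ v ∈ V, OrthZ (dsum B (-L)) W v)
    (hu : ∀ b : Fin r → ℤ, b ≠ 0 → rpair L u (intR b) ≠ 0) (hZ : Z ∈ D)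
    (hZ0 : leadCoeff B L Y u F m Z = 0) :
    ∃ a b, a ≠ 0 ∧ Fin.append a b ∈ V ∧ OrthZ B Z a := by
  by_contra! hn
  have hc0 := h.comp.coefZ_ne_zero h.hyp hZ hX
  set ψ : ℂ → Fin n → ℂ := fun t => (coefZ B Z X)⁻¹ • disc B Z X t with hψ
  have hψd : Differentiable ℂ ψ := (differentiable_disc Z X).fun_const_smul _
  have hψ0 : ψ 0 = Z := by
    simp only [hψ, disc_zero, smul_smul, inv_mul_cancel₀ hc0, one_smul]
  have hψD : ∀ t ∈ closedBall (0 : ℂ) 1, ψ t ∈ D := fun t ht =>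
    h.comp.smul_mem h.hyp (h.comp.disc_mem h.hyp hZ hX (by simpa using ht)) (inv_ne_zero hc0)
  set g : ℂ → ℂ := fun t => leadCoeff B L Y u F m (ψ t) with hg
  have hgd : ∀ t ∈ closedBall (0 : ℂ) 1, DifferentiableAt ℂ g t := fun t ht =>
    DifferentiableAt.comp (g := leadCoeff B L Y u F m) t
      (h.leadCoeff_estimate hF hm (hψD t ht)).1 (hψd t)
  have hg1 : g 1 ≠ 0 := by
    simp only [hg, hψ, disc_one]
    exact hsc _ (inv_ne_zero hc0) X hX hX0
  have hgne : ∀ᶠ t in 𝓝[≠] 0, g t ≠ 0 := by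
    by_contra hfr
    have han : AnalyticOnNhd ℂ g (ball 0 1) := DifferentiableOn.analyticOnNhd
      (fun t ht => (hgd t (ball_subset_closedBall ht)).differentiableWithinAt) isOpen_ball
    have hfr' : ∃ᶠ t in 𝓝[≠] (0 : ℂ), g t = 0 := fun hh => hfr hh
    have he := han.eqOn_zero_of_preconnected_of_frequently_eq_zero
      (convex_ball (0 : ℂ) 1).isPreconnected (mem_ball_self one_pos) hfr'
    have hcl : Set.EqOn g 0 (closedBall 0 1) := by
      rw [← closure_ball (0 : ℂ) one_ne_zero]
      refine he.of_subset_closure (t := closure (ball (0 : ℂ) 1)) ?_ continuousOn_const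
        subset_closure subset_rfl
      rw [closure_ball (0 : ℂ) one_ne_zero]
      exact fun t ht => (hgd t ht).continuousAt.continuousWithinAt
    exact hg1 (hcl (by simp))
  obtain ⟨-, K, ε, hε, hK⟩ := h.leadCoeff_estimate hF hm hZ
  have hev := (h.eventually_ne_zero hV hz hu hZ fun a b ha hab => hn a b ha hab).and
    (h.eventually_differentiableAt hF u hZ)
  obtain ⟨ε₁, hε₁, hev'⟩ := Metric.eventually_nhds_iff_ball.1 hev
  rw [← ball_prod_same] at hev'
  have hmin : 0 < min ε ε₁ := lt_min hε hε₁
  have hψb : ∀ᶠ t in 𝓝 (0 : ℂ), ψ t ∈ ball Z (min ε ε₁) := by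
    have := hψd.continuous.tendsto 0
    rw [hψ0] at this
    exact this.eventually (ball_mem_nhds Z hmin)
  rw [eventually_nhdsWithin_iff] at hgne
  obtain ⟨ρ₀, hρ₀, hρ⟩ := Metric.eventually_nhds_iff_ball.1 (hgne.and hψb)
  set ρ := min (ρ₀ / 2) 1 with hρdef
  have hρp : 0 < ρ := lt_min (by linarith) one_pos
  have hρs : closedBall (0 : ℂ) ρ ⊆ ball 0 ρ₀ :=
    closedBall_subset_ball ((min_le_left _ _).trans_lt (by linarith))
  have hρ1 : closedBall (0 : ℂ) ρ ⊆ closedBall 0 1 := closedBall_subset_closedBall (min_le_right _ _)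
  obtain ⟨δ, hδ, hδb⟩ : ∃ δ : ℝ, 0 < δ ∧ ∀ t : ℂ, ‖t‖ = ρ → δ ≤ ‖g t‖ := by
    obtain ⟨t, ht, hmin⟩ := (isCompact_sphere (0 : ℂ) ρ).exists_isMinOn
      (NormedSpace.sphere_nonempty.2 hρp.le) (f := fun t => ‖g t‖)
      (fun t ht => (hgd t (hρ1 (sphere_subset_closedBall ht))).continuousAt.norm.continuousWithinAt)
    refine ⟨‖g t‖, norm_pos_iff.2 ((hρ t (hρs (sphere_subset_closedBall ht))).1 ?_), fun t' ht' =>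
      hmin (mem_sphere_zero_iff_norm.2 ht')⟩
    rintro rfl
    rw [mem_sphere_zero_iff_norm, norm_zero] at ht
    exact hρp.ne ht
  have hlow : ∀ᶠ s : ℂ in 𝓝[≠] 0, δ / 2 ≤ ‖F (lift B L Y u Z s) / s ^ m‖ := by
    have hKs : ∀ᶠ s : ℂ in 𝓝[≠] 0, K * ‖s‖ < δ / 2 := by
      have hc : Continuous fun s : ℂ => K * ‖s‖ := by fun_prop
      have : Tendsto (fun s : ℂ => K * ‖s‖) (𝓝[≠] 0) (𝓝 0) := by
        simpa using (hc.tendsto 0).mono_left nhdsWithin_le_nhds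
      exact this.eventually_lt_const (by linarith)
    filter_upwards [hKs, self_mem_nhdsWithin, nhdsWithin_le_nhds (ball_mem_nhds (0 : ℂ) hmin)]
      with s h1 h2 h3
    have h3a := ball_subset_ball (min_le_left ε ε₁) h3
    have h3b := ball_subset_ball (min_le_right ε ε₁) h3
    have hsm : s ^ m ≠ 0 := pow_ne_zero _ h2
    have hmem : ∀ t ∈ closedBall (0 : ℂ) ρ, (ψ t, s) ∈ ball Z ε₁ ×ˢ ball (0 : ℂ) ε₁ := fun t ht =>
      ⟨ball_subset_ball (min_le_right ε ε₁) (hρ t (hρs ht)).2, h3b⟩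
    have := le_norm_of_ne_zero (f := fun t => F (lift B L Y u (ψ t) s) / s ^ m) hρp
      (half_pos hδ) (fun t ht => ?_) (fun t ht => div_ne_zero ((hev' _ (hmem t ht)).1 h2) hsm)
      (fun t ht => ?_)
    · simpa only [hψ0] using this
    · have hd := (hev' _ (hmem t ht)).2
      have := DifferentiableAt.comp (f := fun t => (ψ t, s)) t hd
        ((hψd t).prodMk (differentiableAt_const s))
      exact (this.div_const _).differentiableWithinAt
    · have htm : t ∈ closedBall (0 : ℂ) ρ := by simp [ht]
      have h5 := hK (ψ t) (ball_subset_ball (min_le_left ε ε₁) (hρ t (hρs htm)).2) s h3a h2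
      have h6 := hδb t ht
      have h7 := norm_sub_norm_le (g t) (g t - F (lift B L Y u (ψ t) s) / s ^ m)
      rw [sub_sub_cancel, norm_sub_rev] at h7
      linarith
  have h1 := (h.leadCoeff_tendsto hF hm hZ (tendsto_const_nhds (x := Z))).norm
  rw [hZ0, norm_zero] at h1
  have := ge_of_tendsto h1 hlow
  linarith

end Zeros

section Descent

variable {n r : ℕ} {B : Matrix (Fin n) (Fin n) ℤ} {L : Matrix (Fin r) (Fin r) ℤ}

lemma exists_embeds (hB : Hyp B) (hdet : B.det ≠ 0) (hne : (Cone B).Nonempty)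
    (hB' : Hyp (dsum B (-L))) {D' : Set (Fin (n + r) → ℂ)}
    (hD' : IsComponent (dsum B (-L)) D') :
    ∃ D Y, Embeds B L D D' Y ∧ ∃ Z ∈ D, ∀ a : Fin n → ℤ, a ≠ 0 → cpair B Z (intC a) ≠ 0 := by
  obtain ⟨Z₁, hZ₁, hg₁⟩ := exists_generic_cone hB.symm hdet hne
  have hc : ∀ Z W : Fin n → ℂ, cpair (dsum B (-L)) (Fin.append Z 0) (Fin.append W 0) =
      cpair B Z W := fun Z W => by rw [cpair_dsum, cpair_zero_left, add_zero]
  have hj : ∀ Z : Fin n → ℂ, cj (Fin.append Z (0 : Fin r → ℂ)) = Fin.append (cj Z) 0 := fun Z => by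
    rw [cj_append]
    congr 1
    ext i
    simp [cj]
  have hcone : ∀ Z ∈ Cone B, Fin.append Z (0 : Fin r → ℂ) ∈ Cone (dsum B (-L)) := fun Z hZ => by
    rw [mem_cone] at *
    rwa [hj, hc, hc]
  obtain ⟨Z, hZ, hg, hZD⟩ : ∃ Z ∈ Cone B, (∀ a : Fin n → ℤ, a ≠ 0 → cpair B Z (intC a) ≠ 0) ∧
      Fin.append Z 0 ∈ D' := by
    rcases hD'.mem_or_cj_mem hB' (hcone Z₁ hZ₁) with h | h
    · exact ⟨Z₁, hZ₁, hg₁, h⟩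
    · refine ⟨cj Z₁, cj_mem_cone hB.symm hZ₁, fun a ha h0 => hg₁ a ha ?_, by rwa [hj] at h⟩
      rw [intC_eq_realC, cpair_cj_left, cj_realC, ← intC_eq_realC] at h0
      simpa using h0
  have hD := isComponent_same hB hZ
  refine ⟨_, cj Z, ⟨hB, hB', hD, hD', ?_, ?_, ?_⟩, Z, ⟨hZ, same_self hZ⟩, hg⟩
  · exact (cj_mem_cone hB.symm hZ).1
  · exact fun W hW => hD.cpair_cj_ne_zero hB ⟨hZ, same_self hZ⟩ hW
  · intro W hW
    rw [hD'.mem_iff hB' hZD]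
    refine ⟨hcone W hW.1, ?_⟩
    have := hW.2
    unfold Same at *
    rwa [hj, hc, hc]

/-- A modular form on `M ⊕ L(-1)` with zeros on the divisors orthogonal to `V` yields one on `M`
with zeros on the divisors orthogonal to the nonzero projections of `V`. -/
theorem exists_descent (hB : Hyp B) (hdet : B.det ≠ 0) (hne : (Cone B).Nonempty)
    (hB' : Hyp (dsum B (-L))) (hLdet : L.det ≠ 0) (hnr : 6 ≤ n + r) {D' : Set (Fin (n + r) → ℂ)}
    (hD' : IsComponent (dsum B (-L)) D') {Γ' : Set (Matrix (Fin (n + r)) (Fin (n + r)) ℤ)}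
    {χ' : Matrix (Fin (n + r)) (Fin (n + r)) ℤ → ℂ} {k' : ℤ} {F : (Fin (n + r) → ℂ) → ℂ}
    (hΓ : IsFiniteIndexSubgroup (dsum B (-L)) D' Γ') (hχ : IsCharacter Γ' χ')
    (hF : IsModularForm (dsum B (-L)) D' Γ' χ' k' F) (hFn : NonConstantOn D' F)
    {V : Set (Fin (n + r) → ℤ)} {C : ℤ}
    (hV : ∀ v ∈ V, v ≠ 0 ∧ -C ≤ qnorm (dsum B (-L)) v)
    (hz : ∀ W ∈ D', F W = 0 → ∃ v ∈ V, OrthZ (dsum B (-L)) W v) :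
    ∃ D, IsComponent B D ∧ ∃ (Γ : Set (Matrix (Fin n) (Fin n) ℤ))
      (χ : Matrix (Fin n) (Fin n) ℤ → ℂ) (k : ℤ) (G : (Fin n → ℂ) → ℂ),
      IsFiniteIndexSubgroup B D Γ ∧ IsCharacter Γ χ ∧ IsModularForm B D Γ χ k G ∧
      NonConstantOn D G ∧
      ∀ Z ∈ D, G Z = 0 → ∃ a b, a ≠ 0 ∧ Fin.append a b ∈ V ∧ OrthZ B Z a := by
  have hdet' : (dsum B (-L)).det ≠ 0 := by
    rw [dsum_det, det_neg]
    exact mul_ne_zero hdet (mul_ne_zero (pow_ne_zero _ (by norm_num)) hLdet)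
  obtain ⟨D, Y, h, Z₁, hZ₁, hg⟩ := exists_embeds hB hdet hne hB' hD'
  obtain ⟨u, -, hu⟩ := exists_generic hLdet isOpen_univ Set.univ_nonempty
  have hex : ∃ m : ℕ, ∃ Z ∈ D, analyticOrderAt (fun s => F (lift B L Y u Z s)) 0 = m := by
    have := h.exists_lift_ne_zero (fun v hv => (hV v hv).1) hz hu hZ₁ hg
    have hT : analyticOrderAt (fun s => F (lift B L Y u Z₁ s)) 0 ≠ ⊤ := by
      rw [Ne, analyticOrderAt_eq_top]
      exact fun hh => this (hh.mono fun s hs => not_not.2 hs)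
    exact ⟨_, Z₁, hZ₁, (ENat.natCast_toNat hT).symm⟩
  classical
  obtain ⟨X, hX, hXm⟩ := Nat.find_spec hex
  set m := Nat.find hex with hmdef
  have hm : ∀ Z ∈ D, (m : ℕ∞) ≤ analyticOrderAt (fun s => F (lift B L Y u Z s)) 0 := by
    intro Z hZ
    by_cases hT : analyticOrderAt (fun s => F (lift B L Y u Z s)) 0 = ⊤
    · rw [hT]
      exact le_top
    · rw [← ENat.natCast_toNat hT]
      exact_mod_cast Nat.find_min' hex ⟨Z, hZ, (ENat.natCast_toNat hT).symm⟩
  have hG := h.isModularForm_leadCoeff hF hm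
  have hX0 := h.leadCoeff_ne_zero hF.holo hm hX hXm
  refine ⟨D, h.comp, _, _, _, _, h.isFiniteIndexSubgroup hdet hdet' hΓ, isCharacter_restrict hχ,
    hG, ?_, fun Z hZ hZ0 => h.leadCoeff_zero hF.holo hm (fun t ht W hW hW0 => ?_) hX hX0 hV hz hu
      hZ hZ0⟩
  · rintro ⟨c, hc⟩
    have hk := weight_pos hnr hB' hdet' hD' hΓ hχ hF hFn
    have h2 := hG.homogeneous 2 two_ne_zero X hX
    rw [hc X hX] at hX0
    rw [hc _ (h.comp.smul_mem hB hX two_ne_zero), hc X hX] at h2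
    have h3 : (2 : ℂ) ^ (-(k' + m)) = 1 := mul_right_cancel₀ hX0 (by rw [← h2, one_mul])
    have h4 := congrArg norm h3
    rw [norm_zpow, norm_one, Complex.norm_ofNat] at h4
    have h5 : (2 : ℝ) ^ (-(k' + (m : ℤ))) < 1 := zpow_lt_one_of_neg₀ (by norm_num) (by omega)
    linarith
  · rw [hG.homogeneous t ht W hW]
    exact mul_ne_zero (zpow_ne_zero _ ht) hW0

end Descent

section Arithmetic

variable {n : ℕ} {B : Matrix (Fin n) (Fin n) ℤ} {v : Fin n → ℤ}

lemma qnorm_dvd_of_preserves (hv : IsPrimitive v) (h : ReflPreservesLat B v) (hq : qnorm B v ≠ 0)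
    (x : Fin n → ℤ) : qnorm B v ∣ 2 * (x ⬝ᵥ B *ᵥ v) := by
  obtain ⟨y, hy⟩ := h x
  obtain ⟨m, hm⟩ := hv.2 (2 * ((x ⬝ᵥ B *ᵥ v : ℤ) : ℚ) / (qnorm B v : ℚ)) (x - y) fun i => by
    rw [Pi.sub_apply, Int.cast_sub, ← hy i]
    ring
  obtain ⟨i, hi⟩ : ∃ i, v i ≠ 0 := Function.ne_iff.1 hv.1
  have h1 := hy i
  have h2 : x i - y i = m * v i := by simpa using congrFun hm i
  have hvi : (v i : ℚ) ≠ 0 := Int.cast_ne_zero.2 hi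
  have hq' : (qnorm B v : ℚ) ≠ 0 := Int.cast_ne_zero.2 hq
  have h3 : 2 * ((x ⬝ᵥ B *ᵥ v : ℤ) : ℚ) / (qnorm B v : ℚ) = m := by
    have h4 : (x i : ℚ) - y i = m * v i := by exact_mod_cast h2
    refine mul_right_cancel₀ hvi ?_
    linear_combination h4 - h1
  rw [div_eq_iff hq'] at h3
  have h5 : 2 * (x ⬝ᵥ B *ᵥ v) = m * qnorm B v := by exact_mod_cast h3
  exact ⟨m, by rw [h5, mul_comm]⟩

lemma qnorm_dvd_det (hv : IsPrimitive v) (h : ReflPreservesLat B v) (hq : qnorm B v ≠ 0) :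
    qnorm B v ∣ 2 * B.det := by
  choose c hc using fun i => qnorm_dvd_of_preserves hv h hq (B.adjugate i)
  have hi : ∀ i, 2 * B.det * v i = qnorm B v * c i := fun i => by
    have : B.adjugate i ⬝ᵥ B *ᵥ v = (B.adjugate *ᵥ (B *ᵥ v)) i := rfl
    rw [← hc i, this, mulVec_mulVec, adjugate_mul, smul_mulVec, one_mulVec, Pi.smul_apply,
      smul_eq_mul, mul_assoc]
  have hq' : (qnorm B v : ℚ) ≠ 0 := Int.cast_ne_zero.2 hq
  obtain ⟨m, hm⟩ := hv.2 (2 * B.det / qnorm B v) c fun i => by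
    have : (2 * B.det * v i : ℚ) = qnorm B v * c i := by exact_mod_cast hi i
    field_simp
    exact this
  obtain ⟨i, hvi⟩ : ∃ i, v i ≠ 0 := Function.ne_iff.1 hv.1
  refine ⟨m, mul_right_cancel₀ hvi ?_⟩
  rw [hi i, hm, Pi.smul_apply, smul_eq_mul, mul_assoc]

lemma exists_primitive (hv : v ≠ 0) : ∃ (c : ℤ) (w : Fin n → ℤ), c ≠ 0 ∧ v = c • w ∧
    IsPrimitive w := by
  obtain ⟨i, hi⟩ : ∃ i, v i ≠ 0 := Function.ne_iff.1 hv
  obtain ⟨w, hw, hw1⟩ := Finset.extract_gcd v (s := Finset.univ) ⟨i, Finset.mem_univ i⟩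
  have e : v = Finset.univ.gcd v • w := funext fun j => hw j (Finset.mem_univ j)
  refine ⟨_, w, fun h0 => hv (by rw [e, h0, zero_smul]), e, ?_, fun q x hx => ?_⟩
  · rintro rfl
    exact hv (by rw [e, smul_zero])
  · have hd : ∀ j, (q.den : ℤ) ∣ w j := fun j => by
      have h1 : q.num * w j = q.den * x j := by
        have := hx j
        rw [← Rat.num_div_den q, div_mul_eq_mul_div,
          div_eq_iff (Nat.cast_ne_zero.2 q.den_ne_zero)] at this
        rw [mul_comm (q.den : ℤ)]
        exact_mod_cast this
      exact (Int.isCoprime_iff_gcd_eq_one.2 (Nat.Coprime.symm q.reduced)).dvd_of_dvd_mul_left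
        ⟨x j, h1⟩
    have h1 : (q.den : ℤ) ∣ 1 := hw1 ▸ Finset.dvd_gcd fun j _ => hd j
    have hden : q.den = 1 := by exact_mod_cast Int.eq_one_of_dvd_one (by positivity) h1
    refine ⟨q.num, funext fun j => ?_⟩
    have := hx j
    rw [← Rat.coe_int_num_of_den_eq_one hden] at this
    rw [Pi.smul_apply, smul_eq_mul]
    exact_mod_cast this.symm

lemma preserves_of_dvd (hq : qnorm B v ≠ 0) (h : ∀ x, qnorm B v ∣ 2 * (x ⬝ᵥ B *ᵥ v)) :
    ReflPreservesLat B v := by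
  intro x
  obtain ⟨c, hc⟩ := h x
  refine ⟨x - c • v, fun i => ?_⟩
  have hq' : (qnorm B v : ℚ) ≠ 0 := Int.cast_ne_zero.2 hq
  have : (2 * ((x ⬝ᵥ B *ᵥ v : ℤ) : ℚ)) = qnorm B v * c := by exact_mod_cast hc
  rw [this, mul_div_cancel_left₀ _ hq']
  simp

lemma qnorm_smul (c : ℤ) (v : Fin n → ℤ) : qnorm B (c • v) = c * (c * qnorm B v) := by
  rw [qnorm, qnorm, mulVec_smul, smul_dotProduct, dotProduct_smul, smul_eq_mul, smul_eq_mul]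

lemma cpair_intC_self (v : Fin n → ℤ) : cpair B (intC v) (intC v) = qnorm B v := by
  rw [intC_eq_realC, cpair_realC, rpair_intR_self, Complex.ofReal_intCast]

lemma reflC_eq (v : Fin n → ℤ) (Z : Fin n → ℂ) :
    reflC B v Z = Z - (2 * cpair B Z (intC v) / qnorm B v) • intC v := rfl

lemma cpair_reflC (hB : B.IsSymm) (hq : qnorm B v ≠ 0) (Z W : Fin n → ℂ) :
    cpair B (reflC B v Z) (reflC B v W) = cpair B Z W := by
  have hq' : (qnorm B v : ℂ) ≠ 0 := Int.cast_ne_zero.2 hq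
  simp only [reflC_eq, cpair_sub_left, cpair_sub_right, cpair_smul_left, cpair_smul_right,
    cpair_intC_self, cpair_comm hB (intC v) W]
  field_simp
  ring

lemma reflC_reflC (hq : qnorm B v ≠ 0) (Z : Fin n → ℂ) :
    reflC B v (reflC B v Z) = Z := by
  have hq' : (qnorm B v : ℂ) ≠ 0 := Int.cast_ne_zero.2 hq
  rw [reflC_eq _ (reflC B v Z)]
  simp only [reflC_eq, cpair_sub_left, cpair_smul_left, cpair_intC_self]
  rw [sub_sub, ← add_smul]
  convert sub_zero Z
  rw [smul_eq_zero]
  left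
  field_simp
  ring

lemma cj_reflC (v : Fin n → ℤ) (Z : Fin n → ℂ) : cj (reflC B v Z) = reflC B v (cj Z) := by
  have h1 : cj (intC v) = intC v := by rw [intC_eq_realC, cj_realC]
  have h2 : cpair B (cj Z) (intC v) = (starRingEnd ℂ) (cpair B Z (intC v)) := by
    rw [cpair_cj_left, h1]
  rw [reflC_eq, reflC_eq, cj_sub, cj_smul, h1, h2]
  simp [Complex.conj_ofNat]

/-- A reflection in a vector orthogonal to a point of a component preserves that component. -/
lemma reflC_image (hB : Hyp B) {D : Set (Fin n → ℂ)} (hD : IsComponent B D) (hq : qnorm B v ≠ 0)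
    {Z : Fin n → ℂ} (hZ : Z ∈ D) (ho : OrthZ B Z v) : reflC B v '' D = D := by
  have hfix : reflC B v Z = Z := by
    rw [reflC_eq, show cpair B Z (intC v) = 0 from ho]
    simp
  have hfix' : reflC B v (cj Z) = cj Z := by rw [← cj_reflC, hfix]
  have hsub : ∀ W ∈ D, reflC B v W ∈ D := by
    intro W hW
    rw [hD.mem_iff hB hZ] at hW ⊢
    refine ⟨?_, ?_⟩
    · have := hW.1
      rw [mem_cone] at *
      rwa [cj_reflC, cpair_reflC hB.symm hq, cpair_reflC hB.symm hq]
    · have := hW.2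
      have e1 := cpair_reflC hB.symm hq W Z
      have e2 := cpair_reflC hB.symm hq W (cj Z)
      rw [hfix] at e1
      rw [hfix'] at e2
      unfold Same at *
      rw [e1, e2]
      exact this
  refine Set.Subset.antisymm ?_ fun W hW => ⟨_, hsub W hW, reflC_reflC hq W⟩
  rintro _ ⟨W, hW, rfl⟩
  exact hsub W hW

end Arithmetic

section Main

variable {n r : ℕ} {B : Matrix (Fin n) (Fin n) ℤ} {L : Matrix (Fin r) (Fin r) ℤ}
  {a : Fin n → ℤ} {b : Fin r → ℤ}

lemma dsum_rank_zero {L : Matrix (Fin 0) (Fin 0) ℤ} : dsum B L = B := by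
  ext i j
  exact dsum_castAdd_castAdd B L i j

lemma intR_ne_zero (ha : a ≠ 0) : intR a ≠ 0 := fun h =>
  ha (funext fun i => by simpa [intR] using congrFun h i)

lemma IsEvenPosDef.rpair_pos (hL : IsEvenPosDef L) {x : Fin r → ℝ} (hx : x ≠ 0) :
    0 < rpair L x x := by
  rw [rpair_eq_dotProduct]
  simpa using hL.2.2.dotProduct_mulVec_pos hx

lemma IsEvenPosDef.det_ne_zero (hL : IsEvenPosDef L) : L.det ≠ 0 := fun h => by
  have h1 := hL.2.2.det_pos
  have h2 : (L.map (Int.cast : ℤ → ℝ)).det = (L.det : ℝ) := (Int.cast_det L).symm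
  rw [h2, h, Int.cast_zero] at h1
  exact lt_irrefl _ h1

lemma IsEvenPosDef.qnorm_nonneg (hL : IsEvenPosDef L) (b : Fin r → ℤ) : 0 ≤ qnorm L b := by
  by_cases hb : b = 0
  · simp [hb, qnorm]
  · have := hL.rpair_pos (intR_ne_zero hb)
    rw [rpair_intR_self] at this
    exact_mod_cast this.le

/-- A lattice vector orthogonal to a point of the cone has negative norm. -/
lemma Hyp.qnorm_neg (hB : Hyp B) {Z : Fin n → ℂ} (hZ : Z ∈ Cone B) (ha : a ≠ 0)
    (ho : OrthZ B Z a) : qnorm B a < 0 := by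
  have := hB.neg_of_orth hZ (intR_ne_zero ha) (by rwa [← intC_eq_realC])
  rw [rpair_intR_self] at this
  exact_mod_cast this

lemma qnorm_dsum_neg (a : Fin n → ℤ) (b : Fin r → ℤ) :
    qnorm (dsum B (-L)) (Fin.append a b) = qnorm B a - qnorm L b := by
  rw [qnorm_dsum, qnorm_neg_matrix, sub_eq_add_neg]

/-- The projection of a reflective vector of `M ⊕ L(-1)` to `M` is reflective up to scaling, provided
that it has negative norm. -/
lemma dvd_of_append (hL : IsEvenPosDef L) (hv : IsPrimitive (Fin.append a b))
    (hr : ReflPreservesLat (dsum B (-L)) (Fin.append a b)) (hq : qnorm B a < 0)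
    (x : Fin n → ℤ) : qnorm B a ∣ 2 * (x ⬝ᵥ B *ᵥ a) := by
  have hb := hL.qnorm_nonneg b
  have e := qnorm_dsum_neg (B := B) (L := L) a b
  have key : ∀ x, qnorm B a - qnorm L b ∣ 2 * (x ⬝ᵥ B *ᵥ a) := fun x => by
    have := qnorm_dvd_of_preserves hv hr (by rw [e]; omega) (Fin.append x 0)
    rwa [e, dotProduct_dsum, zero_dotProduct, add_zero] at this
  rcases hb.eq_or_lt with h0 | hpos
  · simpa [← h0] using key x
  · obtain ⟨m, hm⟩ := key a
    change 2 * qnorm B a = _ at hm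
    have h1 : 0 < m := by by_contra! h; nlinarith
    have h2 : m < 2 := by by_contra! h; nlinarith
    obtain rfl : m = 1 := by omega
    refine dvd_trans ⟨2, ?_⟩ (key x)
    linarith

lemma exists_reflective (hB : Hyp B) {D : Set (Fin n → ℂ)} (hD : IsComponent B D)
    {Z : Fin n → ℂ} (hZ : Z ∈ D) (ha : a ≠ 0) (ho : OrthZ B Z a)
    (h : ∀ x, qnorm B a ∣ 2 * (x ⬝ᵥ B *ᵥ a)) :
    ∃ w, IsReflectiveVector B D w ∧ OrthZ B Z w := by
  obtain ⟨c, w, hc, rfl, hw⟩ := exists_primitive ha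
  have how : OrthZ B Z w := by
    have e : intC (c • w) = (c : ℂ) • intC w := by
      ext i
      simp [intC]
    rw [OrthZ, e, cpair_smul_right] at ho
    exact (mul_eq_zero.1 ho).resolve_left (Int.cast_ne_zero.2 hc)
  have hneg := hB.qnorm_neg (hD.subset hZ) hw.1 how
  refine ⟨w, ⟨hw, hneg, preserves_of_dvd hneg.ne fun x => ?_, reflC_image hB hD hneg.ne hZ how⟩,
    how⟩
  have h1 := h x
  rw [qnorm_smul, mulVec_smul, dotProduct_smul, smul_eq_mul, mul_left_comm (2 : ℤ)] at h1
  exact (dvd_mul_left _ _).trans (Int.dvd_of_mul_dvd_mul_left hc h1)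

end Main

/-- If M ⊕ L(−1) is reflective (resp. 2-reflective), then so is M. -/
theorem reflectivity_descends {N n rL : ℕ} (B : Matrix (Fin N) (Fin N) ℤ)
    (hB : IsEvenLatticeOfSignature B 2 n) (hn : 3 ≤ n)
    (L : Matrix (Fin rL) (Fin rL) ℤ) (hL : IsEvenPosDef L) :
    (IsReflective (dsum B (-L)) → IsReflective B) ∧
    (Is2Reflective (dsum B (-L)) → Is2Reflective B) := by
  rcases rL with _ | r
  · rw [dsum_rank_zero]
    exact ⟨id, id⟩
  obtain ⟨hH, hne⟩ := hyp_of_signature hB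
  have hH' := hH.dsum_neg hL.1 fun x hx => hL.rpair_pos hx
  have hnr : 6 ≤ N + (r + 1) := by
    have := hB.1
    omega
  have hdet := hB.2.2.2.1
  refine ⟨?_, ?_⟩
  · rintro ⟨D', hD', Γ', χ', k', F, hΓ, hχ, hF, hFn, hz⟩
    have hdet' : (dsum B (-L)).det ≠ 0 := by
      rw [dsum_det, det_neg]
      exact mul_ne_zero hdet (mul_ne_zero (pow_ne_zero _ (by norm_num)) hL.det_ne_zero)
    obtain ⟨D, hD, Γ, χ, k, G, h1, h2, h3, h4, h5⟩ :=
      exists_descent (V := {v | IsReflectiveVector (dsum B (-L)) D' v})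
        (C := |2 * (dsum B (-L)).det|) hH hdet hne hH' hL.det_ne_zero hnr hD' hΓ hχ hF hFn
        (fun v hv => ⟨hv.1.1, by
          have := Int.le_of_dvd (abs_pos.2 (mul_ne_zero two_ne_zero hdet'))
            ((neg_dvd.2 (qnorm_dvd_det hv.1 hv.2.2.1 hv.2.1.ne)).trans (self_dvd_abs _))
          linarith⟩) hz
    refine ⟨D, hD, Γ, χ, k, G, h1, h2, h3, h4, fun Z hZ h0 => ?_⟩
    obtain ⟨a, b, ha, hv, ho⟩ := h5 Z hZ h0
    exact exists_reflective hH hD hZ ha ho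
      (dvd_of_append hL hv.1 hv.2.2.1 (hH.qnorm_neg (hD.subset hZ) ha ho))
  · rintro ⟨D', hD', Γ', χ', k', F, hΓ, hχ, hF, hFn, hz⟩
    obtain ⟨D, hD, Γ, χ, k, G, h1, h2, h3, h4, h5⟩ :=
      exists_descent (V := {v | qnorm (dsum B (-L)) v = -2}) (C := 2) hH hdet hne hH'
        hL.det_ne_zero hnr hD' hΓ hχ hF hFn
        (fun v (hv : qnorm _ v = -2) => ⟨by rintro rfl; simp [qnorm] at hv, hv.ge⟩) hz
    refine ⟨D, hD, Γ, χ, k, G, h1, h2, h3, h4, fun Z hZ h0 => ?_⟩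
    obtain ⟨a, b, ha, hv : qnorm _ _ = -2, ho⟩ := h5 Z hZ h0
    refine ⟨a, ?_, ho⟩
    rw [qnorm_dsum_neg] at hv
    have e1 := hH.qnorm_neg (hD.subset hZ) ha ho
    have e2 := hL.qnorm_nonneg b
    have e3 := hB.2.2.1 a
    omega

end Refl
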